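/- Let q ∈ [1,∞) and let γ = (γ_1,…,γ_d) satisfy 1 = γ_1 = … = γ_ν < γ_{ν+1} ≤ … ≤ γ_d with ν ∈ ℕ, ν ≤ d. Define w(ν,1) = 3; w(ν,q) = 2 for q ∈ (1,2]; and w(ν,q) = (ν−1)(q−2) + min(q,3) for q > 2. Then there exist positive constants C1, C2, C3 depending only on q and γ such that for every n ∈ ℕ and every m ≥ C1·|Q_n^γ|·n^{w(ν,q)} there exist points ξ^1, …, ξ^m ∈ 𝕋^d with C2·‖f‖_q^q ≤ (1/m)·∑_{j=1}^m |f(ξ^j)|^q ≤ C3·‖f‖_q^q for all f ∈ T(Q_n^γ). -/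

import Mathlib

noncomputable section
open MeasureTheory

/-- The fundamental cell `[0, 2π)^d` of the torus `𝕋^d`. -/
def torusCell (d : ℕ) : Set (Fin d → ℝ) := Set.univ.pi fun _ => Set.Ico 0 (2 * Real.pi)

/-- Normalized Lebesgue (probability) measure on the torus `𝕋^d = [0,2π)^d`. -/
def torusMeasure (d : ℕ) : Measure (Fin d → ℝ) :=
  (ENNReal.ofReal ((2 * Real.pi) ^ d))⁻¹ • (volume.restrict (torusCell d))

/-- The `L_q` norm on the torus with respect to the normalized Lebesgue measure. -/
def torusLq (d : ℕ) (q : ℝ) {E : Type*} [NormedAddCommGroup E] (f : (Fin d → ℝ) → E) : ℝ :=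
  (∫ x, ‖f x‖ ^ q ∂(torusMeasure d)) ^ (1 / q)

/-- The step hyperbolic cross `Q_n^γ = ∪_{s : (γ,s) ≤ n} ρ(s)` where
`ρ(s) = {k : ⌊2^{s_j-1}⌋ ≤ |k_j| < 2^{s_j}}`. -/
def hyperbolicCross (d : ℕ) (γ : Fin d → ℝ) (n : ℕ) : Set (Fin d → ℤ) :=
  {k | ∃ s : Fin d → ℕ, (∑ j, γ j * (s j : ℝ)) ≤ (n : ℝ) ∧
    ∀ j, ⌊(2 : ℝ) ^ ((s j : ℤ) - 1)⌋ ≤ |k j| ∧ |k j| < 2 ^ (s j)}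

/-- `f` is a trigonometric polynomial with frequencies in `Q`. -/
def IsTrigPoly (d : ℕ) (Q : Set (Fin d → ℤ)) (f : (Fin d → ℝ) → ℂ) : Prop :=
  ∃ F : Finset (Fin d → ℤ), ↑F ⊆ Q ∧ ∃ c : (Fin d → ℤ) → ℂ,
    ∀ x, f x = ∑ k ∈ F, c k * Complex.exp (Complex.I * ∑ j, (k j : ℂ) * (x j : ℂ))



/-! ### Basics on the torus -/

/-- The exponential with frequency `k`. -/
def ee {d : ℕ} (k : Fin d → ℤ) (x : Fin d → ℝ) : ℂ :=
  Complex.exp (Complex.I * ∑ j, (k j : ℂ) * (x j : ℂ))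

lemma measurableSet_torusCell (d : ℕ) : MeasurableSet (torusCell d) :=
  MeasurableSet.univ_pi fun _ => measurableSet_Ico

lemma volume_torusCell (d : ℕ) : volume (torusCell d) = ENNReal.ofReal ((2 * Real.pi) ^ d) := by
  unfold torusCell
  rw [volume_pi_pi]
  simp [ENNReal.ofReal_pow Real.two_pi_pos.le]

instance torusMeasure_prob (d : ℕ) : IsProbabilityMeasure (torusMeasure d) := by
  constructor
  unfold torusMeasure
  rw [Measure.smul_apply, Measure.restrict_apply MeasurableSet.univ, Set.univ_inter,
    volume_torusCell, smul_eq_mul]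
  apply ENNReal.inv_mul_cancel
  · have := Real.two_pi_pos
    simp only [ne_eq, ENNReal.ofReal_eq_zero, not_le]
    positivity
  · exact ENNReal.ofReal_ne_top

lemma torusMeasure_compl (d : ℕ) : torusMeasure d (torusCell d)ᶜ = 0 := by
  unfold torusMeasure
  rw [Measure.smul_apply, Measure.restrict_apply (measurableSet_torusCell d).compl]
  simp

lemma ee_norm {d : ℕ} (k : Fin d → ℤ) (x : Fin d → ℝ) : ‖ee k x‖ = 1 := by
  unfold ee
  have : Complex.I * ∑ j, (k j : ℂ) * (x j : ℂ) = ((∑ j, (k j : ℝ) * x j : ℝ) : ℂ) * Complex.I := by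
    push_cast; ring
  rw [this, Complex.norm_exp_ofReal_mul_I]

lemma ee_add {d : ℕ} (k l : Fin d → ℤ) (x : Fin d → ℝ) : ee (k + l) x = ee k x * ee l x := by
  unfold ee
  rw [← Complex.exp_add, ← mul_add, ← Finset.sum_add_distrib]
  congr 2
  apply Finset.sum_congr rfl
  intro j _
  simp; ring

lemma ee_zero {d : ℕ} (x : Fin d → ℝ) : ee (0 : Fin d → ℤ) x = 1 := by
  simp [ee]

lemma ee_neg {d : ℕ} (k : Fin d → ℤ) (x : Fin d → ℝ) : ee (-k) x = (starRingEnd ℂ) (ee k x) := by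
  unfold ee
  rw [← Complex.exp_conj]
  congr 1
  simp

lemma ee_sub {d : ℕ} (k l : Fin d → ℤ) (x : Fin d → ℝ) :
    ee (k - l) x = ee k x * (starRingEnd ℂ) (ee l x) := by
  rw [sub_eq_add_neg, ee_add, ee_neg]

lemma ee_sub_arg {d : ℕ} (k : Fin d → ℤ) (x y : Fin d → ℝ) :
    ee k (x - y) = ee k x * ee (-k) y := by
  unfold ee
  rw [← Complex.exp_add, ← mul_add, ← Finset.sum_add_distrib]
  congr 2
  apply Finset.sum_congr rfl
  intro j _
  simp; ring

lemma ee_continuous {d : ℕ} (k : Fin d → ℤ) : Continuous (ee k) := by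
  unfold ee
  fun_prop

lemma integral_exp_Ico (k : ℤ) :
    ∫ x in Set.Ico 0 (2 * Real.pi), Complex.exp (Complex.I * ((k : ℂ) * (x : ℂ)))
      = if k = 0 then ((2 * Real.pi : ℝ) : ℂ) else 0 := by
  rw [integral_Ico_eq_integral_Ioc, ← intervalIntegral.integral_of_le Real.two_pi_pos.le]
  split_ifs with h
  · simp [h]
  · have hc : (Complex.I * k : ℂ) ≠ 0 := by simp [h]
    have := integral_exp_mul_complex (a := 0) (b := 2 * Real.pi) hc
    have h2 : ∀ x : ℝ, Complex.exp (Complex.I * ((k : ℂ) * (x : ℂ)))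
      = Complex.exp (Complex.I * (k : ℂ) * (x : ℂ)) := fun x => by rw [mul_assoc]
    simp_rw [h2]
    rw [this]
    have h3 : Complex.exp (Complex.I * k * ((2 * Real.pi : ℝ) : ℂ)) = 1 := by
      rw [Complex.exp_eq_one_iff]
      exact ⟨k, by push_cast; ring⟩
    rw [h3]; simp

lemma integral_ee {d : ℕ} (k : Fin d → ℤ) :
    ∫ x, ee k x ∂(torusMeasure d) = if k = 0 then 1 else 0 := by
  unfold torusMeasure
  rw [integral_smul_measure]
  unfold torusCell
  rw [volume_pi, Measure.restrict_pi_pi]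
  have h1 : ∀ x : Fin d → ℝ, ee k x
      = ∏ j, Complex.exp (Complex.I * ((k j : ℂ) * (x j : ℂ))) := by
    intro x
    unfold ee
    rw [← Complex.exp_sum, Finset.mul_sum]
  simp_rw [h1]
  rw [integral_fintype_prod_eq_prod
    (f := fun (j : Fin d) (y : ℝ) => Complex.exp (Complex.I * ((k j : ℂ) * (y : ℂ))))]
  simp_rw [integral_exp_Ico]
  have hpi := Real.two_pi_pos
  rw [ENNReal.toReal_inv, ENNReal.toReal_ofReal (by positivity)]
  split_ifs with h
  · subst h
    simp only [Pi.zero_apply, if_true, Finset.prod_const, Finset.card_univ, Fintype.card_fin]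
    rw [Complex.real_smul]
    push_cast
    rw [inv_mul_cancel₀]
    have : (Real.pi : ℂ) ≠ 0 := by exact_mod_cast Real.pi_ne_zero
    exact pow_ne_zero _ (mul_ne_zero two_ne_zero this)
  · have : ∃ j, k j ≠ 0 := by
      by_contra hh
      push Not at hh
      exact h (funext hh)
    obtain ⟨j, hj⟩ := this
    rw [Finset.prod_eq_zero (Finset.mem_univ j) (by simp [hj])]
    simp

/-- Fourier coefficient. -/
def fc {d : ℕ} (h : (Fin d → ℝ) → ℂ) (k : Fin d → ℤ) : ℂ :=
  ∫ y, h y * ee (-k) y ∂(torusMeasure d)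

lemma bdd_integrable {d : ℕ} {E : Type*} [NormedAddCommGroup E] {h : (Fin d → ℝ) → E}
    (hm : AEStronglyMeasurable h (torusMeasure d)) {B : ℝ} (hB : ∀ x, ‖h x‖ ≤ B) :
    Integrable h (torusMeasure d) :=
  Integrable.of_bound hm B (Filter.Eventually.of_forall hB)

lemma integrable_mul_ee {d : ℕ} {h : (Fin d → ℝ) → ℂ}
    (hm : Measurable h) {B : ℝ} (hB : ∀ x, ‖h x‖ ≤ B) (k : Fin d → ℤ) :
    Integrable (fun y => h y * ee k y) (torusMeasure d) := by
  apply bdd_integrable (B := B)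
  · exact (hm.mul (ee_continuous k).measurable).aestronglyMeasurable
  · intro x
    rw [norm_mul, ee_norm, mul_one]; exact hB x

/-- Trigonometric sums. -/
def ts {d : ℕ} (F : Finset (Fin d → ℤ)) (c : (Fin d → ℤ) → ℂ) (x : Fin d → ℝ) : ℂ :=
  ∑ k ∈ F, c k * ee k x

lemma ts_continuous {d : ℕ} (F : Finset (Fin d → ℤ)) (c : (Fin d → ℤ) → ℂ) :
    Continuous (ts F c) := by
  unfold ts
  exact continuous_finsetSum _ fun k _ => continuous_const.mul (ee_continuous k)

lemma ts_bound {d : ℕ} (F : Finset (Fin d → ℤ)) (c : (Fin d → ℤ) → ℂ) (x : Fin d → ℝ) :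
    ‖ts F c x‖ ≤ ∑ k ∈ F, ‖c k‖ := by
  unfold ts
  refine (norm_sum_le _ _).trans (Finset.sum_le_sum fun k _ => ?_)
  rw [norm_mul, ee_norm, mul_one]

lemma fc_ts {d : ℕ} (F : Finset (Fin d → ℤ)) (c : (Fin d → ℤ) → ℂ) (k : Fin d → ℤ) :
    fc (ts F c) k = if k ∈ F then c k else 0 := by
  unfold fc ts
  have : ∀ y : Fin d → ℝ, (∑ l ∈ F, c l * ee l y) * ee (-k) y = ∑ l ∈ F, c l * ee (l - k) y := by
    intro y
    rw [Finset.sum_mul]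
    apply Finset.sum_congr rfl
    intro l _
    rw [sub_eq_add_neg, ee_add]; ring
  simp_rw [this]
  rw [integral_finsetSum]
  · simp_rw [integral_const_mul, integral_ee, sub_eq_zero]
    simp
  · intro l _
    apply Integrable.const_mul
    exact bdd_integrable (ee_continuous _).aestronglyMeasurable (B := 1) (fun x => (ee_norm _ x).le)

lemma bessel {d : ℕ} {h : (Fin d → ℝ) → ℂ} (hm : Measurable h) {B : ℝ} (hB : ∀ x, ‖h x‖ ≤ B)
    (F : Finset (Fin d → ℤ)) :
    ∑ k ∈ F, ‖fc h k‖ ^ 2 ≤ ∫ x, ‖h x‖ ^ 2 ∂(torusMeasure d) := by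
  classical
  set P := ts F (fc h) with hP
  set S := ∑ k ∈ F, ‖fc h k‖ ^ 2 with hS
  have hPc : Continuous P := ts_continuous _ _
  have hPb : ∀ x, ‖P x‖ ≤ ∑ k ∈ F, ‖fc h k‖ := ts_bound _ _
  set BP := ∑ k ∈ F, ‖fc h k‖
  have hB0 : 0 ≤ B := (norm_nonneg _).trans (hB 0)
  have hBP0 : 0 ≤ BP := Finset.sum_nonneg fun _ _ => norm_nonneg _
  -- general: inner product with P
  have key : ∀ g : (Fin d → ℝ) → ℂ, Measurable g → (∃ B, ∀ x, ‖g x‖ ≤ B) →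
      ∫ x, g x * (starRingEnd ℂ) (P x) ∂(torusMeasure d)
        = ∑ k ∈ F, (starRingEnd ℂ) (fc h k) * fc g k := by
    intro g hg ⟨B', hB'⟩
    have : ∀ x, g x * (starRingEnd ℂ) (P x)
        = ∑ k ∈ F, (starRingEnd ℂ) (fc h k) * (g x * ee (-k) x) := by
      intro x
      simp only [hP, ts, map_sum, map_mul, Finset.mul_sum, ee_neg]
      apply Finset.sum_congr rfl
      intro k _; ring
    simp_rw [this]
    rw [integral_finsetSum]
    · simp_rw [integral_const_mul]; rfl
    · intro k _
      exact (integrable_mul_ee hg hB' _).const_mul _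
  have e1 := key h hm ⟨B, hB⟩
  have e2 := key P hPc.measurable ⟨_, hPb⟩
  have s1 : ∑ k ∈ F, (starRingEnd ℂ) (fc h k) * fc h k = (S : ℂ) := by
    rw [hS]; push_cast
    apply Finset.sum_congr rfl
    intro k _
    rw [Complex.conj_mul']
  have s2 : ∑ k ∈ F, (starRingEnd ℂ) (fc h k) * fc P k = (S : ℂ) := by
    rw [← s1]
    apply Finset.sum_congr rfl
    intro k hk
    rw [hP, fc_ts, if_pos hk]
  rw [s1] at e1
  rw [s2] at e2
  have i1 : Integrable (fun x => ‖h x‖ ^ 2) (torusMeasure d) :=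
    bdd_integrable (hm.norm.pow_const 2).aestronglyMeasurable (B := B ^ 2) (fun x => by
      rw [norm_pow, norm_norm]; exact pow_le_pow_left₀ (norm_nonneg _) (hB x) 2)
  have i2 : Integrable (fun x => h x * (starRingEnd ℂ) (P x)) (torusMeasure d) :=
    bdd_integrable (hm.mul (Complex.continuous_conj.comp hPc).measurable).aestronglyMeasurable
      (B := B * BP) (fun x => by
        rw [norm_mul, RCLike.norm_conj]
        exact mul_le_mul (hB x) (hPb x) (norm_nonneg _) hB0)
  have i3 : Integrable (fun x => P x * (starRingEnd ℂ) (P x)) (torusMeasure d) :=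
    bdd_integrable (hPc.measurable.mul
      (Complex.continuous_conj.comp hPc).measurable).aestronglyMeasurable
      (B := BP * BP) (fun x => by
        rw [norm_mul, RCLike.norm_conj]
        exact mul_le_mul (hPb x) (hPb x) (norm_nonneg _) hBP0)
  have r1 : ∫ x, (h x * (starRingEnd ℂ) (P x)).re ∂(torusMeasure d) = S := by
    have := integral_re i2
    simp only [RCLike.re_to_complex] at this
    rw [this, e1]; simp
  have r2 : ∫ x, (P x * (starRingEnd ℂ) (P x)).re ∂(torusMeasure d) = S := by
    have := integral_re i3
    simp only [RCLike.re_to_complex] at this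
    rw [this, e2]; simp
  have pos : 0 ≤ ∫ x, (‖h x‖ ^ 2 - 2 * (h x * (starRingEnd ℂ) (P x)).re
      + (P x * (starRingEnd ℂ) (P x)).re) ∂(torusMeasure d) := by
    apply integral_nonneg
    intro x
    have : ‖h x‖ ^ 2 - 2 * (h x * (starRingEnd ℂ) (P x)).re
      + (P x * (starRingEnd ℂ) (P x)).re = ‖h x - P x‖ ^ 2 := by
      rw [← Complex.normSq_eq_norm_sq, ← Complex.normSq_eq_norm_sq]
      simp [Complex.normSq_apply]; ring
    simp only [Pi.zero_apply]
    rw [this]; positivity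
  have j2 : Integrable (fun x => (h x * (starRingEnd ℂ) (P x)).re) (torusMeasure d) := i2.re
  have j3 : Integrable (fun x => (P x * (starRingEnd ℂ) (P x)).re) (torusMeasure d) := i3.re
  have j4 : Integrable (fun x => ‖h x‖ ^ 2 - 2 * (h x * (starRingEnd ℂ) (P x)).re)
      (torusMeasure d) := i1.sub (j2.const_mul 2)
  rw [integral_add j4 j3, integral_sub i1 (j2.const_mul 2),
    integral_const_mul, r1, r2] at pos
  linarith


/-! ### Dual Sudakov inequality -/

section DS
variable {ι : Type*} [Fintype ι]

def gw (y : ι → ℝ) : ℝ := Real.exp (-(y ⬝ᵥ y) / 2)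

lemma gw_pos (y : ι → ℝ) : 0 < gw y := Real.exp_pos _

lemma gw_cont : Continuous (gw : (ι → ℝ) → ℝ) := by
  unfold gw dotProduct
  fun_prop

lemma gw_integrable : Integrable (gw : (ι → ℝ) → ℝ) := by
  have h := (GaussianFourier.integrable_cexp_neg_mul_sum_add (ι := ι) (b := 1 / 2)
    (by norm_num) (fun _ => 0)).norm
  refine h.congr (Filter.Eventually.of_forall fun v => ?_)
  simp only [Complex.norm_exp, gw, dotProduct]
  congr 1
  have : (-(1 / 2 : ℂ) * ∑ i, (v i : ℂ) ^ 2 + ∑ i, 0 * (v i : ℂ))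
    = ((-(∑ i, v i * v i) / 2 : ℝ) : ℂ) := by
    push_cast
    simp only [zero_mul, Finset.sum_const_zero, add_zero, pow_two]
    ring
  rw [this, Complex.ofReal_re]

lemma gw_shift (y b : ι → ℝ) :
    gw (y - b) = Real.exp (-(b ⬝ᵥ b) / 2) * (gw y * Real.exp (y ⬝ᵥ b)) := by
  unfold gw
  rw [← Real.exp_add, ← Real.exp_add]
  congr 1
  simp only [sub_dotProduct, dotProduct_sub]
  rw [dotProduct_comm b y]
  ring

lemma gw_exp_integral (b : ι → ℝ) :
    Integrable (fun y => gw y * Real.exp (y ⬝ᵥ b)) ∧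
    ∫ y, gw y * Real.exp (y ⬝ᵥ b) = Real.exp ((b ⬝ᵥ b) / 2) * ∫ y : ι → ℝ, gw y := by
  have e : (fun y => gw y * Real.exp (y ⬝ᵥ b))
      = fun y => Real.exp ((b ⬝ᵥ b) / 2) * gw (y - b) := by
    funext y
    rw [gw_shift, ← mul_assoc, ← Real.exp_add]
    have : b ⬝ᵥ b / 2 + -(b ⬝ᵥ b) / 2 = 0 := by ring
    rw [this]; simp
  constructor
  · rw [e]
    exact (gw_integrable.comp_sub_right b).const_mul _
  · rw [e, integral_const_mul, integral_sub_right_eq_self (fun y => gw y) b]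

lemma gw_Z_pos : 0 < ∫ y : ι → ℝ, gw y := by
  rw [integral_pos_iff_support_of_nonneg (fun y => (gw_pos y).le) gw_integrable]
  have : Function.support (gw : (ι → ℝ) → ℝ) = Set.univ := by
    ext y; simp [(gw_pos y).ne']
  rw [this]
  exact isOpen_univ.measure_pos volume Set.univ_nonempty

lemma gw_sym_shift {χ : (ι → ℝ) → ℝ} (hχm : Measurable χ) (h0 : ∀ y, 0 ≤ χ y) (h1 : ∀ y, χ y ≤ 1)
    (hs : ∀ y, χ (-y) = χ y) (a : ι → ℝ) :
    Real.exp (-(a ⬝ᵥ a) / 2) * ∫ y, gw y * χ y ≤ ∫ z, gw z * χ (z - a) := by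
  have int : ∀ b : ι → ℝ, Integrable (fun z => gw (z - b) * χ z) := by
    intro b
    refine (gw_integrable.comp_sub_right b).mul_bdd (c := 1) hχm.aestronglyMeasurable
      (Filter.Eventually.of_forall fun y => ?_)
    rw [Real.norm_of_nonneg (h0 y)]; exact h1 y
  have e1 : ∫ z, gw z * χ (z - a) = ∫ z, gw (z - (-a)) * χ z := by
    rw [← integral_add_right_eq_self _ a]
    simp
  have e2 : ∫ z, gw (z - (-a)) * χ z = ∫ z, gw (z - a) * χ z := by
    rw [← integral_neg_eq_self]
    congr 1; funext z
    rw [hs]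
    congr 1
    unfold gw
    have : -z - -a = -(z - a) := by abel
    rw [this, neg_dotProduct, dotProduct_neg, neg_neg]
  have i0 : Integrable (fun z => gw z * χ z) := by simpa using int 0
  rw [← integral_const_mul]
  have : ∫ z, gw z * χ (z - a) = ∫ z, (1 / 2 : ℝ) * (gw (z - (-a)) * χ z + gw (z - a) * χ z) := by
    rw [integral_const_mul, integral_add (int _) (int _), e1, e2]; ring
  rw [this]
  apply integral_mono (i0.const_mul _) (((int _).add (int _)).const_mul _)
  intro z
  simp only [Pi.add_apply]
  rw [gw_shift, gw_shift]
  simp only [dotProduct_neg, neg_dotProduct, neg_neg]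
  have hc : 1 ≤ (Real.exp (z ⬝ᵥ a) + Real.exp (-(z ⬝ᵥ a))) / 2 := by
    rw [← Real.cosh_eq]; exact Real.one_le_cosh _
  have : 0 ≤ Real.exp (-(a ⬝ᵥ a) / 2) * (gw z * χ z) := by
    have := h0 z; have := gw_pos z; positivity
  nlinarith

lemma ds_packing {Ω : Type*} [Fintype Ω] [Nonempty Ω] (Φ : Ω → ι → ℝ) {V t : ℝ} (hV : 0 < V)
    (ht : 0 < t) (hΦ : ∀ ω, Φ ω ⬝ᵥ Φ ω ≤ V) (Y : Finset (ι → ℝ)) (hY : ∀ y ∈ Y, y ⬝ᵥ y ≤ 1)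
    (hsep : ∀ x ∈ Y, ∀ y ∈ Y, x ≠ y → ∃ ω, t < |(x - y) ⬝ᵥ Φ ω|) :
    (Y.card : ℝ) ≤ 2 * Real.exp (4 * V * Real.log (4 * Fintype.card Ω) / t ^ 2) := by
  classical
  set M : ℝ := (Fintype.card Ω : ℝ) with hM
  have hM1 : 1 ≤ M := by
    rw [hM]; exact_mod_cast Fintype.card_pos
  set L := Real.log (4 * M) with hL
  have hLpos : 0 < L := Real.log_pos (by linarith)
  set R := Real.sqrt (2 * V * L) with hR
  have hR2 : R ^ 2 = 2 * V * L := Real.sq_sqrt (by positivity)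
  have hRpos : 0 < R := Real.sqrt_pos.mpr (by positivity)
  set lam := 2 * R / t with hlam
  set Z := ∫ y : ι → ℝ, gw y with hZ
  have hZpos : 0 < Z := gw_Z_pos
  let S : Set (ι → ℝ) := {y | ∀ ω, |y ⬝ᵥ Φ ω| ≤ R}
  have hSm : MeasurableSet S := by
    have : S = ⋂ ω, {y | |y ⬝ᵥ Φ ω| ≤ R} := by ext; simp [S]
    rw [this]
    refine MeasurableSet.iInter fun ω => ?_
    apply IsClosed.measurableSet
    apply isClosed_le _ continuous_const
    unfold dotProduct
    fun_prop
  set χ : (ι → ℝ) → ℝ := S.indicator 1 with hχ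
  have hχm : Measurable χ := measurable_one.indicator hSm
  have χ0 : ∀ y, 0 ≤ χ y := fun y => Set.indicator_nonneg (by simp) y
  have χ1 : ∀ y, χ y ≤ 1 := fun y => Set.indicator_le_self' (by simp) y
  have χs : ∀ y, χ (-y) = χ y := by
    intro y
    have : -y ∈ S ↔ y ∈ S := by simp [S]
    by_cases h : y ∈ S
    · rw [hχ, Set.indicator_of_mem h, Set.indicator_of_mem (this.2 h)]; rfl
    · rw [hχ, Set.indicator_of_notMem h, Set.indicator_of_notMem (fun h' => h (this.1 h'))]
  have intχ : ∀ a : ι → ℝ, Integrable (fun z => gw z * χ (z - a)) := by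
    intro a
    refine gw_integrable.mul_bdd (c := 1) (hχm.comp (measurable_sub_const a)).aestronglyMeasurable
      (Filter.Eventually.of_forall fun y => ?_)
    rw [Real.norm_of_nonneg (χ0 _)]; exact χ1 _
  have intχ0 : Integrable (fun z => gw z * χ z) := by simpa using intχ 0
  -- mass of S
  set θ := R / V with hθ
  have mass : Z / 2 ≤ ∫ y, gw y * χ y := by
    have pw : ∀ y, gw y ≤ gw y * χ y + ∑ ω, (Real.exp (-(θ * R)) *
        (gw y * Real.exp (y ⬝ᵥ (θ • Φ ω))) + Real.exp (-(θ * R)) *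
        (gw y * Real.exp (y ⬝ᵥ (-(θ • Φ ω))))) := by
      intro y
      have nn : ∀ ω, 0 ≤ (Real.exp (-(θ * R)) *
        (gw y * Real.exp (y ⬝ᵥ (θ • Φ ω))) + Real.exp (-(θ * R)) *
        (gw y * Real.exp (y ⬝ᵥ (-(θ • Φ ω))))) := by
        intro ω; have := gw_pos y; positivity
      by_cases h : y ∈ S
      · rw [hχ, Set.indicator_of_mem h]
        have := Finset.sum_nonneg (s := Finset.univ) fun ω _ => nn ω
        simp only [Pi.one_apply, mul_one]
        linarith
      · rw [hχ, Set.indicator_of_notMem h, mul_zero, zero_add]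
        have : ∃ ω, R < |y ⬝ᵥ Φ ω| := by
          by_contra hh; push Not at hh; exact h hh
        obtain ⟨ω, hω⟩ := this
        refine le_trans ?_ (Finset.single_le_sum (fun ω _ => nn ω) (Finset.mem_univ ω))
        have hθ0 : 0 < θ := by positivity
        simp only [dotProduct_neg, dotProduct_smul, smul_eq_mul]
        have g := gw_pos y
        rcases lt_abs.1 hω with h' | h'
        · have : 1 ≤ Real.exp (-(θ * R)) * Real.exp (θ * (y ⬝ᵥ Φ ω)) := by
            rw [← Real.exp_add]; apply Real.one_le_exp; nlinarith
          have h2 : 0 < Real.exp (-(θ * R)) * (gw y * Real.exp (-(θ * (y ⬝ᵥ Φ ω)))) := by positivity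
          nlinarith
        · have : 1 ≤ Real.exp (-(θ * R)) * Real.exp (-(θ * (y ⬝ᵥ Φ ω))) := by
            rw [← Real.exp_add]; apply Real.one_le_exp; nlinarith
          have h2 : 0 < Real.exp (-(θ * R)) * (gw y * Real.exp ((θ * (y ⬝ᵥ Φ ω)))) := by positivity
          nlinarith
    have ie : ∀ b : ι → ℝ, Integrable (fun y => Real.exp (-(θ * R)) *
        (gw y * Real.exp (y ⬝ᵥ b))) := fun b => (gw_exp_integral b).1.const_mul _
    have iw : ∀ ω : Ω, Integrable (fun y => Real.exp (-(θ * R)) *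
        (gw y * Real.exp (y ⬝ᵥ (θ • Φ ω))) + Real.exp (-(θ * R)) *
        (gw y * Real.exp (y ⬝ᵥ (-(θ • Φ ω))))) := fun ω => (ie _).add (ie _)
    have h1 : Z ≤ ∫ y, (gw y * χ y + ∑ ω, (Real.exp (-(θ * R)) *
        (gw y * Real.exp (y ⬝ᵥ (θ • Φ ω))) + Real.exp (-(θ * R)) *
        (gw y * Real.exp (y ⬝ᵥ (-(θ • Φ ω)))))) :=
      integral_mono gw_integrable (intχ0.add (integrable_finsetSum _ fun ω _ =>
        iw ω)) pw
    rw [integral_add intχ0 (integrable_finsetSum _ fun ω _ => iw ω),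
      integral_finsetSum _ (fun ω _ => iw ω)] at h1
    have h2 : ∀ ω, ∫ y, (Real.exp (-(θ * R)) *
        (gw y * Real.exp (y ⬝ᵥ (θ • Φ ω))) + Real.exp (-(θ * R)) *
        (gw y * Real.exp (y ⬝ᵥ (-(θ • Φ ω))))) ≤ 2 * (1 / (4 * M)) * Z := by
      intro ω
      rw [integral_add (ie _) (ie _), integral_const_mul, integral_const_mul,
        (gw_exp_integral _).2, (gw_exp_integral _).2]
      simp only [dotProduct_neg, neg_dotProduct, dotProduct_smul, smul_dotProduct,
        smul_eq_mul, mul_neg, neg_neg]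
      rw [← hZ]
      have : Real.exp (-(θ * R)) * Real.exp (θ * (θ * (Φ ω ⬝ᵥ Φ ω)) / 2) ≤ 1 / (4 * M) := by
        rw [← Real.exp_add, one_div, ← Real.exp_log (show 0 < 4 * M by linarith), ← Real.exp_neg,
          ← hL]
        apply Real.exp_le_exp.mpr
        have e1 : θ * R = 2 * L := by
          rw [hθ]; field_simp; linarith
        have e2 : θ * (θ * (Φ ω ⬝ᵥ Φ ω)) ≤ θ * (θ * V) := by
          have : 0 < θ := by positivity
          have := hΦ ω
          gcongr
        have e3 : θ * (θ * V) = 2 * L := by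
          rw [hθ]; field_simp; linarith
        linarith
      nlinarith
    have h3 := Finset.sum_le_sum (s := Finset.univ) fun ω _ => h2 ω
    rw [Finset.sum_const, Finset.card_univ, nsmul_eq_mul, ← hM] at h3
    have : M * (2 * (1 / (4 * M)) * Z) = Z / 2 := by field_simp; ring
    linarith
  -- packing
  have tot : ∑ x ∈ Y, ∫ z, gw z * χ (z - lam • x) ≤ Z := by
    rw [← integral_finsetSum _ (fun x _ => intχ _)]
    apply integral_mono (integrable_finsetSum _ fun x _ => intχ _) gw_integrable
    intro z
    simp only
    rw [← Finset.mul_sum]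
    have : ∑ x ∈ Y, χ (z - lam • x) ≤ 1 := by
      by_cases hex : ∃ x ∈ Y, z - lam • x ∈ S
      · obtain ⟨x, hx, hxS⟩ := hex
        rw [Finset.sum_eq_single_of_mem x hx]
        · exact χ1 _
        · intro y hy hyx
          rw [hχ, Set.indicator_of_notMem]
          intro hyS
          obtain ⟨ω, hω⟩ := hsep x hx y hy hyx.symm
          have a1 := hxS ω
          have a2 := hyS ω
          have : lam * ((x - y) ⬝ᵥ Φ ω) = (z - lam • y) ⬝ᵥ Φ ω - (z - lam • x) ⬝ᵥ Φ ω := by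
            simp only [sub_dotProduct, smul_dotProduct, smul_eq_mul]; ring
          have h3 : |lam * ((x - y) ⬝ᵥ Φ ω)| ≤ 2 * R := by
            rw [this]
            have := abs_sub ((z - lam • y) ⬝ᵥ Φ ω) ((z - lam • x) ⬝ᵥ Φ ω)
            linarith
          have lpos : 0 < lam := by positivity
          rw [abs_mul, abs_of_pos lpos] at h3
          have : lam * t = 2 * R := by rw [hlam]; field_simp
          nlinarith
      · push Not at hex
        rw [Finset.sum_eq_zero]
        · norm_num
        · intro x hx
          rw [hχ, Set.indicator_of_notMem (hex x hx)]
    have := gw_pos z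
    nlinarith
  have each : ∀ x ∈ Y, Real.exp (-(lam ^ 2) / 2) * (Z / 2) ≤ ∫ z, gw z * χ (z - lam • x) := by
    intro x hx
    refine le_trans ?_ (gw_sym_shift hχm χ0 χ1 χs (lam • x))
    simp only [smul_dotProduct, dotProduct_smul, smul_eq_mul]
    have : Real.exp (-(lam ^ 2) / 2) ≤ Real.exp (-(lam * (lam * (x ⬝ᵥ x))) / 2) := by
      apply Real.exp_le_exp.mpr
      have := hY x hx
      nlinarith [sq_nonneg lam]
    gcongr
  have h4 := Finset.sum_le_sum each
  rw [Finset.sum_const, nsmul_eq_mul] at h4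
  have h5 : (Y.card : ℝ) * Real.exp (-(lam ^ 2) / 2) ≤ 2 := by
    have : (Y.card : ℝ) * (Real.exp (-(lam ^ 2) / 2) * (Z / 2)) ≤ Z := h4.trans tot
    by_contra hh
    push Not at hh
    nlinarith
  have h6 : lam ^ 2 / 2 = 4 * V * L / t ^ 2 := by
    rw [hlam, div_pow, mul_pow, hR2]; field_simp; ring
  rw [← h6]
  calc (Y.card : ℝ) = Y.card * Real.exp (-(lam ^ 2) / 2) * Real.exp (lam ^ 2 / 2) := by
        rw [mul_assoc, ← Real.exp_add]
        have : -(lam ^ 2) / 2 + lam ^ 2 / 2 = 0 := by ring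
        rw [this]; simp
    _ ≤ 2 * Real.exp (lam ^ 2 / 2) := by gcongr

/-- From bounded packings to nets. -/
lemma net_of_packing {α : Type*} (B : Set α) (close : α → α → Prop) (hrefl : ∀ x ∈ B, close x x)
    (hsymm : ∀ x y, close x y → close y x) (K : ℝ)
    (hp : ∀ Y : Finset α, (∀ y ∈ Y, y ∈ B) → (∀ x ∈ Y, ∀ y ∈ Y, x ≠ y → ¬ close x y) →
      (Y.card : ℝ) ≤ K) :
    ∃ Y : Finset α, (∀ y ∈ Y, y ∈ B) ∧ (Y.card : ℝ) ≤ K ∧ ∀ x ∈ B, ∃ y ∈ Y, close x y := by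
  classical
  let T : Set ℕ := {c | ∃ Y : Finset α, Y.card = c ∧ (∀ y ∈ Y, y ∈ B) ∧
    (∀ x ∈ Y, ∀ y ∈ Y, x ≠ y → ¬ close x y)}
  have hT0 : T.Nonempty := ⟨0, ∅, by simp⟩
  have hTb : BddAbove T := by
    refine ⟨⌊K⌋₊, ?_⟩
    rintro c ⟨Y, rfl, h1, h2⟩
    exact Nat.le_floor (hp Y h1 h2)
  obtain ⟨Y, hc, h1, h2⟩ := Nat.sSup_mem hT0 hTb
  refine ⟨Y, h1, hp Y h1 h2, ?_⟩
  intro x hx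
  by_contra hh
  push Not at hh
  have hxY : x ∉ Y := fun h => hh x h (hrefl x hx)
  have : (insert x Y).card ∈ T := by
    refine ⟨_, rfl, ?_, ?_⟩
    · intro y hy
      rcases Finset.mem_insert.1 hy with rfl | h
      · exact hx
      · exact h1 y h
    · intro a ha b hb hab
      rcases Finset.mem_insert.1 ha with ha' | ha'
      · rcases Finset.mem_insert.1 hb with hb' | hb'
        · exact absurd (ha'.trans hb'.symm) hab
        · rw [ha']; exact hh b hb'
      · rcases Finset.mem_insert.1 hb with hb' | hb'
        · rw [hb']; exact fun h => hh a ha' (hsymm _ _ h)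
        · exact h2 a ha' b hb' hab
  have h3 := le_csSup hTb this
  rw [Finset.card_insert_of_notMem hxY, hc] at h3
  omega

lemma dual_sudakov {Ω : Type*} [Fintype Ω] [Nonempty Ω] (Φ : Ω → ι → ℝ) {V t : ℝ} (hV : 0 < V)
    (ht : 0 < t) (hΦ : ∀ ω, Φ ω ⬝ᵥ Φ ω ≤ V) :
    ∃ Y : Finset (ι → ℝ), (∀ y ∈ Y, y ⬝ᵥ y ≤ 1) ∧
      (Y.card : ℝ) ≤ 2 * Real.exp (4 * V * Real.log (4 * Fintype.card Ω) / t ^ 2) ∧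
      ∀ x : ι → ℝ, x ⬝ᵥ x ≤ 1 → ∃ y ∈ Y, ∀ ω, |(x - y) ⬝ᵥ Φ ω| ≤ t := by
  apply net_of_packing {y : ι → ℝ | y ⬝ᵥ y ≤ 1} (fun x y => ∀ ω, |(x - y) ⬝ᵥ Φ ω| ≤ t)
  · intro x _ ω; simp [ht.le]
  · intro x y h ω
    rw [← neg_sub, neg_dotProduct, abs_neg]; exact h ω
  · intro Y h1 h2
    apply ds_packing Φ hV ht hΦ Y h1
    intro x hx y hy hxy
    have := h2 x hx y hy hxy
    push Not at this
    exact this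

end DS


/-! ### Covering of ellipsoids of trigonometric sums in the uniform norm -/

lemma ee_lip {d : ℕ} (k : Fin d → ℤ) (x y : Fin d → ℝ) {A δ : ℝ} (hA : ∀ j, |(k j : ℝ)| ≤ A)
    (hδ : ∀ j, |x j - y j| ≤ δ) : ‖ee k x - ee k y‖ ≤ d * (A * δ) := by
  have h1 : ee k x = ee k (x - y) * ee k y := by
    rw [ee_sub_arg, mul_assoc, ← ee_add]
    simp [ee_zero]
  have h2 : ee k x - ee k y = (ee k (x - y) - 1) * ee k y := by rw [h1]; ring
  rw [h2, norm_mul, ee_norm, mul_one]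
  have h3 : ee k (x - y) = Complex.exp (Complex.I * ((∑ j, (k j : ℝ) * (x j - y j) : ℝ) : ℂ)) := by
    unfold ee; simp only [Pi.sub_apply]; push_cast; rfl
  rw [h3]
  refine (Real.norm_exp_I_mul_ofReal_sub_one_le).trans ?_
  rw [Real.norm_eq_abs]
  refine (Finset.abs_sum_le_sum_abs _ _).trans ?_
  calc ∑ j, |(k j : ℝ) * (x j - y j)| ≤ ∑ _j : Fin d, A * δ := by
        apply Finset.sum_le_sum
        intro j _
        rw [abs_mul]
        exact mul_le_mul (hA j) (hδ j) (abs_nonneg _) ((abs_nonneg _).trans (hA j))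
    _ = d * (A * δ) := by simp

lemma ee_period {d : ℕ} (k z z' : Fin d → ℤ) (L : ℕ) (hL : 0 < L)
    (h : ∀ j, z' j = z j % L) :
    ee k (fun j => 2 * Real.pi * z j / L) = ee k (fun j => 2 * Real.pi * z' j / L) := by
  unfold ee
  rw [Complex.exp_eq_exp_iff_exists_int]
  refine ⟨∑ j, k j * (z j / L), ?_⟩
  have hL' : (L : ℂ) ≠ 0 := by exact_mod_cast hL.ne'
  push_cast
  rw [Finset.sum_mul, Finset.mul_sum, Finset.mul_sum, ← Finset.sum_add_distrib]
  apply Finset.sum_congr rfl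
  intro j _
  have e : (z j : ℂ) = z' j + L * ((z j / L : ℤ) : ℂ) := by
    rw [h j]
    have := Int.emod_add_mul_ediv (z j) L
    exact_mod_cast this.symm
  rw [e]
  field_simp
  try ring

set_option maxHeartbeats 1000000 in
lemma trig_cover (d : ℕ) (D : ℝ) (hD : 0 ≤ D) : ∃ C : ℝ, 1 ≤ C ∧ ∀ n : ℕ, 1 ≤ n →
    ∀ (ι : Type) [Fintype ι] (κ : ι → Fin d → ℤ) (w : ι → ℝ) (V t : ℝ), 0 < V → 0 < t →
    ∑ i, w i ^ 2 ≤ V → (∀ i j, |(κ i j : ℝ)| ≤ 2 ^ (n + 1)) → V ≤ t ^ 2 * Real.exp (D * n) →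
    ∃ N : Finset ((Fin d → ℝ) → ℂ), (∀ g ∈ N, Continuous g) ∧
      (N.card : ℝ) ≤ Real.exp (C * n * (1 + V / t ^ 2)) ∧
      ∀ x : ι → ℂ, ∑ i, ‖x i‖ ^ 2 ≤ 1 → ∃ g ∈ N, ∀ ω,
        ‖∑ i, x i * (w i : ℂ) * ee (κ i) ω - g ω‖ ≤ t := by
  classical
  set C0 : ℝ := 60 * d + 3 + D with hC0
  have hC0p : 0 < C0 := by positivity
  refine ⟨64 * (3 + d * C0) + 1, by nlinarith [mul_nonneg (Nat.cast_nonneg (α := ℝ) d) hC0p.le], ?_⟩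
  intro n hn ι _ κ w V t hV ht hw hκ hVt
  have hn1 : (1 : ℝ) ≤ n := by exact_mod_cast hn
  set A : ℝ := 2 ^ (n + 1) with hA
  have hA0 : 0 < A := by positivity
  have hpi := Real.pi_pos
  set L : ℕ := ⌈8 * Real.pi * d * A * Real.exp (D * n)⌉₊ + 1 with hL
  have hLpos : 0 < L := Nat.succ_pos _
  have : NeZero L := ⟨hLpos.ne'⟩
  have hLge : 8 * Real.pi * d * A * Real.exp (D * n) ≤ L := by
    rw [hL]; push_cast
    have := Nat.le_ceil (8 * Real.pi * d * A * Real.exp (D * n))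
    linarith
  have hLle : (L : ℝ) ≤ Real.exp (C0 * n) := by
    have h1 : (L : ℝ) ≤ 8 * Real.pi * d * A * Real.exp (D * n) + 2 := by
      rw [hL]; push_cast
      have := Nat.ceil_lt_add_one (show 0 ≤ 8 * Real.pi * d * A * Real.exp (D * n) by positivity)
      linarith
    have h2 : A ≤ 2 * Real.exp n := by
      rw [hA, pow_succ]
      have : (2 : ℝ) ^ n ≤ Real.exp n := by
        rw [← Real.exp_one_pow]
        exact pow_le_pow_left₀ (by norm_num) (by linarith [Real.add_one_le_exp (1 : ℝ)]) n
      linarith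
    have h3 : 8 * Real.pi * d * A * Real.exp (D * n) ≤ 60 * d * (Real.exp n * Real.exp (D * n)) := by
      have : 8 * Real.pi * d * A * Real.exp (D * n)
        ≤ 8 * 3.15 * d * (2 * Real.exp n) * Real.exp (D * n) := by
        gcongr; exact Real.pi_lt_d2.le
      refine this.trans ?_
      have : 0 ≤ d * (Real.exp n * Real.exp (D * n)) := by positivity
      nlinarith
    have h4 : 1 ≤ Real.exp n * Real.exp (D * n) := by
      rw [← Real.exp_add]; apply Real.one_le_exp; positivity
    have h5 : (60 * d + 2 : ℝ) ≤ Real.exp ((60 * d + 2) * n) := by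
      have := Real.add_one_le_exp ((60 * d + 2) * n : ℝ)
      have : (60 * d + 2 : ℝ) * 1 ≤ (60 * d + 2) * n := by gcongr
      linarith
    calc (L : ℝ) ≤ (60 * d + 2) * (Real.exp n * Real.exp (D * n)) := by nlinarith
      _ ≤ Real.exp ((60 * d + 2) * n) * (Real.exp n * Real.exp (D * n)) := by gcongr
      _ = Real.exp (C0 * n) := by
        rw [← Real.exp_add, ← Real.exp_add, hC0]; congr 1; ring
  let pt : (Fin d → Fin L) → Fin d → ℝ := fun p j => 2 * Real.pi * ((p j : ℕ) : ℤ) / L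
  let Φ : (Fin d → Fin L) × Bool → ι × Bool → ℝ := fun p i =>
    match p.2, i.2 with
    | false, false => w i.1 * (ee (κ i.1) (pt p.1)).re
    | false, true => -(w i.1 * (ee (κ i.1) (pt p.1)).im)
    | true, false => w i.1 * (ee (κ i.1) (pt p.1)).im
    | true, true => w i.1 * (ee (κ i.1) (pt p.1)).re
  have nsq : ∀ k : Fin d → ℤ, ∀ y, (ee k y).re ^ 2 + (ee k y).im ^ 2 = 1 := by
    intro k y
    have h := Complex.normSq_apply (ee k y)
    rw [Complex.normSq_eq_norm_sq, ee_norm] at h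
    nlinarith
  have hΦ : ∀ p, Φ p ⬝ᵥ Φ p ≤ V := by
    rintro ⟨p, b⟩
    refine le_trans (le_of_eq ?_) hw
    unfold dotProduct
    rw [Fintype.sum_prod_type]
    apply Finset.sum_congr rfl
    intro i _
    have := nsq (κ i) (pt p)
    cases b <;> simp only [Fintype.sum_bool, Φ] <;> linear_combination (w i ^ 2) * this
  obtain ⟨Y, hY1, hYc, hYn⟩ := dual_sudakov Φ hV (show 0 < t / 4 by positivity) hΦ
  let toF : (ι × Bool → ℝ) → (Fin d → ℝ) → ℂ := fun y ω =>
    ∑ i, (⟨y (i, false), y (i, true)⟩ : ℂ) * (w i : ℂ) * ee (κ i) ω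
  refine ⟨Y.image toF, ?_, ?_, ?_⟩
  · intro g hg
    obtain ⟨y, _, rfl⟩ := Finset.mem_image.1 hg
    exact continuous_finsetSum _ fun i _ => continuous_const.mul (ee_continuous _)
  · have h1 : ((Y.image toF).card : ℝ) ≤ Y.card := by exact_mod_cast Finset.card_image_le
    refine h1.trans (hYc.trans ?_)
    have h2 : (2 : ℝ) ≤ Real.exp 1 := by linarith [Real.add_one_le_exp (1 : ℝ)]
    refine (mul_le_mul_of_nonneg_right h2 (Real.exp_pos _).le).trans ?_
    rw [← Real.exp_add]
    apply Real.exp_le_exp.mpr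
    have hlog : Real.log (4 * (Fintype.card ((Fin d → Fin L) × Bool) : ℝ)) ≤ (3 + d * C0) * n := by
      simp only [Fintype.card_prod, Fintype.card_pi, Fintype.card_fin, Finset.prod_const,
        Finset.card_univ, Fintype.card_bool]
      push_cast
      have hLp : (0 : ℝ) < L := by exact_mod_cast hLpos
      rw [show (4 * ((L : ℝ) ^ d * 2)) = 8 * (L : ℝ) ^ d by ring,
        Real.log_mul (by norm_num) (by positivity), Real.log_pow]
      have h8 : Real.log 8 ≤ 3 := by
        rw [show (8 : ℝ) = 2 ^ 3 by norm_num, Real.log_pow]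
        have := Real.log_two_lt_d9
        push_cast; linarith
      have hl : Real.log L ≤ C0 * n := by
        rw [Real.log_le_iff_le_exp hLp]; exact hLle
      have : (d : ℝ) * Real.log L ≤ d * (C0 * n) := by gcongr
      nlinarith
    have hv : 0 ≤ V / t ^ 2 := by positivity
    have e : 4 * V * Real.log (4 * (Fintype.card ((Fin d → Fin L) × Bool) : ℝ)) / (t / 4) ^ 2
        = 64 * Real.log (4 * (Fintype.card ((Fin d → Fin L) × Bool) : ℝ)) * (V / t ^ 2) := by
      field_simp; ring
    rw [e]
    have h5 : 64 * Real.log (4 * (Fintype.card ((Fin d → Fin L) × Bool) : ℝ)) * (V / t ^ 2)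
      ≤ 64 * ((3 + d * C0) * n) * (V / t ^ 2) := by gcongr
    have h6 : 0 ≤ 64 * ((3 + d * C0) * n) := by positivity
    have h7 : 0 ≤ (n : ℝ) * (V / t ^ 2) := by positivity
    calc _ ≤ 1 + 64 * ((3 + d * C0) * n) * (V / t ^ 2) := by linarith
      _ ≤ _ := by nlinarith
  · intro x hx
    let X : ι × Bool → ℝ := fun i => match i.2 with
      | false => (x i.1).re
      | true => (x i.1).im
    have hX : X ⬝ᵥ X ≤ 1 := by
      refine le_trans (le_of_eq ?_) hx
      unfold dotProduct
      rw [Fintype.sum_prod_type]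
      apply Finset.sum_congr rfl
      intro i _
      simp only [Fintype.sum_bool, X]
      rw [← Complex.normSq_eq_norm_sq, Complex.normSq_apply]; ring
    obtain ⟨y, hyY, hy⟩ := hYn X hX
    refine ⟨toF y, Finset.mem_image_of_mem _ hyY, ?_⟩
    set u : ι → ℂ := fun i => x i - ⟨y (i, false), y (i, true)⟩ with hu
    have hdiff : ∀ ω, ∑ i, x i * (w i : ℂ) * ee (κ i) ω - toF y ω
        = ∑ i, u i * (w i : ℂ) * ee (κ i) ω := by
      intro ω
      simp only [toF, hu]
      rw [← Finset.sum_sub_distrib]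
      apply Finset.sum_congr rfl
      intro i _; ring
    have hgrid : ∀ p, ‖∑ i, u i * (w i : ℂ) * ee (κ i) (pt p)‖ ≤ t / 2 := by
      intro p
      have h1 := hy (p, false)
      have h2 := hy (p, true)
      have e1 : (∑ i, u i * (w i : ℂ) * ee (κ i) (pt p)).re = (X - y) ⬝ᵥ Φ (p, false) := by
        unfold dotProduct
        rw [Fintype.sum_prod_type, Complex.re_sum]
        apply Finset.sum_congr rfl
        intro i _
        simp [X, Φ, hu]; ring
      have e2 : (∑ i, u i * (w i : ℂ) * ee (κ i) (pt p)).im = (X - y) ⬝ᵥ Φ (p, true) := by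
        unfold dotProduct
        rw [Fintype.sum_prod_type, Complex.im_sum]
        apply Finset.sum_congr rfl
        intro i _
        simp [X, Φ, hu]; ring
      refine (Complex.norm_le_abs_re_add_abs_im _).trans ?_
      rw [e1, e2]; linarith
    have husum : ∑ i, ‖u i‖ ^ 2 ≤ 4 := by
      have hyy := hY1 y hyY
      have : ∑ i, ‖u i‖ ^ 2 ≤ 2 * (∑ i, ‖x i‖ ^ 2) + 2 * (y ⬝ᵥ y) := by
        unfold dotProduct
        rw [Fintype.sum_prod_type, Finset.mul_sum, Finset.mul_sum, ← Finset.sum_add_distrib]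
        apply Finset.sum_le_sum
        intro i _
        simp only [Fintype.sum_bool, hu]
        rw [← Complex.normSq_eq_norm_sq, ← Complex.normSq_eq_norm_sq, Complex.normSq_apply,
          Complex.normSq_apply]
        simp only [Complex.sub_re, Complex.sub_im]
        nlinarith [sq_nonneg ((x i).re + y (i, false)), sq_nonneg ((x i).im + y (i, true))]
      linarith
    have hl1 : ∑ i, ‖u i‖ * |w i| ≤ 2 * Real.sqrt V := by
      have cs := Finset.sum_mul_sq_le_sq_mul_sq Finset.univ (fun i => ‖u i‖) (fun i => |w i|)
      have h1 : (∑ i, ‖u i‖ * |w i|) ^ 2 ≤ (2 * Real.sqrt V) ^ 2 := by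
        refine cs.trans ?_
        rw [mul_pow, Real.sq_sqrt hV.le]
        simp only [sq_abs]
        have : 0 ≤ ∑ i, w i ^ 2 := Finset.sum_nonneg fun i _ => sq_nonneg _
        calc _ ≤ 4 * V := mul_le_mul husum hw this (by norm_num)
          _ = _ := by norm_num
      exact le_of_sq_le_sq h1 (by positivity)
    intro ω
    rw [hdiff]
    -- nearest grid point
    let z : Fin d → ℤ := fun j => ⌊ω j * L / (2 * Real.pi)⌋
    have hLp : (0 : ℝ) < L := by exact_mod_cast hLpos
    let p : Fin d → Fin L := fun j => ⟨(z j % L).toNat, by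
      have h1 := Int.emod_nonneg (z j) (show (L : ℤ) ≠ 0 by exact_mod_cast hLpos.ne')
      have h2 := Int.emod_lt_of_pos (z j) (show (0 : ℤ) < L by exact_mod_cast hLpos)
      omega⟩
    have hp : ∀ k : Fin d → ℤ, ee k (fun j => 2 * Real.pi * z j / L) = ee k (pt p) := by
      intro k
      apply ee_period k z (fun j => ((p j : ℕ) : ℤ)) L hLpos
      intro j
      have h1 := Int.emod_nonneg (z j) (show (L : ℤ) ≠ 0 by exact_mod_cast hLpos.ne')
      simp only [p]
      omega
    have hz : ∀ j, |ω j - 2 * Real.pi * z j / L| ≤ 2 * Real.pi / L := by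
      intro j
      have h1 := Int.floor_le (ω j * L / (2 * Real.pi))
      have h2 := Int.lt_floor_add_one (ω j * L / (2 * Real.pi))
      have e : ω j - 2 * Real.pi * z j / L
        = (2 * Real.pi / L) * (ω j * L / (2 * Real.pi) - z j) := by field_simp
      rw [e, abs_mul, abs_of_pos (by positivity : 0 < 2 * Real.pi / L)]
      have : |ω j * L / (2 * Real.pi) - z j| ≤ 1 := by
        rw [abs_le]; constructor <;> simp only [z] <;> linarith
      have h3 : 0 < 2 * Real.pi / L := by positivity
      nlinarith
    have hsplit : ∑ i, u i * (w i : ℂ) * ee (κ i) ω = ∑ i, u i * (w i : ℂ) * ee (κ i) (pt p)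
        + ∑ i, u i * (w i : ℂ) * (ee (κ i) ω - ee (κ i) (pt p)) := by
      rw [← Finset.sum_add_distrib]
      apply Finset.sum_congr rfl
      intro i _; ring
    rw [hsplit]
    refine (norm_add_le _ _).trans ?_
    have h1 := hgrid p
    have h2 : ‖∑ i, u i * (w i : ℂ) * (ee (κ i) ω - ee (κ i) (pt p))‖
        ≤ (∑ i, ‖u i‖ * |w i|) * (d * (A * (2 * Real.pi / L))) := by
      refine (norm_sum_le _ _).trans ?_
      rw [Finset.sum_mul]
      apply Finset.sum_le_sum
      intro i _
      rw [norm_mul, norm_mul, Complex.norm_real, Real.norm_eq_abs, ← hp]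
      gcongr
      exact ee_lip _ _ _ (hκ i) hz
    have h3 : 2 * Real.sqrt V * (d * (A * (2 * Real.pi / L))) ≤ t / 2 := by
      have hs : Real.sqrt V ≤ t * Real.exp (D * n) := by
        apply Real.sqrt_le_iff.mpr
        refine ⟨by positivity, hVt.trans ?_⟩
        rw [mul_pow]
        have : Real.exp (D * n) ≤ Real.exp (D * n) ^ 2 := by
          have : 1 ≤ Real.exp (D * n) := Real.one_le_exp (by positivity)
          nlinarith
        gcongr
      have e : 2 * Real.sqrt V * (d * (A * (2 * Real.pi / L)))
        = Real.sqrt V * (4 * Real.pi * d * A) / L := by field_simp; ring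
      rw [e, div_le_iff₀ hLp]
      calc Real.sqrt V * (4 * Real.pi * d * A)
          ≤ t * Real.exp (D * n) * (4 * Real.pi * d * A) := by gcongr
        _ = t / 2 * (8 * Real.pi * d * A * Real.exp (D * n)) := by ring
        _ ≤ t / 2 * L := by gcongr
    have h4 : (∑ i, ‖u i‖ * |w i|) * (d * (A * (2 * Real.pi / L)))
      ≤ 2 * Real.sqrt V * (d * (A * (2 * Real.pi / L))) := by gcongr
    linarith


/-! ### Random sampling: simultaneous control of finitely many sets -/

lemma chernoff_mgf {Ω : Type*} [MeasurableSpace Ω] (μ : Measure Ω) [IsProbabilityMeasure μ]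
    (m : ℕ) (D : Set Ω) (hD : MeasurableSet D) (a : ℝ) :
    Integrable (fun ξ : Fin m → Ω => Real.exp (a * ∑ k, D.indicator (fun _ => (1 : ℝ)) (ξ k)))
      (Measure.pi fun _ => μ) ∧
    ∫ ξ : Fin m → Ω, Real.exp (a * ∑ k, D.indicator (fun _ => (1 : ℝ)) (ξ k))
      ∂(Measure.pi fun _ => μ) ≤ Real.exp (m * (μ.real D * (Real.exp a - 1))) := by
  have hmeas : Measurable (fun x => Real.exp (a * D.indicator (fun _ => (1 : ℝ)) x)) :=
    Real.measurable_exp.comp ((measurable_const.indicator hD).const_mul a)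
  have e : ∀ ξ : Fin m → Ω, Real.exp (a * ∑ k, D.indicator (fun _ => (1 : ℝ)) (ξ k))
      = ∏ k, Real.exp (a * D.indicator (fun _ => (1 : ℝ)) (ξ k)) := by
    intro ξ; rw [← Real.exp_sum, Finset.mul_sum]
  have e2 : ∀ x, Real.exp (a * D.indicator (fun _ => (1 : ℝ)) x)
      = 1 + D.indicator (fun _ => (1 : ℝ)) x * (Real.exp a - 1) := by
    intro x
    by_cases hx : x ∈ D <;> simp [hx]
  have i0 : Integrable (fun x => D.indicator (fun _ => (1 : ℝ)) x) μ :=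
    (integrable_const (1 : ℝ)).indicator hD
  have i1 : Integrable (fun x => Real.exp (a * D.indicator (fun _ => (1 : ℝ)) x)) μ := by
    simp_rw [e2]
    exact (integrable_const _).add (i0.mul_const _)
  simp_rw [e]
  constructor
  · exact Integrable.fintype_prod (f := fun (_ : Fin m) x =>
      Real.exp (a * D.indicator (fun _ => (1 : ℝ)) x)) (fun _ => i1)
  · rw [integral_fintype_prod_eq_pow
      (f := fun x => Real.exp (a * D.indicator (fun _ => (1 : ℝ)) x))]
    have e3 : ∫ x, Real.exp (a * D.indicator (fun _ => (1 : ℝ)) x) ∂μ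
        = 1 + μ.real D * (Real.exp a - 1) := by
      simp_rw [e2]
      rw [integral_add (integrable_const _) (i0.mul_const _), integral_mul_const,
        integral_indicator_const _ hD]
      simp
    rw [e3, Fintype.card_fin, Real.exp_nat_mul]
    apply pow_le_pow_left₀
    · rw [← e3]; exact integral_nonneg fun x => (Real.exp_pos _).le
    · linarith [Real.add_one_le_exp (μ.real D * (Real.exp a - 1))]

lemma sample_sets {Ω : Type*} [MeasurableSpace Ω] (μ : Measure Ω) [IsProbabilityMeasure μ]
    (m : ℕ) {J : Type*} (s : Finset J) (D : J → Set Ω) (hD : ∀ j ∈ s, MeasurableSet (D j))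
    (τ : J → ℝ) (hτ : ∀ j ∈ s, 0 ≤ τ j)
    (hsum : ∑ j ∈ s, 2 * Real.exp (-(m * τ j / 2)) < 1) (Z : Set Ω) (hZ : μ Z = 0) :
    ∃ ξ : Fin m → Ω, (∀ k, ξ k ∉ Z) ∧ ∀ j ∈ s,
      ∑ k, (D j).indicator (fun _ => (1 : ℝ)) (ξ k) ≤ m * (2 * μ.real (D j) + τ j) ∧
      m * μ.real (D j) ≤ 2 * ∑ k, (D j).indicator (fun _ => (1 : ℝ)) (ξ k) + m * τ j := by
  set S : J → (Fin m → Ω) → ℝ := fun j ξ => ∑ k, (D j).indicator (fun _ => (1 : ℝ)) (ξ k) with hS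
  set Ψ : (Fin m → Ω) → ℝ := fun ξ => ∑ j ∈ s,
    (Real.exp (-(m * (2 * μ.real (D j) + τ j))) * Real.exp (1 * S j ξ)
      + Real.exp (m * (μ.real (D j) - τ j) / 2) * Real.exp ((-1) * S j ξ)) with hΨ
  have hint : ∀ j ∈ s, Integrable (fun ξ =>
      (Real.exp (-(m * (2 * μ.real (D j) + τ j))) * Real.exp (1 * S j ξ)
      + Real.exp (m * (μ.real (D j) - τ j) / 2) * Real.exp ((-1) * S j ξ)))
      (Measure.pi fun _ => μ) := by
    intro j hj
    exact ((chernoff_mgf μ m (D j) (hD j hj) 1).1.const_mul _).add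
      ((chernoff_mgf μ m (D j) (hD j hj) (-1)).1.const_mul _)
  have hI : ∫ ξ, Ψ ξ ∂(Measure.pi fun _ => μ) ≤ ∑ j ∈ s, 2 * Real.exp (-(m * τ j / 2)) := by
    rw [hΨ, integral_finsetSum _ hint]
    apply Finset.sum_le_sum
    intro j hj
    have h1 := chernoff_mgf μ m (D j) (hD j hj) 1
    have h2 := chernoff_mgf μ m (D j) (hD j hj) (-1)
    rw [integral_add (h1.1.const_mul _) (h2.1.const_mul _), integral_const_mul, integral_const_mul,
      two_mul (Real.exp _)]
    have hp : 0 ≤ μ.real (D j) := measureReal_nonneg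
    have hm0 : (0 : ℝ) ≤ m := Nat.cast_nonneg m
    have hmp : 0 ≤ m * μ.real (D j) := mul_nonneg hm0 hp
    have hmt : 0 ≤ m * τ j := mul_nonneg hm0 (hτ j hj)
    apply add_le_add
    · refine (mul_le_mul_of_nonneg_left h1.2 (Real.exp_pos _).le).trans ?_
      rw [← Real.exp_add]
      apply Real.exp_le_exp.mpr
      have := Real.exp_one_lt_d9
      nlinarith
    · refine (mul_le_mul_of_nonneg_left h2.2 (Real.exp_pos _).le).trans ?_
      rw [← Real.exp_add]
      apply Real.exp_le_exp.mpr
      have h3 : Real.exp (-1) ≤ 1 / 2 := by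
        rw [Real.exp_neg, one_div]
        apply inv_anti₀ (by norm_num)
        linarith [Real.add_one_le_exp (1 : ℝ)]
      nlinarith
  have hΨi : Integrable Ψ (Measure.pi fun _ => μ) := integrable_finsetSum _ hint
  have hnull : (Measure.pi fun _ : Fin m => μ) {ξ | ∃ k, ξ k ∈ Z} = 0 := by
    have : {ξ : Fin m → Ω | ∃ k, ξ k ∈ Z} = ⋃ k, (Function.eval k) ⁻¹' Z := by
      ext ξ; simp
    rw [this, measure_iUnion_null_iff]
    intro k
    exact (Measure.quasiMeasurePreserving_eval (fun _ => μ) k).preimage_null hZ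
  obtain ⟨ξ, hξ1, hξ2⟩ := exists_notMem_null_le_integral hΨi hnull
  refine ⟨ξ, by simpa using hξ1, ?_⟩
  have hlt : Ψ ξ < 1 := lt_of_le_of_lt hξ2 (hI.trans_lt hsum)
  intro j hj
  have hterm : (Real.exp (-(m * (2 * μ.real (D j) + τ j))) * Real.exp (1 * S j ξ)
      + Real.exp (m * (μ.real (D j) - τ j) / 2) * Real.exp ((-1) * S j ξ)) < 1 := by
    refine lt_of_le_of_lt ?_ hlt
    rw [hΨ]
    exact Finset.single_le_sum (f := fun j => (Real.exp (-(m * (2 * μ.real (D j) + τ j))) *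
      Real.exp (1 * S j ξ) + Real.exp (m * (μ.real (D j) - τ j) / 2) * Real.exp ((-1) * S j ξ)))
      (fun i _ => by positivity) hj
  rw [← Real.exp_add, ← Real.exp_add] at hterm
  have p1 := Real.exp_pos (-(m * (2 * μ.real (D j) + τ j)) + 1 * S j ξ)
  have p2 := Real.exp_pos (m * (μ.real (D j) - τ j) / 2 + (-1) * S j ξ)
  have q1 : -(m * (2 * μ.real (D j) + τ j)) + 1 * S j ξ < 0 := by
    rw [← Real.exp_lt_one_iff]; linarith
  have q2 : m * (μ.real (D j) - τ j) / 2 + (-1) * S j ξ < 0 := by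
    rw [← Real.exp_lt_one_iff]; linarith
  constructor
  · change S j ξ ≤ _; linarith
  · change _ ≤ 2 * S j ξ + _; linarith


/-! ### Discretization from uniform coverings -/

lemma level_sum_le (q : ℝ) (hq : 1 ≤ q) (a : ℝ) (I : ℕ) : ∀ T : ℝ, 0 < T →
    ∑ i ∈ Finset.range I, (if T / 2 ^ i ≤ a then (T / 2 ^ i) ^ q else 0) ≤ 2 * (max a 0) ^ q := by
  have hq0 : 0 ≤ q := by linarith
  induction I with
  | zero => intro T hT; simp; positivity
  | succ I ih =>
    intro T hT
    by_cases h : T ≤ a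
    · have ha : 0 < a := hT.trans_le h
      rw [max_eq_left ha.le]
      have h1 : ∀ i ∈ Finset.range (I + 1), (if T / 2 ^ i ≤ a then (T / 2 ^ i) ^ q else 0)
          ≤ a ^ q * (1 / 2) ^ i := by
        intro i _
        have h2 : (T / 2 ^ i) ^ q ≤ a ^ q * (1 / 2) ^ i := by
          rw [Real.div_rpow hT.le (by positivity), div_eq_mul_one_div]
          have h3 : (2 : ℝ) ^ i ≤ (2 ^ i) ^ q := by
            have : (1 : ℝ) ≤ 2 ^ i := one_le_pow₀ (by norm_num)
            calc (2 : ℝ) ^ i = (2 ^ i) ^ (1 : ℝ) := by simp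
              _ ≤ _ := Real.rpow_le_rpow_of_exponent_le this hq
          have h4 : 1 / (2 ^ i : ℝ) ^ q ≤ (1 / 2) ^ i := by
            rw [one_div_pow]
            exact one_div_le_one_div_of_le (by positivity) h3
          have h5 : T ^ q ≤ a ^ q := Real.rpow_le_rpow hT.le h hq0
          exact mul_le_mul h5 h4 (by positivity) (by positivity)
        split_ifs
        · exact h2
        · positivity
      refine (Finset.sum_le_sum h1).trans ?_
      rw [← Finset.mul_sum]
      have := geom_sum_eq (show (1 / 2 : ℝ) ≠ 1 by norm_num) (I + 1)
      rw [this]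
      have h6 : (0 : ℝ) < (1 / 2) ^ (I + 1) := by positivity
      have h7 : ((1 / 2 : ℝ) ^ (I + 1) - 1) / (1 / 2 - 1) ≤ 2 := by
        rw [div_le_iff_of_neg (by norm_num)]; linarith
      have : 0 ≤ a ^ q := by positivity
      nlinarith
    · rw [Finset.sum_range_succ']
      have e : ∀ i, T / 2 ^ (i + 1) = (T / 2) / 2 ^ i := by
        intro i; rw [pow_succ]; field_simp
      simp_rw [e]
      have := ih (T / 2) (by positivity)
      simpa [h] using this

lemma level_upper (q : ℝ) (hq : 1 ≤ q) (I : ℕ) : ∀ T a : ℝ, 0 < T → 0 ≤ a → a < 2 * T →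
    a ^ q ≤ (2 * (T / 2 ^ I)) ^ q +
      ∑ i ∈ Finset.range (I + 1), (if 2 * (T / 2 ^ i) ≤ a then (4 * (T / 2 ^ i)) ^ q else 0) := by
  have hq0 : 0 ≤ q := by linarith
  intro T a hT ha haT
  have hnn : ∀ i ∈ Finset.range (I + 1),
      0 ≤ (if 2 * (T / 2 ^ i) ≤ a then (4 * (T / 2 ^ i)) ^ q else 0) := by
    intro i _; split_ifs <;> positivity
  by_cases h : a < 2 * (T / 2 ^ I)
  · have := Finset.sum_nonneg hnn
    have := Real.rpow_le_rpow ha h.le hq0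
    linarith
  · push Not at h
    classical
    have hex : ∃ i, 2 * (T / 2 ^ i) ≤ a := ⟨I, h⟩
    let i := Nat.find hex
    have hi : 2 * (T / 2 ^ i) ≤ a := Nat.find_spec hex
    have hiI : i ≤ I := Nat.find_min' hex h
    have hi0 : i ≠ 0 := by
      intro h0
      rw [h0] at hi; simp at hi; linarith
    obtain ⟨j, hj⟩ := Nat.exists_eq_succ_of_ne_zero hi0
    have hj2 : ¬ 2 * (T / 2 ^ j) ≤ a := Nat.find_min hex (show j < i by omega)
    have h4 : a ≤ 4 * (T / 2 ^ i) := by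
      push Not at hj2
      have e : (4 : ℝ) * (T / 2 ^ i) = 2 * (T / 2 ^ j) := by
        rw [hj, pow_succ]; field_simp; norm_num
      rw [e]; exact hj2.le
    have h5 := Finset.single_le_sum hnn (Finset.mem_range.2 (show i < I + 1 by omega))
    simp only [hi, if_true] at h5
    have h6 := Real.rpow_le_rpow ha h4 hq0
    have : 0 ≤ (2 * (T / 2 ^ I)) ^ q := by positivity
    linarith

set_option maxHeartbeats 1000000 in
theorem disc_of_cover (d : ℕ) (q A K D : ℝ) (hq : 1 ≤ q) (hA : 0 ≤ A) (hK : 1 ≤ K) (hD : 0 ≤ D) :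
    ∃ C1 C3 : ℝ, 0 < C1 ∧ 0 < C3 ∧ ∀ n : ℕ, 1 ≤ n → ∀ G T : ℝ, 1 ≤ G → 0 < T → T ^ q = K * G →
      K * G ≤ Real.exp (D * n) → ∀ B : Set ((Fin d → ℝ) → ℂ),
      (∀ f ∈ B, Continuous f ∧ (∀ x, ‖f x‖ ≤ T) ∧ ∫ x, ‖f x‖ ^ q ∂(torusMeasure d) ≤ 1) →
      (∀ i : ℕ, 1 / 32 ≤ T / 2 ^ i → ∃ N : Finset ((Fin d → ℝ) → ℂ), (∀ g ∈ N, Continuous g) ∧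
        (N.card : ℝ) ≤ Real.exp (A * n * (G / (T / 2 ^ i) ^ q)) ∧
        ∀ f ∈ B, ∃ g ∈ N, ∀ x, ‖f x - g x‖ ≤ (T / 2 ^ i) / 2) →
      ∀ m : ℕ, C1 * G * (n : ℝ) ^ 2 ≤ m → ∃ ξ : Fin m → Fin d → ℝ, (∀ k, ξ k ∈ torusCell d) ∧
        ∀ f ∈ B, (∑ k, ‖f (ξ k)‖ ^ q ≤ C3 * m) ∧
          (∫ x, ‖f x‖ ^ q ∂(torusMeasure d) = 1 → (1 / (8 * 8 ^ q)) * m ≤ ∑ k, ‖f (ξ k)‖ ^ q) := by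
  classical
  have hq0 : 0 < q := by linarith
  set L : ℝ := 5 + 2 * D with hL
  have hLp : 0 < L := by positivity
  set c : ℝ := 1 / (4 * 4 ^ q) with hc
  have hcp : 0 < c := by positivity
  set B0 : ℝ := 4 * L * K with hB0
  have hB0p : 0 < B0 := by positivity
  refine ⟨(A + B0) * (2 * L) / c, 2 + 4 * 8 ^ q, by positivity, by positivity, ?_⟩
  intro n hn G T hG hT hTq hKG B hB hcov m hm
  have hn1 : (1 : ℝ) ≤ n := by exact_mod_cast hn
  have hT1 : 1 ≤ T := by
    by_contra hlt
    push Not at hlt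
    have := Real.rpow_lt_one hT.le hlt hq0
    nlinarith
  -- the number of levels
  have hex : ∃ i : ℕ, T / 2 ^ i ≤ 1 / 8 := by
    obtain ⟨i, hi⟩ := pow_unbounded_of_one_lt (8 * T) (show (1 : ℝ) < 2 by norm_num)
    exact ⟨i, by rw [div_le_iff₀ (by positivity)]; linarith⟩
  let I := Nat.find hex
  have hI1 : T / 2 ^ I ≤ 1 / 8 := Nat.find_spec hex
  have hI2 : ∀ i, i ≤ I → 1 / 16 ≤ T / 2 ^ i := by
    intro i hi
    have h16 : 1 / 16 ≤ T / 2 ^ I := by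
      rcases Nat.eq_zero_or_pos I with h0 | h0
      · rw [h0] at hI1; simp at hI1; linarith
      · obtain ⟨j, hj⟩ := Nat.exists_eq_succ_of_ne_zero h0.ne'
        have hj2 : ¬ T / 2 ^ j ≤ 1 / 8 := Nat.find_min hex (show j < I by omega)
        push Not at hj2
        have e : T / 2 ^ I = (T / 2 ^ j) / 2 := by rw [hj, pow_succ]; field_simp
        rw [e]; linarith
    refine h16.trans ?_
    have : (2 : ℝ) ^ i ≤ 2 ^ I := pow_le_pow_right₀ (by norm_num) hi
    exact div_le_div_of_nonneg_left hT.le (by positivity) this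
  have hIL : ((I : ℝ) + 1) ≤ L * n := by
    have h1 : (2 : ℝ) ^ I ≤ 16 * T := by
      have := hI2 I le_rfl
      rw [le_div_iff₀ (by positivity)] at this; linarith
    have h2 : T ≤ Real.exp (D * n) := by
      refine le_trans ?_ hKG
      rw [← hTq]
      calc T = T ^ (1 : ℝ) := by simp
        _ ≤ T ^ q := Real.rpow_le_rpow_of_exponent_le hT1 hq
    have h3 : Real.log ((2 : ℝ) ^ I) ≤ Real.log (2 ^ 4 * Real.exp (D * n)) := by
      apply Real.log_le_log (by positivity); norm_num; linarith
    rw [Real.log_mul (by positivity) (by positivity), Real.log_exp, Real.log_pow, Real.log_pow] at h3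
    have h4 := Real.log_two_gt_d9
    have h6 : 0 ≤ D * n := by positivity
    push_cast at h3
    have h5 : ((I : ℝ) - 4) ≤ 2 * (D * n) := by
      by_contra hlt
      push Not at hlt
      nlinarith
    rw [hL]; nlinarith
  have hLn : 0 < L * n := by positivity
  -- nets
  choose! N hNc hNcard hN using hcov
  set t : ℕ → ℝ := fun i => T / 2 ^ i with ht
  have htp : ∀ i, 0 < t i := fun i => by positivity
  set τ : ℕ → ℝ := fun i => c / (L * n * (t i) ^ q) with hτ
  have hτp : ∀ i, 0 < τ i := fun i => by have := htp i; positivity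
  have h32 : ∀ i, i ≤ I → 1 / 32 ≤ T / 2 ^ i := fun i hi => by linarith [hI2 i hi]
  set s : Finset (Σ _ : ℕ, (Fin d → ℝ) → ℂ) := (Finset.range (I + 1)).sigma N with hs
  set Ds : (Σ _ : ℕ, (Fin d → ℝ) → ℂ) → Set (Fin d → ℝ) := fun j => {x | t j.1 ≤ ‖j.2 x‖} with hDs
  have hDm : ∀ j ∈ s, MeasurableSet (Ds j) := by
    intro j hj
    rw [hs, Finset.mem_sigma, Finset.mem_range] at hj
    have := hNc j.1 (h32 _ (by omega)) j.2 hj.2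
    exact (isClosed_le continuous_const this.norm).measurableSet
  have hsum : ∑ j ∈ s, 2 * Real.exp (-(m * τ j.1 / 2)) < 1 := by
    rw [hs, Finset.sum_sigma]
    have h1 : ∀ i ∈ Finset.range (I + 1), ∑ _g ∈ N i, 2 * Real.exp (-(m * τ i / 2))
        ≤ 2 * Real.exp (-(4 * L * n)) := by
      intro i hi
      rw [Finset.mem_range] at hi
      rw [Finset.sum_const, nsmul_eq_mul]
      have h2 := hNcard i (h32 i (by omega))
      have hti := htp i
      have htq : 0 < (t i) ^ q := by positivity
      set r : ℝ := G / (t i) ^ q with hr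
      have hrK : 1 / K ≤ r := by
        rw [hr, div_le_div_iff₀ (by positivity) htq]
        have : (t i) ^ q ≤ T ^ q := by
          apply Real.rpow_le_rpow hti.le _ hq0.le
          exact div_le_self hT.le (one_le_pow₀ (by norm_num))
        rw [hTq] at this; linarith
      have h3 : (A + B0) * n * r ≤ m * τ i / 2 := by
        have e : (A + B0) * n * r = ((A + B0) * (2 * L) / c * G * (n : ℝ) ^ 2) * τ i / 2 := by
          rw [hr, hτ]; field_simp
        rw [e]
        have := (hτp i).le
        gcongr
      have h4 : 4 * L * n ≤ B0 * n * r := by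
        have : B0 * n * (1 / K) ≤ B0 * n * r := by gcongr
        have e : B0 * n * (1 / K) = 4 * L * n := by rw [hB0]; field_simp
        linarith
      calc (N i).card * (2 * Real.exp (-(m * τ i / 2)))
          ≤ Real.exp (A * n * r) * (2 * Real.exp (-(m * τ i / 2))) := by gcongr
        _ = 2 * Real.exp (A * n * r - m * τ i / 2) := by rw [sub_eq_add_neg, Real.exp_add]; ring
        _ ≤ _ := by
          gcongr
          linarith
    refine (Finset.sum_le_sum h1).trans_lt ?_
    rw [Finset.sum_const, nsmul_eq_mul, Finset.card_range]
    push_cast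
    have h2 := Real.add_one_le_exp (4 * L * n)
    calc ((I : ℝ) + 1) * (2 * Real.exp (-(4 * L * n)))
        ≤ (L * n) * (2 * Real.exp (-(4 * L * n))) := by gcongr
      _ = (2 * (L * n)) / Real.exp (4 * L * n) := by rw [Real.exp_neg]; field_simp
      _ < 1 := by
        rw [div_lt_one (Real.exp_pos _)]; nlinarith
  obtain ⟨ξ, hξZ, hξ⟩ := sample_sets (torusMeasure d) m s Ds hDm (fun j => τ j.1)
    (fun j _ => (hτp j.1).le) hsum (torusCell d)ᶜ (torusMeasure_compl d)
  refine ⟨ξ, fun k => by simpa using hξZ k, ?_⟩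
  intro f hf
  obtain ⟨hfc, hfT, hf1⟩ := hB f hf
  have hNf : ∀ i, i ≤ I → ∃ g ∈ N i, ∀ x, ‖f x - g x‖ ≤ (T / 2 ^ i) / 2 :=
    fun i hi => hN i (h32 i hi) f hf
  choose! g hgN hg using hNf
  set E : ℕ → Set (Fin d → ℝ) := fun i => {x | t i ≤ ‖g i x‖} with hE
  have hEm : ∀ i, i ≤ I → MeasurableSet (E i) := fun i hi =>
    hDm ⟨i, g i⟩ (by rw [hs, Finset.mem_sigma, Finset.mem_range]; exact ⟨by simp; omega, hgN i hi⟩)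
  have hemp : ∀ i, i ≤ I →
      ∑ k, (E i).indicator (fun _ => (1 : ℝ)) (ξ k)
        ≤ m * (2 * (torusMeasure d).real (E i) + τ i) ∧
      m * (torusMeasure d).real (E i)
        ≤ 2 * ∑ k, (E i).indicator (fun _ => (1 : ℝ)) (ξ k) + m * τ i := fun i hi =>
    hξ ⟨i, g i⟩ (by rw [hs, Finset.mem_sigma, Finset.mem_range]; exact ⟨by simp; omega, hgN i hi⟩)
  -- pointwise estimates
  have hup : ∀ x, ‖f x‖ ^ q ≤ 1 / 4 + ∑ i ∈ Finset.range (I + 1),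
      4 ^ q * (t i) ^ q * (E i).indicator (fun _ => (1 : ℝ)) x := by
    intro x
    have h0 : ‖f x‖ < 2 * T := by linarith [hfT x]
    refine (level_upper q hq I T ‖f x‖ hT (norm_nonneg _) h0).trans ?_
    apply add_le_add
    · have h1 : 2 * (T / 2 ^ I) ≤ 1 / 4 := by linarith
      calc (2 * (T / 2 ^ I)) ^ q ≤ (1 / 4) ^ q := Real.rpow_le_rpow (by positivity) h1 hq0.le
        _ ≤ (1 / 4) ^ (1 : ℝ) := Real.rpow_le_rpow_of_exponent_ge (by norm_num) (by norm_num) hq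
        _ = 1 / 4 := by simp
    · apply Finset.sum_le_sum
      intro i hi
      rw [Finset.mem_range] at hi
      have hi' : i ≤ I := by omega
      have htq : 0 ≤ (t i) ^ q := Real.rpow_nonneg (htp i).le q
      split_ifs with hif
      · have hx : x ∈ E i := by
          change t i ≤ ‖g i x‖
          have h1 := hg i hi' x
          have h2 := norm_sub_norm_le (f x) (g i x)
          have h3 := htp i
          simp only [ht] at h3 ⊢
          linarith
        rw [Set.indicator_of_mem hx, mul_one, Real.mul_rpow (by norm_num) (htp i).le]
      · apply mul_nonneg (by positivity)
        exact Set.indicator_nonneg (fun _ _ => zero_le_one) x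
  have hlow : ∀ x, ∑ i ∈ Finset.range (I + 1), (t i) ^ q * (E i).indicator (fun _ => (1 : ℝ)) x
      ≤ 2 * 2 ^ q * ‖f x‖ ^ q := by
    intro x
    have h1 := level_sum_le q hq (2 * ‖f x‖) (I + 1) T hT
    rw [max_eq_left (by positivity), Real.mul_rpow (by norm_num) (norm_nonneg _), ← mul_assoc] at h1
    refine le_trans ?_ h1
    apply Finset.sum_le_sum
    intro i hi
    rw [Finset.mem_range] at hi
    have hi' : i ≤ I := by omega
    by_cases hx : x ∈ E i
    · have h2 : T / 2 ^ i ≤ 2 * ‖f x‖ := by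
        have h1 := hg i hi' x
        have h2 := norm_sub_norm_le (g i x) (f x)
        rw [norm_sub_rev] at h2
        have h3 : t i ≤ ‖g i x‖ := hx
        simp only [ht] at h3
        linarith
      rw [if_pos h2, Set.indicator_of_mem hx, mul_one]
    · rw [Set.indicator_of_notMem hx, mul_zero]
      split_ifs
      · have := htp i; positivity
      · exact le_rfl
  -- the sums of τ
  have hτsum : ∑ i ∈ Finset.range (I + 1), (t i) ^ q * τ i ≤ c := by
    have h1 : ∀ i ∈ Finset.range (I + 1), (t i) ^ q * τ i = c / (L * n) := by
      intro i _
      have : 0 < (t i) ^ q := Real.rpow_pos_of_pos (htp i) q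
      rw [hτ]; field_simp
    rw [Finset.sum_congr rfl h1, Finset.sum_const, nsmul_eq_mul, Finset.card_range]
    push_cast
    rw [mul_div_assoc', div_le_iff₀ hLn]
    nlinarith
  have hfi : Integrable (fun x => ‖f x‖ ^ q) (torusMeasure d) := by
    apply bdd_integrable (B := T ^ q)
    · exact (hfc.norm.rpow_const fun _ => Or.inr hq0.le).aestronglyMeasurable
    · intro x
      rw [Real.norm_of_nonneg (by positivity)]
      exact Real.rpow_le_rpow (norm_nonneg _) (hfT x) hq0.le
  have hii : ∀ i ∈ Finset.range (I + 1), Integrable (fun x =>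
      (t i) ^ q * (E i).indicator (fun _ => (1 : ℝ)) x) (torusMeasure d) := by
    intro i hi
    rw [Finset.mem_range] at hi
    exact ((integrable_const (1 : ℝ)).indicator (hEm i (by omega))).const_mul _
  have hint : ∫ x, ∑ i ∈ Finset.range (I + 1), (t i) ^ q * (E i).indicator (fun _ => (1 : ℝ)) x
      ∂(torusMeasure d) = ∑ i ∈ Finset.range (I + 1), (t i) ^ q * (torusMeasure d).real (E i) := by
    rw [integral_finsetSum _ hii]
    apply Finset.sum_congr rfl
    intro i hi
    rw [Finset.mem_range] at hi
    rw [integral_const_mul, integral_indicator_const _ (hEm i (by omega))]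
    simp
  set P : ℝ := ∑ i ∈ Finset.range (I + 1), (t i) ^ q * (torusMeasure d).real (E i) with hP
  set S : ℝ := ∑ i ∈ Finset.range (I + 1), (t i) ^ q *
    ∑ k, (E i).indicator (fun _ => (1 : ℝ)) (ξ k) with hS
  have hm0 : (0 : ℝ) ≤ m := Nat.cast_nonneg m
  have h4c : (4 : ℝ) ^ q * c = 1 / 4 := by rw [hc]; field_simp
  have h4q : (0 : ℝ) < 4 ^ q := by positivity
  have h48 : (4 : ℝ) ^ q * 2 ^ q = 8 ^ q := by
    rw [← Real.mul_rpow (by norm_num) (by norm_num)]; norm_num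
  have hPS1 : S ≤ m * (2 * P + c) := by
    have : S ≤ ∑ i ∈ Finset.range (I + 1), m * (2 * ((t i) ^ q * (torusMeasure d).real (E i))
        + (t i) ^ q * τ i) := by
      apply Finset.sum_le_sum
      intro i hi
      rw [Finset.mem_range] at hi
      have := mul_le_mul_of_nonneg_left (hemp i (by omega)).1 (Real.rpow_nonneg (htp i).le q)
      linarith
    rw [← Finset.mul_sum, Finset.sum_add_distrib, ← Finset.mul_sum] at this
    refine this.trans ?_
    gcongr
  have hPS2 : m * P ≤ 2 * S + m * c := by
    have : m * P ≤ ∑ i ∈ Finset.range (I + 1), (2 * ((t i) ^ q *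
        ∑ k, (E i).indicator (fun _ => (1 : ℝ)) (ξ k)) + m * ((t i) ^ q * τ i)) := by
      rw [hP, Finset.mul_sum]
      apply Finset.sum_le_sum
      intro i hi
      rw [Finset.mem_range] at hi
      have := mul_le_mul_of_nonneg_left (hemp i (by omega)).2 (Real.rpow_nonneg (htp i).le q)
      linarith
    rw [Finset.sum_add_distrib, ← Finset.mul_sum, ← Finset.mul_sum] at this
    refine this.trans ?_
    gcongr
  have hPf : P ≤ 2 * 2 ^ q * ∫ x, ‖f x‖ ^ q ∂(torusMeasure d) := by
    rw [← hint, ← integral_const_mul]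
    exact integral_mono (integrable_finsetSum _ hii) (hfi.const_mul _) hlow
  have hSswap : ∑ k, ∑ i ∈ Finset.range (I + 1), (t i) ^ q *
      (E i).indicator (fun _ => (1 : ℝ)) (ξ k) = S := by
    rw [Finset.sum_comm, hS]
    apply Finset.sum_congr rfl
    intro i _; rw [Finset.mul_sum]
  have hup' : ∀ x, ‖f x‖ ^ q ≤ 1 / 4 + 4 ^ q * ∑ i ∈ Finset.range (I + 1),
      (t i) ^ q * (E i).indicator (fun _ => (1 : ℝ)) x := by
    intro x
    refine (hup x).trans (le_of_eq ?_)
    rw [Finset.mul_sum]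
    congr 1
    apply Finset.sum_congr rfl
    intro i _; ring
  constructor
  · have h1 : ∑ k, ‖f (ξ k)‖ ^ q ≤ m * (1 / 4) + 4 ^ q * S := by
      refine (Finset.sum_le_sum fun k _ => hup' (ξ k)).trans (le_of_eq ?_)
      rw [Finset.sum_add_distrib, ← Finset.mul_sum, hSswap]
      simp
    have h2 : P ≤ 2 * 2 ^ q := by
      refine hPf.trans ?_
      have : (0 : ℝ) < 2 * 2 ^ q := by positivity
      nlinarith
    have h3 : 4 ^ q * S ≤ m * (4 * 8 ^ q + 1 / 4) := by
      have : 4 ^ q * S ≤ 4 ^ q * (m * (2 * (2 * 2 ^ q) + c)) := by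
        refine mul_le_mul_of_nonneg_left (hPS1.trans ?_) h4q.le
        gcongr
      refine this.trans (le_of_eq ?_)
      rw [← h48, ← h4c]; ring
    nlinarith
  · intro hone
    have h1 : 1 ≤ 1 / 4 + 4 ^ q * P := by
      have h0 := integral_mono hfi ((integrable_const (1 / 4 : ℝ)).add
        ((integrable_finsetSum _ hii).const_mul (4 ^ q))) hup'
      have h00 := integral_add (integrable_const (1 / 4 : ℝ)) ((integrable_finsetSum _ hii).const_mul (4 ^ q))
      simp only [Pi.add_apply] at h0
      rw [h00, integral_const_mul, hint, hone] at h0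
      simpa using h0
    have h2 : S ≤ 2 * 2 ^ q * ∑ k, ‖f (ξ k)‖ ^ q := by
      rw [← hSswap, Finset.mul_sum]
      exact Finset.sum_le_sum fun k _ => hlow (ξ k)
    have h3 : m * (4 ^ q * P) ≤ 4 * 8 ^ q * (∑ k, ‖f (ξ k)‖ ^ q) + m * (1 / 4) := by
      have a1 : 4 ^ q * (m * P) ≤ 4 ^ q * (2 * S + m * c) := mul_le_mul_of_nonneg_left hPS2 h4q.le
      have a2 : 4 ^ q * (2 * S) ≤ 4 ^ q * (2 * (2 * 2 ^ q * ∑ k, ‖f (ξ k)‖ ^ q)) := by gcongr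
      rw [← h48, ← h4c]
      nlinarith
    have h4 : (m : ℝ) * (1 / 2) ≤ 4 * 8 ^ q * (∑ k, ‖f (ξ k)‖ ^ q) := by nlinarith
    rw [div_mul_eq_mul_div, div_le_iff₀ (by positivity)]
    nlinarith


/-! ### Covering for `1 ≤ q ≤ 2` -/

/-- The `L_q` unit ball of trigonometric polynomials with spectrum in `Q`. -/
def ballq {d : ℕ} (q : ℝ) (Q : Finset (Fin d → ℤ)) : Set ((Fin d → ℝ) → ℂ) :=
  {f | (∃ c, f = ts Q c) ∧ ∫ x, ‖f x‖ ^ q ∂(torusMeasure d) ≤ 1}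

lemma integrable_rpow {d : ℕ} {q : ℝ} (hq : 0 ≤ q) {f : (Fin d → ℝ) → ℂ} (hf : Measurable f)
    {B : ℝ} (hB : ∀ x, ‖f x‖ ≤ B) : Integrable (fun x => ‖f x‖ ^ q) (torusMeasure d) := by
  apply bdd_integrable (B := B ^ q)
  · exact (hf.norm.pow_const q).aestronglyMeasurable
  · intro x
    rw [Real.norm_of_nonneg (by positivity)]
    exact Real.rpow_le_rpow (norm_nonneg _) (hB x) hq

lemma l2_of_lq {d : ℕ} {q : ℝ} (hq : 1 ≤ q) (hq2 : q ≤ 2) {f : (Fin d → ℝ) → ℂ}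
    (hf : Measurable f) {B : ℝ} (hB : ∀ x, ‖f x‖ ≤ B) :
    ∫ x, ‖f x‖ ^ 2 ∂(torusMeasure d) ≤ B ^ (2 - q) * ∫ x, ‖f x‖ ^ q ∂(torusMeasure d) := by
  have hB0 : 0 ≤ B := (norm_nonneg _).trans (hB 0)
  rw [← integral_const_mul]
  have i2 : Integrable (fun x => ‖f x‖ ^ 2) (torusMeasure d) := by
    have := integrable_rpow (d := d) (q := 2) (by norm_num) hf hB
    simpa using this
  refine integral_mono i2 ((integrable_rpow (by linarith) hf hB).const_mul _) ?_
  intro x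
  change ‖f x‖ ^ 2 ≤ B ^ (2 - q) * ‖f x‖ ^ q
  have e : ‖f x‖ ^ 2 = ‖f x‖ ^ (2 - q) * ‖f x‖ ^ q := by
    rw [← Real.rpow_add_of_nonneg (norm_nonneg _) (by linarith) (by linarith)]
    norm_num
  rw [e]
  gcongr
  exact hB x

lemma ts_sq_le {d : ℕ} (Q : Finset (Fin d → ℤ)) (c : (Fin d → ℤ) → ℂ) (x : Fin d → ℝ) :
    ‖ts Q c x‖ ^ 2 ≤ Q.card * ∑ k ∈ Q, ‖c k‖ ^ 2 := by
  have h1 := ts_bound Q c x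
  have h2 := Finset.sum_mul_sq_le_sq_mul_sq Q (fun _ => (1 : ℝ)) (fun k => ‖c k‖)
  simp only [one_mul, one_pow, Finset.sum_const, nsmul_eq_mul, mul_one] at h2
  refine le_trans ?_ h2
  gcongr

lemma ts_coeff_sq_le {d : ℕ} (Q : Finset (Fin d → ℤ)) (c : (Fin d → ℤ) → ℂ) :
    ∑ k ∈ Q, ‖c k‖ ^ 2 ≤ ∫ x, ‖ts Q c x‖ ^ 2 ∂(torusMeasure d) := by
  refine le_trans (le_of_eq ?_) (bessel (ts_continuous Q c).measurable (ts_bound Q c) Q)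
  apply Finset.sum_congr rfl
  intro k hk
  rw [fc_ts, if_pos hk]

lemma sup_small {d : ℕ} {q : ℝ} (hq : 1 ≤ q) (hq2 : q ≤ 2) (Q : Finset (Fin d → ℤ))
    (f : (Fin d → ℝ) → ℂ) (hf : f ∈ ballq q Q) (x : Fin d → ℝ) : ‖f x‖ ^ q ≤ Q.card := by
  obtain ⟨⟨c, rfl⟩, hint⟩ := hf
  set M : ℝ := ⨆ x, ‖ts Q c x‖ with hM
  have hbdd : BddAbove (Set.range fun x => ‖ts Q c x‖) :=
    ⟨_, by rintro _ ⟨x, rfl⟩; exact ts_bound Q c x⟩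
  have hxM : ∀ x, ‖ts Q c x‖ ≤ M := fun x => le_ciSup hbdd x
  have hM0 : 0 ≤ M := (norm_nonneg _).trans (hxM 0)
  have hl2 := l2_of_lq hq hq2 (ts_continuous Q c).measurable hxM
  have hMp : 0 ≤ M ^ (2 - q) := by positivity
  have h2 : ∀ x, ‖ts Q c x‖ ^ 2 ≤ Q.card * M ^ (2 - q) := by
    intro x
    refine (ts_sq_le Q c x).trans ?_
    gcongr
    refine (ts_coeff_sq_le Q c).trans (hl2.trans ?_)
    nlinarith
  have h3 : M ≤ Real.sqrt (Q.card * M ^ (2 - q)) :=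
    ciSup_le fun x => Real.le_sqrt_of_sq_le (h2 x)
  have hMq : M ^ q ≤ Q.card := by
    rcases hM0.eq_or_lt with h0 | h0
    · rw [← h0, Real.zero_rpow (by linarith)]; positivity
    · have h4 : M ^ 2 ≤ Q.card * M ^ (2 - q) := by
        rw [Real.le_sqrt hM0 (by positivity)] at h3; exact h3
      have e : M ^ 2 = M ^ q * M ^ (2 - q) := by
        rw [← Real.rpow_add h0]; norm_num
      rw [e] at h4
      exact le_of_mul_le_mul_right h4 (by positivity)
  exact (Real.rpow_le_rpow (norm_nonneg _) (hxM x) (by linarith)).trans hMq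

lemma rpow_add_le' {q a b : ℝ} (hq : 1 ≤ q) (ha : 0 ≤ a) (hb : 0 ≤ b) :
    (a + b) ^ q ≤ 2 ^ q * (a ^ q + b ^ q) := by
  have hq0 : 0 ≤ q := by linarith
  have h1 : a + b ≤ 2 * max a b := by
    have := le_max_left a b; have := le_max_right a b; linarith
  have h2 : (a + b) ^ q ≤ (2 * max a b) ^ q := Real.rpow_le_rpow (by positivity) h1 hq0
  rw [Real.mul_rpow (by norm_num) (by positivity)] at h2
  refine h2.trans ?_
  gcongr
  rcases le_total a b with h | h
  · rw [max_eq_right h]; have : 0 ≤ a ^ q := by positivity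
    linarith
  · rw [max_eq_left h]; have : 0 ≤ b ^ q := by positivity
    linarith

lemma card_box {d n : ℕ} (hn : 1 ≤ n) (Q : Finset (Fin d → ℤ))
    (hQ : ∀ k ∈ Q, ∀ j, |k j| ≤ 2 ^ n) : (Q.card : ℝ) ≤ Real.exp (3 * d * n) := by
  have hsub : Q ⊆ Fintype.piFinset fun _ : Fin d => Finset.Icc (-(2 : ℤ) ^ n) (2 ^ n) := by
    intro k hk
    rw [Fintype.mem_piFinset]
    intro j
    rw [Finset.mem_Icc]
    exact abs_le.1 (hQ k hk j)
  have h1 := Finset.card_le_card hsub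
  rw [Fintype.card_piFinset_const, Int.card_Icc] at h1
  have h2 : ((2 : ℤ) ^ n + 1 - -2 ^ n).toNat ≤ 2 ^ (3 * n) := by
    have h3 : (2 : ℕ) ^ 1 ≤ 2 ^ n := Nat.pow_le_pow_right (by norm_num) hn
    have h4 : (2 : ℕ) ^ (3 * n) = (2 ^ n) * (2 ^ n) * (2 ^ n) := by ring
    have h5 : ((2 : ℤ) ^ n + 1 - -2 ^ n).toNat = 2 ^ n + 1 + 2 ^ n := by
      have : ((2 : ℤ) ^ n + 1 - -2 ^ n) = ((2 ^ n + 1 + 2 ^ n : ℕ) : ℤ) := by push_cast; ring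
      rw [this, Int.toNat_natCast]
    rw [h4, h5]
    nlinarith
  have h6 : Q.card ≤ 2 ^ (3 * n * d) := by
    refine h1.trans ?_
    rw [pow_mul]
    exact Nat.pow_le_pow_left h2 d
  have h7 : (Q.card : ℝ) ≤ 2 ^ (3 * n * d) := by exact_mod_cast h6
  refine h7.trans ?_
  have h8 : (2 : ℝ) ^ (3 * n * d) ≤ Real.exp 1 ^ (3 * n * d) :=
    pow_le_pow_left₀ (by norm_num) (by linarith [Real.add_one_le_exp (1 : ℝ)]) _
  refine h8.trans (le_of_eq ?_)
  rw [Real.exp_one_pow]; push_cast; congr 1; ring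

lemma small_step {d : ℕ} {q : ℝ} (hq : 1 ≤ q) (hq2 : q ≤ 2) {C : ℝ} {n : ℕ} (hn : 1 ≤ n)
    (hC1 : 1 ≤ C)
    (hC : ∀ (ι : Type) [Fintype ι] (κ : ι → Fin d → ℤ) (w : ι → ℝ) (V t : ℝ), 0 < V → 0 < t →
      ∑ i, w i ^ 2 ≤ V → (∀ i j, |(κ i j : ℝ)| ≤ 2 ^ (n + 1)) →
      V ≤ t ^ 2 * Real.exp ((3 * d + 20 : ℝ) * n) →
      ∃ N : Finset ((Fin d → ℝ) → ℂ), (∀ g ∈ N, Continuous g) ∧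
        (N.card : ℝ) ≤ Real.exp (C * n * (1 + V / t ^ 2)) ∧
        ∀ x : ι → ℂ, ∑ i, ‖x i‖ ^ 2 ≤ 1 → ∃ g ∈ N, ∀ ω,
          ‖∑ i, x i * (w i : ℂ) * ee (κ i) ω - g ω‖ ≤ t)
    (Q : Finset (Fin d → ℤ)) (hne : Q.Nonempty) (hQ : ∀ k ∈ Q, ∀ j, |k j| ≤ 2 ^ n)
    (t : ℝ) (ht : 1 / 64 ≤ t) (htT : t ^ q ≤ Q.card)
    (Y : Finset ((Fin d → ℝ) → ℂ)) (hY : ∀ g ∈ Y, g ∈ ballq q Q)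
    (hYc : (Y.card : ℝ) ≤ Real.exp (129 * C * n * (Q.card / t ^ q)))
    (hYn : ∀ f ∈ ballq q Q, ∃ g ∈ Y, ∀ x, ‖f x - g x‖ ≤ t) :
    ∃ Y' : Finset ((Fin d → ℝ) → ℂ), (∀ g ∈ Y', g ∈ ballq q Q) ∧
      (Y'.card : ℝ) ≤ Real.exp (129 * C * n * (Q.card / (t / 2) ^ q)) ∧
      ∀ f ∈ ballq q Q, ∃ g ∈ Y', ∀ x, ‖f x - g x‖ ≤ t / 2 := by
  classical
  have hq0 : 0 < q := by linarith
  have ht0 : 0 < t := by linarith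
  have hN0 : (0 : ℝ) < Q.card := by exact_mod_cast hne.card_pos
  set a : ℝ := Real.sqrt (8 * t ^ (2 - q)) with ha
  have hap : 0 < a := by rw [ha]; positivity
  have ha2 : a ^ 2 = 8 * t ^ (2 - q) := Real.sq_sqrt (by positivity)
  set t' : ℝ := t / 4 / a with ht'
  have ht'p : 0 < t' := by positivity
  have ht'2 : t' ^ 2 = t ^ q / 128 := by
    have e : t ^ 2 = t ^ q * t ^ (2 - q) := by
      rw [← Real.rpow_add ht0]; norm_num
    have : 0 < t ^ (2 - q) := by positivity
    rw [ht', div_pow, div_pow, ha2, e]; field_simp; norm_num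
  obtain ⟨N, hNc, hNcard, hNn⟩ := hC {k // k ∈ Q} (fun k => k.1) (fun _ => 1) Q.card t' hN0 ht'p
    (by simp) (by
      intro i j
      have h1 := hQ i.1 i.2 j
      have h2 : |((i.1 j : ℤ) : ℝ)| ≤ 2 ^ n := by exact_mod_cast h1
      refine h2.trans (pow_le_pow_right₀ (by norm_num) (by omega))) (by
      rw [ht'2]
      have h1 := card_box hn Q hQ
      have h2 : (1 / 64 : ℝ) ^ (2 : ℝ) ≤ t ^ q := by
        calc (1 / 64 : ℝ) ^ (2 : ℝ) ≤ (1 / 64) ^ q :=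
              Real.rpow_le_rpow_of_exponent_ge (by norm_num) (by norm_num) hq2
          _ ≤ t ^ q := Real.rpow_le_rpow (by norm_num) ht hq0.le
      have h3 : (2 : ℝ) ^ 19 ≤ Real.exp (20 * n) := by
        have h4 : (2 : ℝ) ^ 20 ≤ Real.exp 1 ^ 20 :=
          pow_le_pow_left₀ (by norm_num) (by linarith [Real.add_one_le_exp (1 : ℝ)]) _
        rw [Real.exp_one_pow] at h4
        have hn1 : (1 : ℝ) ≤ n := by exact_mod_cast hn
        have h5 : Real.exp 20 ≤ Real.exp (20 * n) := by
          apply Real.exp_le_exp.2; linarith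
        norm_num at h4 ⊢; linarith
      have h6 : (1 / 2 ^ 19 : ℝ) ≤ t ^ q / 128 := by norm_num at h2 ⊢; linarith
      rw [show ((3 * d + 20 : ℝ) * n) = 3 * d * n + 20 * n by ring, Real.exp_add]
      calc (Q.card : ℝ) ≤ Real.exp (3 * d * n) * 1 := by linarith
        _ ≤ Real.exp (3 * d * n) * ((1 / 2 ^ 19) * Real.exp (20 * n)) := by
          gcongr; norm_num at h3 ⊢; linarith
        _ ≤ Real.exp (3 * d * n) * (t ^ q / 128 * Real.exp (20 * n)) := by gcongr
        _ = _ := by ring)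
  have hV : (Q.card : ℝ) / t' ^ 2 = 128 * (Q.card / t ^ q) := by
    rw [ht'2]; field_simp
  rw [hV] at hNcard
  let good : ((Fin d → ℝ) → ℂ) × ((Fin d → ℝ) → ℂ) → ((Fin d → ℝ) → ℂ) → Prop := fun p f =>
    f ∈ ballq q Q ∧ ∀ x, ‖f x - p.1 x - a * p.2 x‖ ≤ t / 4
  have h0 : ∀ p, ∃ r, r ∈ ballq q Q ∧ ((∃ f, good p f) → good p r) := by
    intro p
    by_cases h : ∃ f, good p f
    · obtain ⟨f, hf⟩ := h
      exact ⟨f, hf.1, fun _ => hf⟩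
    · refine ⟨ts Q 0, ⟨⟨0, rfl⟩, ?_⟩, fun h' => absurd h' h⟩
      simp [ts, Real.zero_rpow hq0.ne']
  choose r hr1 hr2 using h0
  refine ⟨(Y ×ˢ N).image r, ?_, ?_, ?_⟩
  · intro g hg
    obtain ⟨p, _, rfl⟩ := Finset.mem_image.1 hg
    exact hr1 p
  · have h1 : (((Y ×ˢ N).image r).card : ℝ) ≤ Y.card * N.card := by
      have := Finset.card_image_le (s := Y ×ˢ N) (f := r)
      rw [Finset.card_product] at this
      exact_mod_cast this
    refine h1.trans ((mul_le_mul hYc hNcard (by positivity) (by positivity)).trans ?_)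
    rw [← Real.exp_add]
    apply Real.exp_le_exp.2
    have htq : 0 < t ^ q := by positivity
    set ρ : ℝ := Q.card / t ^ q with hρ
    have hρ1 : 1 ≤ ρ := by rw [hρ, le_div_iff₀ htq]; linarith
    have h2 : 2 * ρ ≤ Q.card / (t / 2) ^ q := by
      rw [Real.div_rpow ht0.le (by norm_num), hρ]
      have h3 : (2 : ℝ) ≤ 2 ^ q := by
        calc (2 : ℝ) = 2 ^ (1 : ℝ) := by simp
          _ ≤ _ := Real.rpow_le_rpow_of_exponent_le (by norm_num) hq
      have e : (Q.card : ℝ) / (t ^ q / 2 ^ q) = 2 ^ q * (Q.card / t ^ q) := by field_simp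
      rw [e]; gcongr
    have hCn : 0 ≤ C * n := by positivity
    calc 129 * C * n * ρ + C * n * (1 + 128 * ρ) ≤ 129 * C * n * (2 * ρ) := by nlinarith
      _ ≤ _ := by gcongr
  · intro f hf
    obtain ⟨g, hgY, hg⟩ := hYn f hf
    have hgB := hY g hgY
    obtain ⟨⟨c, hfc⟩, hfi⟩ := id hf
    obtain ⟨⟨c', hgc⟩, hgi⟩ := hgB
    have hu : ∀ x, f x - g x = ts Q (c - c') x := by
      intro x
      rw [hfc, hgc]
      simp only [ts, Pi.sub_apply, sub_mul, Finset.sum_sub_distrib]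
    have hut : ∀ x, ‖ts Q (c - c') x‖ ≤ t := fun x => by rw [← hu]; exact hg x
    have huq : ∫ x, ‖ts Q (c - c') x‖ ^ q ∂(torusMeasure d) ≤ 8 := by
      have if1 : Integrable (fun x => ‖f x‖ ^ q) (torusMeasure d) := by
        rw [hfc]; exact integrable_rpow hq0.le (ts_continuous Q c).measurable (ts_bound Q c)
      have ig1 : Integrable (fun x => ‖g x‖ ^ q) (torusMeasure d) := by
        rw [hgc]; exact integrable_rpow hq0.le (ts_continuous Q c').measurable (ts_bound Q c')
      have h1 : ∫ x, ‖ts Q (c - c') x‖ ^ q ∂(torusMeasure d)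
          ≤ ∫ x, 2 ^ q * (‖f x‖ ^ q + ‖g x‖ ^ q) ∂(torusMeasure d) := by
        refine integral_mono (integrable_rpow hq0.le (ts_continuous Q _).measurable hut)
          ((if1.add ig1).const_mul _) ?_
        intro x
        change ‖ts Q (c - c') x‖ ^ q ≤ 2 ^ q * (‖f x‖ ^ q + ‖g x‖ ^ q)
        rw [← hu]
        exact (Real.rpow_le_rpow (norm_nonneg _) (norm_sub_le _ _) hq0.le).trans
          (rpow_add_le' hq (norm_nonneg _) (norm_nonneg _))
      rw [integral_const_mul, integral_add if1 ig1] at h1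
      have h2 : (2 : ℝ) ^ q ≤ 4 := by
        calc (2 : ℝ) ^ q ≤ 2 ^ (2 : ℝ) := Real.rpow_le_rpow_of_exponent_le (by norm_num) hq2
          _ = 4 := by norm_num
      refine h1.trans ?_
      calc _ ≤ (2 : ℝ) ^ q * 2 := by gcongr; linarith
        _ ≤ 8 := by linarith
    have hcoef : ∑ k ∈ Q, ‖(c - c') k‖ ^ 2 ≤ a ^ 2 := by
      refine (ts_coeff_sq_le Q _).trans
        ((l2_of_lq hq hq2 (ts_continuous Q _).measurable hut).trans ?_)
      rw [ha2]
      have : 0 ≤ t ^ (2 - q) := by positivity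
      nlinarith
    obtain ⟨y, hyN, hy⟩ := hNn (fun k => (c - c') k.1 / a) (by
      simp only [norm_div, div_pow, Complex.norm_real, Real.norm_eq_abs, sq_abs]
      rw [← Finset.sum_div, div_le_one (by positivity)]
      rw [Finset.sum_coe_sort Q (fun k => ‖(c - c') k‖ ^ 2)]
      exact hcoef)
    have hgood : good (g, y) f := by
      refine ⟨hf, fun x => ?_⟩
      have h1 := hy x
      rw [Finset.sum_coe_sort Q (fun k => (c - c') k / (a : ℂ) * ((1 : ℝ) : ℂ) * ee k x)] at h1
      have haC : (a : ℂ) ≠ 0 := by exact_mod_cast hap.ne'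
      have e : f x - g x - a * y x
          = a * (∑ k ∈ Q, (c - c') k / (a : ℂ) * ((1 : ℝ) : ℂ) * ee k x - y x) := by
        rw [hu, mul_sub, Finset.mul_sum]
        congr 1
        unfold ts
        apply Finset.sum_congr rfl
        intro k _
        field_simp; simp
      change ‖f x - g x - a * y x‖ ≤ t / 4
      rw [e, norm_mul, Complex.norm_real, Real.norm_of_nonneg hap.le]
      calc _ ≤ a * t' := by gcongr
        _ = t / 4 := by rw [ht']; field_simp
    have hrg := hr2 (g, y) ⟨f, hgood⟩
    refine ⟨r (g, y), Finset.mem_image_of_mem _ (Finset.mem_product.2 ⟨hgY, hyN⟩), fun x => ?_⟩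
    have e : f x - r (g, y) x = (f x - g x - a * y x) - (r (g, y) x - g x - a * y x) := by ring
    rw [e]
    refine (norm_sub_le _ _).trans ?_
    have h1 := hgood.2 x
    have h2 := hrg.2 x
    simp only at h1 h2
    linarith

lemma cover_small (d : ℕ) (q : ℝ) (hq : 1 ≤ q) (hq2 : q ≤ 2) : ∃ A : ℝ, 0 ≤ A ∧ ∀ n : ℕ, 1 ≤ n →
    ∀ (Q : Finset (Fin d → ℤ)), Q.Nonempty → (∀ k ∈ Q, ∀ j, |k j| ≤ 2 ^ n) →
    ∀ T : ℝ, 0 < T → T ^ q = Q.card → (∀ f ∈ ballq q Q, ∀ x, ‖f x‖ ≤ T) ∧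
    ∀ i : ℕ, 1 / 32 ≤ T / 2 ^ i → ∃ N : Finset ((Fin d → ℝ) → ℂ), (∀ g ∈ N, Continuous g) ∧
        (N.card : ℝ) ≤ Real.exp (A * n * (Q.card / (T / 2 ^ i) ^ q)) ∧
        ∀ f ∈ ballq q Q, ∃ g ∈ N, ∀ x, ‖f x - g x‖ ≤ (T / 2 ^ i) / 2 := by
  classical
  have hq0 : 0 < q := by linarith
  obtain ⟨C, hC1, hC⟩ := trig_cover d (3 * d + 20) (by positivity)
  refine ⟨129 * C * 2 ^ q, by positivity, ?_⟩
  intro n hn Q hne hQ T hT hTq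
  have hsup : ∀ f ∈ ballq q Q, ∀ x, ‖f x‖ ≤ T := by
    intro f hf x
    have := sup_small hq hq2 Q f hf x
    rw [← hTq] at this
    exact (Real.rpow_le_rpow_iff (norm_nonneg _) hT.le hq0).1 this
  refine ⟨hsup, ?_⟩
  have key : ∀ i : ℕ, 1 / 64 ≤ T / 2 ^ i → ∃ Y : Finset ((Fin d → ℝ) → ℂ),
      (∀ g ∈ Y, g ∈ ballq q Q) ∧
      (Y.card : ℝ) ≤ Real.exp (129 * C * n * (Q.card / (T / 2 ^ i) ^ q)) ∧
      ∀ f ∈ ballq q Q, ∃ g ∈ Y, ∀ x, ‖f x - g x‖ ≤ T / 2 ^ i := by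
    intro i
    induction i with
    | zero =>
      intro _
      refine ⟨{ts Q 0}, ?_, ?_, ?_⟩
      · intro g hg
        rw [Finset.mem_singleton.1 hg]
        exact ⟨⟨0, rfl⟩, by simp [ts, Real.zero_rpow hq0.ne']⟩
      · simp; positivity
      · intro f hf
        refine ⟨_, Finset.mem_singleton_self _, fun x => ?_⟩
        have := hsup f hf x
        simpa [ts] using this
    | succ i ih =>
      intro h
      have e : T / 2 ^ (i + 1) = (T / 2 ^ i) / 2 := by rw [pow_succ]; field_simp
      rw [e] at h
      have hi : 1 / 64 ≤ T / 2 ^ i := by linarith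
      obtain ⟨Y, h1, h2, h3⟩ := ih hi
      rw [e]
      refine small_step hq hq2 hn hC1 (hC n hn) Q hne hQ (T / 2 ^ i) hi ?_ Y h1 h2 h3
      rw [← hTq]
      apply Real.rpow_le_rpow (by positivity) _ hq0.le
      exact div_le_self hT.le (one_le_pow₀ (by norm_num))
  intro i hi
  have e : T / 2 ^ (i + 1) = (T / 2 ^ i) / 2 := by rw [pow_succ]; field_simp
  obtain ⟨Y, h1, h2, h3⟩ := key (i + 1) (by rw [e]; linarith)
  rw [e] at h2 h3
  refine ⟨Y, ?_, h2.trans (le_of_eq ?_), h3⟩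
  · intro g hg
    obtain ⟨⟨c, rfl⟩, _⟩ := h1 g hg
    exact ts_continuous Q c
  · rw [Real.div_rpow (by positivity) (by norm_num)]
    congr 1
    have : 0 < (T / 2 ^ i) ^ q := by positivity
    field_simp


/-! ### Combinatorics of the hyperbolic cross -/

lemma floor_two_pow (s : ℕ) : ⌊(2 : ℝ) ^ ((s : ℤ) - 1)⌋ = ((2 ^ s / 2 : ℕ) : ℤ) := by
  cases s with
  | zero => norm_num
  | succ r =>
    have h1 : ((r + 1 : ℕ) : ℤ) - 1 = (r : ℤ) := by push_cast; ring
    rw [h1, zpow_natCast]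
    have h2 : (2 ^ (r + 1) / 2 : ℕ) = 2 ^ r := by rw [pow_succ]; simp
    rw [h2]
    have h3 : ((2 : ℝ) ^ r) = (((2 ^ r : ℕ) : ℤ) : ℝ) := by push_cast; rfl
    rw [h3, Int.floor_intCast]

/-- Admissible dyadic levels. -/
def lev {d : ℕ} (γ : Fin d → ℝ) (n : ℕ) : Finset (Fin d → ℕ) :=
  by classical exact
  (Fintype.piFinset fun _ : Fin d => Finset.range (n + 1)).filter (fun s => ∑ j, γ j * (s j : ℝ) ≤ n)

lemma mem_lev {d : ℕ} {γ : Fin d → ℝ} (hγ : ∀ j, 1 ≤ γ j) {n : ℕ} {s : Fin d → ℕ} :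
    s ∈ lev γ n ↔ ∑ j, γ j * (s j : ℝ) ≤ n := by
  classical
  unfold lev
  rw [Finset.mem_filter, Fintype.mem_piFinset]
  refine ⟨fun h => h.2, fun h => ⟨fun j => ?_, h⟩⟩
  rw [Finset.mem_range]
  have h1 : γ j * (s j : ℝ) ≤ ∑ j, γ j * (s j : ℝ) :=
    Finset.single_le_sum (f := fun j => γ j * (s j : ℝ))
      (fun i _ => mul_nonneg (by linarith [hγ i]) (Nat.cast_nonneg _)) (Finset.mem_univ j)
  have h2 : (s j : ℝ) ≤ γ j * (s j : ℝ) := by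
    have := hγ j
    have h0 : (0 : ℝ) ≤ s j := Nat.cast_nonneg _
    nlinarith
  have h3 : (s j : ℝ) ≤ n := by linarith
  have : s j ≤ n := by exact_mod_cast h3
  omega

lemma hc_abs_lt {d : ℕ} {γ : Fin d → ℝ} (hγ : ∀ j, 1 ≤ γ j) {n : ℕ} {k : Fin d → ℤ}
    (hk : k ∈ hyperbolicCross d γ n) : ∀ j, |k j| ≤ 2 ^ n := by
  obtain ⟨s, hs, hk⟩ := hk
  classical
  have := (mem_lev hγ).2 hs
  unfold lev at this
  rw [Finset.mem_filter, Fintype.mem_piFinset] at this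
  intro j
  have h1 := this.1 j
  rw [Finset.mem_range] at h1
  exact (hk j).2.le.trans (pow_le_pow_right₀ (by norm_num) (by omega))

lemma hc_finite {d : ℕ} {γ : Fin d → ℝ} (hγ : ∀ j, 1 ≤ γ j) (n : ℕ) :
    (hyperbolicCross d γ n).Finite := by
  apply Set.Finite.subset (Finset.finite_toSet
    (Fintype.piFinset fun _ : Fin d => Finset.Icc (-(2 : ℤ) ^ n) (2 ^ n)))
  intro k hk
  rw [Finset.mem_coe, Fintype.mem_piFinset]
  intro j
  rw [Finset.mem_Icc]
  exact abs_le.1 (hc_abs_lt hγ hk j)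

lemma hc_zero_mem {d : ℕ} {γ : Fin d → ℝ} (n : ℕ) : (0 : Fin d → ℤ) ∈ hyperbolicCross d γ n := by
  refine ⟨0, by simp, fun j => ?_⟩
  rw [floor_two_pow]
  simp

lemma prod_ite_le {d ν : ℕ} (a : ℕ) (ha : 1 ≤ a) :
    ∏ j : Fin d, (if 0 < (j : ℕ) ∧ (j : ℕ) < ν then a else 1) ≤ a ^ (ν - 1) := by
  classical
  rw [Finset.prod_ite, Finset.prod_const_one, mul_one, Finset.prod_const]
  apply Nat.pow_le_pow_right ha
  calc _ = ((Finset.univ.filter fun j : Fin d => 0 < (j : ℕ) ∧ (j : ℕ) < ν).image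
        Fin.val).card := (Finset.card_image_of_injective _ Fin.val_injective).symm
    _ ≤ (Finset.Ico 1 ν).card := by
        apply Finset.card_le_card
        intro x hx
        obtain ⟨j, hj, rfl⟩ := Finset.mem_image.1 hx
        rw [Finset.mem_filter] at hj
        rw [Finset.mem_Ico]; omega
    _ = ν - 1 := by simp

lemma prod_ite_eq {d ν : ℕ} (hνd : ν ≤ d) (a : ℕ) :
    ∏ j : Fin d, (if 0 < (j : ℕ) ∧ (j : ℕ) < ν then a else 1) = a ^ (ν - 1) := by
  classical
  rw [Finset.prod_ite, Finset.prod_const_one, mul_one, Finset.prod_const]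
  congr 1
  calc _ = ((Finset.univ.filter fun j : Fin d => 0 < (j : ℕ) ∧ (j : ℕ) < ν).image
        Fin.val).card := (Finset.card_image_of_injective _ Fin.val_injective).symm
    _ = (Finset.Ico 1 ν).card := by
        congr 1
        ext x
        rw [Finset.mem_image, Finset.mem_Ico]
        constructor
        · rintro ⟨j, hj, rfl⟩
          rw [Finset.mem_filter] at hj
          omega
        · intro hx
          exact ⟨⟨x, by omega⟩, by rw [Finset.mem_filter]; exact ⟨Finset.mem_univ _, by simp; omega⟩, rfl⟩
    _ = ν - 1 := by simp

/-- Levels of total size `n - l`. -/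
def levl {d : ℕ} (γ : Fin d → ℝ) (n l : ℕ) : Finset (Fin d → ℕ) :=
  by classical exact (lev γ n).filter (fun s => ∑ j, s j + l = n)

lemma levl_card_nat {d ν : ℕ} {γ : Fin d → ℝ} (hν : 1 ≤ ν) (hνd : ν ≤ d)
    (hγ1 : ∀ j : Fin d, (j : ℕ) < ν → γ j = 1) (hγ2 : ∀ j : Fin d, ν ≤ (j : ℕ) → 1 < γ j) :
    ∃ M0 : ℕ, ∀ n l : ℕ, (levl γ n l).card ≤ (n + 1) ^ (ν - 1) * (M0 * l + 1) ^ d := by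
  classical
  have hγ : ∀ j, 1 ≤ γ j := by
    intro j
    rcases lt_or_ge (j : ℕ) ν with h | h
    · exact (hγ1 j h).ge
    · exact (hγ2 j h).le
  refine ⟨∑ j, ⌈1 / (γ j - 1)⌉₊, ?_⟩
  set M0 := ∑ j, ⌈1 / (γ j - 1)⌉₊ with hM0
  intro n l
  have hd : 0 < d := by omega
  let j0 : Fin d := ⟨0, hd⟩
  let P : Fin d → Finset ℕ := fun j => if (j : ℕ) = 0 then {0} else
    if (j : ℕ) < ν then Finset.range (n + 1) else Finset.range (M0 * l + 1)
  have hmaps : ∀ s ∈ levl γ n l, Function.update s j0 0 ∈ Fintype.piFinset P := by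
    intro s hs
    unfold levl at hs
    rw [Finset.mem_filter] at hs
    rw [Fintype.mem_piFinset]
    intro j
    by_cases hj : j = j0
    · subst hj; simp [P, j0]
    · rw [Function.update_of_ne hj]
      have hj' : (j : ℕ) ≠ 0 := fun h => hj (Fin.ext h)
      simp only [P, if_neg hj']
      have hmem := hs.1
      have hsum := (mem_lev hγ).1 hs.1
      split_ifs with hlt
      · unfold lev at hmem
        rw [Finset.mem_filter, Fintype.mem_piFinset] at hmem
        exact hmem.1 j
      · rw [Finset.mem_range]
        have hgt := hγ2 j (by omega)
        have h1 : ∑ i, (γ i - 1) * (s i : ℝ) ≤ l := by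
          have h2 : ((∑ i, s i + l : ℕ) : ℝ) = n := by rw [hs.2]
          push_cast at h2
          simp only [sub_mul, one_mul, Finset.sum_sub_distrib]
          linarith
        have h3 : (γ j - 1) * (s j : ℝ) ≤ l := by
          refine le_trans ?_ h1
          exact Finset.single_le_sum (f := fun i => (γ i - 1) * (s i : ℝ))
            (fun i _ => mul_nonneg (by linarith [hγ i]) (Nat.cast_nonneg _)) (Finset.mem_univ j)
        have h4 : (1 / (γ j - 1)) ≤ M0 := by
          refine (Nat.le_ceil _).trans ?_
          rw [hM0]
          have := Finset.single_le_sum (f := fun j => ⌈1 / (γ j - 1)⌉₊) (fun i _ => Nat.zero_le _)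
            (Finset.mem_univ j)
          exact_mod_cast this
        have h5 : (s j : ℝ) ≤ M0 * l := by
          have hp : 0 < γ j - 1 := by linarith
          have h6 : (s j : ℝ) ≤ (1 / (γ j - 1)) * l := by
            rw [one_div, inv_mul_eq_div, le_div_iff₀ hp]; linarith
          refine h6.trans ?_
          gcongr
        have : s j ≤ M0 * l := by exact_mod_cast h5
        omega
  have hinj : Set.InjOn (fun s : Fin d → ℕ => Function.update s j0 0) (levl γ n l) := by
    intro s hs s' hs' heq
    rw [Finset.mem_coe] at hs hs'
    unfold levl at hs hs'
    rw [Finset.mem_filter] at hs hs'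
    have hne : ∀ j, j ≠ j0 → s j = s' j := by
      intro j hj
      have := congrFun heq j
      simpa [Function.update_of_ne hj] using this
    have e1 := hs.2
    have e2 := hs'.2
    rw [← Finset.add_sum_erase _ _ (Finset.mem_univ j0)] at e1 e2
    have e3 : ∑ j ∈ Finset.univ.erase j0, s j = ∑ j ∈ Finset.univ.erase j0, s' j :=
      Finset.sum_congr rfl fun j hj => hne j (Finset.ne_of_mem_erase hj)
    funext j
    by_cases hj : j = j0
    · subst hj; omega
    · exact hne j hj
  have hcard := Finset.card_le_card_of_injOn _ hmaps hinj
  refine hcard.trans ?_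
  rw [Fintype.card_piFinset]
  have h1 : ∀ j ∈ (Finset.univ : Finset (Fin d)), (P j).card
      ≤ (if 0 < (j : ℕ) ∧ (j : ℕ) < ν then n + 1 else 1) * (M0 * l + 1) := by
    intro j _
    simp only [P]
    split_ifs <;> first | omega | simp
  refine (Finset.prod_le_prod' h1).trans ?_
  rw [Finset.prod_mul_distrib, Finset.prod_const, Finset.card_univ, Fintype.card_fin]
  exact Nat.mul_le_mul_right _ (prod_ite_le (n + 1) (by omega))

lemma levl_card {d ν : ℕ} {γ : Fin d → ℝ} (hν : 1 ≤ ν) (hνd : ν ≤ d)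
    (hγ1 : ∀ j : Fin d, (j : ℕ) < ν → γ j = 1) (hγ2 : ∀ j : Fin d, ν ≤ (j : ℕ) → 1 < γ j)
    (κ : ℝ) (hκ : 0 < κ) :
    ∃ C : ℝ, 0 < C ∧ ∀ n l : ℕ, 1 ≤ n →
      ((levl γ n l).card : ℝ) ≤ C * (n : ℝ) ^ (ν - 1) * Real.exp (κ * l) := by
  obtain ⟨M0, hM⟩ := levl_card_nat hν hνd hγ1 hγ2
  have hd : (0 : ℝ) < d := by exact_mod_cast (by omega : 0 < d)
  set b : ℝ := 1 + M0 * d / κ with hb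
  have hbp : 0 < b := by positivity
  refine ⟨2 ^ (ν - 1) * b ^ d, by positivity, ?_⟩
  intro n l hn
  have h1 : ((levl γ n l).card : ℝ) ≤ ((n : ℝ) + 1) ^ (ν - 1) * ((M0 : ℝ) * l + 1) ^ d := by
    exact_mod_cast hM n l
  have hn1 : (1 : ℝ) ≤ n := by exact_mod_cast hn
  have h2 : ((n : ℝ) + 1) ^ (ν - 1) ≤ 2 ^ (ν - 1) * (n : ℝ) ^ (ν - 1) := by
    rw [← mul_pow]
    apply pow_le_pow_left₀ (by positivity); linarith
  have h3 : (M0 : ℝ) * l + 1 ≤ b * Real.exp (κ * l / d) := by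
    have h4 := Real.add_one_le_exp (κ * l / d)
    have h5 : (M0 : ℝ) * l + 1 ≤ b * (κ * l / d + 1) := by
      have e : b * (κ * l / d + 1) = M0 * l + 1 + (κ * l / d + M0 * d / κ) := by
        rw [hb]; field_simp; ring
      rw [e]
      have : 0 ≤ κ * l / d + M0 * d / κ := by positivity
      linarith
    exact h5.trans (by gcongr)
  have h6 : ((M0 : ℝ) * l + 1) ^ d ≤ b ^ d * Real.exp (κ * l) := by
    refine (pow_le_pow_left₀ (by positivity) h3 d).trans (le_of_eq ?_)
    rw [mul_pow, ← Real.exp_nat_mul]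
    congr 2
    field_simp
  calc ((levl γ n l).card : ℝ) ≤ _ := h1
    _ ≤ (2 ^ (ν - 1) * (n : ℝ) ^ (ν - 1)) * (b ^ d * Real.exp (κ * l)) := by gcongr
    _ = _ := by ring

lemma hc_card_lower {d ν : ℕ} {γ : Fin d → ℝ} (hν : 1 ≤ ν) (hνd : ν ≤ d)
    (hγ1 : ∀ j : Fin d, (j : ℕ) < ν → γ j = 1) (Q : ℕ → Finset (Fin d → ℤ))
    (hQ : ∀ n, (Q n : Set (Fin d → ℤ)) = hyperbolicCross d γ n) :
    ∃ C : ℝ, 0 < C ∧ ∀ n : ℕ, 1 ≤ n → (2 : ℝ) ^ n * (n : ℝ) ^ (ν - 1) ≤ C * (Q n).card := by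
  classical
  refine ⟨2 ^ d * (ν : ℝ) ^ (ν - 1), by positivity, ?_⟩
  intro n hn
  have hd : 0 < d := by omega
  let j0 : Fin d := ⟨0, hd⟩
  let P : Fin d → Finset ℕ := fun j =>
    if 0 < (j : ℕ) ∧ (j : ℕ) < ν then Finset.range (n / ν + 1) else {0}
  let A : Finset (Fin d → ℕ) := Fintype.piFinset P
  have hA0 : ∀ a ∈ A, ∀ j : Fin d, ¬ (0 < (j : ℕ) ∧ (j : ℕ) < ν) → a j = 0 := by
    intro a ha j hj
    have := (Fintype.mem_piFinset.1 ha) j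
    simpa [P, if_neg hj] using this
  have hAsum : ∀ a ∈ A, ∑ j, a j ≤ n := by
    intro a ha
    have h1 : ∀ j ∈ (Finset.univ : Finset (Fin d)),
        a j ≤ if 0 < (j : ℕ) ∧ (j : ℕ) < ν then n / ν else 0 := by
      intro j _
      have := (Fintype.mem_piFinset.1 ha) j
      simp only [P] at this
      split_ifs at this ⊢ with h
      · rw [Finset.mem_range] at this; omega
      · simp at this; omega
    refine (Finset.sum_le_sum h1).trans ?_
    rw [Finset.sum_ite, Finset.sum_const_zero, add_zero, Finset.sum_const, smul_eq_mul]
    have hc : (Finset.univ.filter fun j : Fin d => 0 < (j : ℕ) ∧ (j : ℕ) < ν).card ≤ ν := by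
      calc _ = ((Finset.univ.filter fun j : Fin d => 0 < (j : ℕ) ∧ (j : ℕ) < ν).image
            Fin.val).card := (Finset.card_image_of_injective _ Fin.val_injective).symm
        _ ≤ (Finset.range ν).card := by
            apply Finset.card_le_card
            intro x hx
            obtain ⟨j, hj, rfl⟩ := Finset.mem_image.1 hx
            rw [Finset.mem_filter] at hj
            rw [Finset.mem_range]; omega
        _ = ν := by simp
    exact (Nat.mul_le_mul_right _ hc).trans (Nat.mul_div_le n ν)
  let sg : (Fin d → ℕ) → Fin d → ℕ := fun a j => if j = j0 then n - ∑ i, a i else a j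
  have hj0 : ∀ a ∈ A, a j0 = 0 := fun a ha => hA0 a ha j0 (by simp [j0])
  have hsgsum : ∀ a ∈ A, ∑ j, sg a j = n := by
    intro a ha
    rw [← Finset.add_sum_erase _ _ (Finset.mem_univ j0)]
    have h1 : ∑ j ∈ Finset.univ.erase j0, sg a j = ∑ j ∈ Finset.univ.erase j0, a j :=
      Finset.sum_congr rfl fun j hj => by simp [sg, Finset.ne_of_mem_erase hj]
    have h2 := Finset.add_sum_erase Finset.univ a (Finset.mem_univ j0)
    rw [hj0 a ha] at h2
    rw [h1]
    have h3 := hAsum a ha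
    have h4 : sg a j0 = n - ∑ i, a i := by simp [sg]
    omega
  let blk : (Fin d → ℕ) → Finset (Fin d → ℤ) := fun a => Fintype.piFinset fun j =>
    Finset.Ico (((2 ^ (sg a j) / 2 : ℕ) : ℤ)) (((2 ^ (sg a j) : ℕ) : ℤ))
  have hsub : A.biUnion blk ⊆ Q n := by
    intro k hk
    obtain ⟨a, ha, hka⟩ := Finset.mem_biUnion.1 hk
    rw [← Finset.mem_coe, hQ n]
    refine ⟨sg a, ?_, fun j => ?_⟩
    · have : ∑ j, γ j * (sg a j : ℝ) = ∑ j, (sg a j : ℝ) := by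
        apply Finset.sum_congr rfl
        intro j _
        by_cases h : (j : ℕ) < ν
        · rw [hγ1 j h, one_mul]
        · have h1 : j ≠ j0 := by
            intro h2; rw [h2] at h; simp [j0] at h; omega
          have h3 : sg a j = 0 := by
            simp only [sg, if_neg h1]
            exact hA0 a ha j (by omega)
          rw [h3]; simp
      rw [this]
      have h4 := hsgsum a ha
      exact_mod_cast h4.le
    · have h1 := (Fintype.mem_piFinset.1 hka) j
      rw [Finset.mem_Ico] at h1
      have h2 : 0 ≤ k j := le_trans (by positivity) h1.1
      rw [floor_two_pow, abs_of_nonneg h2]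
      exact ⟨h1.1, by have := h1.2; push_cast at this; exact this⟩
  have huniq : ∀ (s s' : ℕ) (x : ℤ), x ∈ Finset.Ico (((2 ^ s / 2 : ℕ) : ℤ)) (((2 ^ s : ℕ) : ℤ)) →
      x ∈ Finset.Ico (((2 ^ s' / 2 : ℕ) : ℤ)) (((2 ^ s' : ℕ) : ℤ)) → ¬ s < s' := by
    intro s s' x h1 h2 hlt
    rw [Finset.mem_Ico] at h1 h2
    obtain ⟨r, rfl⟩ : ∃ r, s' = r + 1 := ⟨s' - 1, by omega⟩
    have h3 : (2 ^ (r + 1) / 2 : ℕ) = 2 ^ r := by rw [pow_succ]; simp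
    rw [h3] at h2
    have h4 : (2 ^ s : ℕ) ≤ 2 ^ r := Nat.pow_le_pow_right (by norm_num) (by omega)
    have : ((2 ^ s : ℕ) : ℤ) ≤ ((2 ^ r : ℕ) : ℤ) := by exact_mod_cast h4
    omega
  have hdisj : ∀ a ∈ A, ∀ a' ∈ A, a ≠ a' → Disjoint (blk a) (blk a') := by
    intro a ha a' ha' hne
    rw [Finset.disjoint_left]
    intro k hk hk'
    apply hne
    have hs : ∀ j, sg a j = sg a' j := by
      intro j
      have h1 := (Fintype.mem_piFinset.1 hk) j
      have h2 := (Fintype.mem_piFinset.1 hk') j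
      have h3 := huniq _ _ _ h1 h2
      have h4 := huniq _ _ _ h2 h1
      omega
    funext j
    by_cases hj : j = j0
    · rw [hj, hj0 a ha, hj0 a' ha']
    · have := hs j
      simpa [sg, hj] using this
  have hblk : ∀ a ∈ A, (2 : ℝ) ^ n / 2 ^ d ≤ (blk a).card := by
    intro a ha
    rw [Fintype.card_piFinset]
    push_cast
    have h1 : ∀ j ∈ (Finset.univ : Finset (Fin d)), (2 : ℝ) ^ (sg a j) / 2 ≤
        ((Finset.Ico (((2 ^ (sg a j) / 2 : ℕ) : ℤ)) (((2 ^ (sg a j) : ℕ) : ℤ))).card : ℝ) := by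
      intro j _
      rw [Int.card_Ico]
      have h2 : ((((2 ^ (sg a j) : ℕ) : ℤ)) - ((2 ^ (sg a j) / 2 : ℕ) : ℤ)).toNat
        = 2 ^ (sg a j) - 2 ^ (sg a j) / 2 := by omega
      rw [h2, div_le_iff₀ (by norm_num)]
      have h3 : 2 ^ (sg a j) ≤ (2 ^ (sg a j) - 2 ^ (sg a j) / 2) * 2 := by omega
      exact_mod_cast h3
    refine le_trans (le_of_eq ?_) (Finset.prod_le_prod (fun j _ => by positivity) h1)
    rw [Finset.prod_div_distrib, Finset.prod_pow_eq_pow_sum, hsgsum a ha, Finset.prod_const,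
      Finset.card_univ, Fintype.card_fin]
  have hAcard : A.card = (n / ν + 1) ^ (ν - 1) := by
    rw [Fintype.card_piFinset, ← prod_ite_eq hνd (n / ν + 1)]
    apply Finset.prod_congr rfl
    intro j _
    simp only [P]
    split_ifs <;> simp
  have hfin : (A.card : ℝ) * (2 ^ n / 2 ^ d) ≤ (Q n).card := by
    have h1 := Finset.card_le_card hsub
    rw [Finset.card_biUnion hdisj] at h1
    have h2 : ((∑ a ∈ A, (blk a).card : ℕ) : ℝ) ≤ (Q n).card := by exact_mod_cast h1
    refine le_trans ?_ h2
    push_cast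
    rw [← nsmul_eq_mul]
    exact Finset.card_nsmul_le_sum _ _ _ hblk
  have hn2 : (n : ℝ) ≤ ν * ((n / ν + 1 : ℕ) : ℝ) := by
    have : n ≤ ν * (n / ν + 1) := (Nat.lt_mul_div_succ n (by omega)).le
    exact_mod_cast this
  have h3 : (n : ℝ) ^ (ν - 1) ≤ (ν : ℝ) ^ (ν - 1) * A.card := by
    rw [hAcard, Nat.cast_pow, ← mul_pow]
    exact pow_le_pow_left₀ (by positivity) hn2 _
  calc (2 : ℝ) ^ n * (n : ℝ) ^ (ν - 1) ≤ 2 ^ n * ((ν : ℝ) ^ (ν - 1) * A.card) := by gcongr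
    _ = 2 ^ d * (ν : ℝ) ^ (ν - 1) * (A.card * (2 ^ n / 2 ^ d)) := by field_simp
    _ ≤ _ := by gcongr


/-! ### Multipliers of de la Vallee Poussin type -/

def vv (M : ℕ) (k : ℤ) : ℝ := ((min M (2 * M - k.natAbs) : ℕ) : ℝ) / M

lemma vv_card (M : ℕ) (k : ℤ) :
    ((Finset.Ico (M : ℤ) (2 * M)).filter (fun b => k + b ∈ Finset.Ico (0 : ℤ) (3 * M))).card
      = min M (2 * M - k.natAbs) := by
  have : (Finset.Ico (M : ℤ) (2 * M)).filter (fun b => k + b ∈ Finset.Ico (0 : ℤ) (3 * M))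
      = Finset.Ico (max (M : ℤ) (-k)) (min (2 * M) (3 * M - k)) := by
    ext b
    simp only [Finset.mem_filter, Finset.mem_Ico, max_le_iff, lt_min_iff]
    omega
  rw [this, Int.card_Ico]
  omega

lemma vv_nonneg (M : ℕ) (k : ℤ) : 0 ≤ vv M k := by unfold vv; positivity

lemma vv_le_one (M : ℕ) (k : ℤ) : vv M k ≤ 1 := by
  unfold vv
  apply div_le_one_of_le₀ _ (Nat.cast_nonneg _)
  exact_mod_cast min_le_left _ _

lemma vv_zero (k : ℤ) : vv 0 k = 0 := by simp [vv]

lemma vv_eq_one {M : ℕ} {k : ℤ} (hM : 1 ≤ M) (hk : |k| ≤ M) : vv M k = 1 := by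
  unfold vv
  have h1 : min M (2 * M - k.natAbs) = M := by rw [Int.abs_eq_natAbs] at hk; omega
  rw [h1]
  have : (M : ℝ) ≠ 0 := by positivity
  field_simp

lemma vv_eq_zero {M : ℕ} {k : ℤ} (hk : 2 * (M : ℤ) ≤ |k|) : vv M k = 0 := by
  unfold vv
  have h1 : min M (2 * M - k.natAbs) = 0 := by rw [Int.abs_eq_natAbs] at hk; omega
  rw [h1]; simp

lemma vv_mono (M : ℕ) (k : ℤ) : vv M k ≤ vv (2 * M) k := by
  rcases Nat.eq_zero_or_pos M with h | h
  · subst h; simp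
  unfold vv
  have hM : (0 : ℝ) < M := by exact_mod_cast h
  rw [div_le_div_iff₀ hM (by push_cast; positivity)]
  have h1 : min M (2 * M - k.natAbs) * 2 ≤ min (2 * M) (2 * (2 * M) - k.natAbs) := by omega
  have h2 : ((min M (2 * M - k.natAbs) : ℕ) : ℝ) * 2 ≤ ((min (2 * M) (2 * (2 * M) - k.natAbs) : ℕ) : ℝ) := by
    exact_mod_cast h1
  rw [Nat.cast_mul, Nat.cast_ofNat]
  nlinarith

def al (r : ℕ) (k : ℤ) : ℝ := vv (2 ^ r) k - vv (2 ^ r / 2) k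

lemma two_pow_succ_half (r : ℕ) : 2 ^ (r + 1) / 2 = 2 ^ r := by rw [pow_succ]; simp

lemma al_nonneg (r : ℕ) (k : ℤ) : 0 ≤ al r k := by
  unfold al
  cases r with
  | zero => simp [vv_zero, vv_nonneg]
  | succ r =>
    rw [two_pow_succ_half, pow_succ, mul_comm]
    linarith [vv_mono (2 ^ r) k]

lemma al_le_one (r : ℕ) (k : ℤ) : al r k ≤ 1 := by
  unfold al
  linarith [vv_le_one (2 ^ r) k, vv_nonneg (2 ^ r / 2) k]

lemma al_sum (R : ℕ) (k : ℤ) : ∑ r ∈ Finset.range (R + 1), al r k = vv (2 ^ R) k := by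
  induction R with
  | zero => simp [al, vv_zero]
  | succ R ih =>
    rw [Finset.sum_range_succ, ih]
    unfold al
    rw [two_pow_succ_half]; ring

lemma al_ne_zero {r s : ℕ} {k : ℤ} (h : al r k ≠ 0) (hk : |k| < 2 ^ s) : r ≤ s := by
  by_contra hlt
  push Not at hlt
  apply h
  obtain ⟨r', rfl⟩ : ∃ r', r = r' + 1 := ⟨r - 1, by omega⟩
  unfold al
  rw [two_pow_succ_half]
  have h1 : (2 : ℤ) ^ s ≤ 2 ^ r' := pow_le_pow_right₀ (by norm_num) (by omega)
  have h2 : (2 : ℤ) ^ s ≤ 2 ^ (r' + 1) := pow_le_pow_right₀ (by norm_num) (by omega)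
  rw [vv_eq_one Nat.one_le_two_pow (by push_cast; omega),
    vv_eq_one Nat.one_le_two_pow (by push_cast; omega)]
  ring

lemma al_supp {r : ℕ} {k : ℤ} (h : al r k ≠ 0) : |k| < 2 ^ (r + 1) := by
  by_contra hlt
  push Not at hlt
  apply h
  unfold al
  rw [pow_succ] at hlt
  have h0 : ((2 ^ r / 2 : ℕ) : ℤ) ≤ ((2 ^ r : ℕ) : ℤ) := by
    exact_mod_cast Nat.div_le_self _ _
  push_cast at h0
  rw [vv_eq_zero (by push_cast; omega), vv_eq_zero (by push_cast; omega)]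
  ring

lemma integral_pa {d : ℕ} (A : Finset (Fin d → ℤ)) (x : Fin d → ℝ) :
    ∫ y, ‖∑ a ∈ A, ee a x * ee (-a) y‖ ^ 2 ∂(torusMeasure d) = A.card := by
  classical
  have h1 : ∀ y : Fin d → ℝ, ((‖∑ a ∈ A, ee a x * ee (-a) y‖ ^ 2 : ℝ) : ℂ)
      = ∑ a ∈ A, ∑ b ∈ A, (ee a x * (starRingEnd ℂ) (ee b x)) * ee (b - a) y := by
    intro y
    rw [Complex.ofReal_pow, ← Complex.mul_conj', map_sum, Finset.sum_mul_sum]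
    refine Finset.sum_congr rfl fun a _ => Finset.sum_congr rfl fun b _ => ?_
    rw [map_mul, ee_neg b, Complex.conj_conj, ee_sub, ee_neg]; ring
  have h2 : ((∫ y, ‖∑ a ∈ A, ee a x * ee (-a) y‖ ^ 2 ∂(torusMeasure d) : ℝ) : ℂ) = A.card := by
    rw [← integral_complex_ofReal]
    simp only [h1]
    have hi : ∀ a b : Fin d → ℤ, Integrable (fun y => (ee a x * (starRingEnd ℂ) (ee b x)) * ee (b - a) y)
        (torusMeasure d) := by
      intro a b
      apply Integrable.const_mul
      apply bdd_integrable (ee_continuous _).aestronglyMeasurable (B := 1)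
      intro y; rw [ee_norm]
    rw [integral_finsetSum _ fun a _ => integrable_finsetSum _ fun b _ => hi a b]
    have h3 : ∀ a ∈ A, ∫ y, ∑ b ∈ A, (ee a x * (starRingEnd ℂ) (ee b x)) * ee (b - a) y ∂(torusMeasure d)
        = 1 := by
      intro a ha
      rw [integral_finsetSum _ fun b _ => hi a b]
      simp only [integral_const_mul, integral_ee, sub_eq_zero]
      rw [Finset.sum_eq_single a]
      · rw [if_pos rfl, mul_one, Complex.mul_conj', ee_norm]; simp
      · intro b _ hb; rw [if_neg hb, mul_zero]
      · intro h; exact absurd ha h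
    rw [Finset.sum_congr rfl h3]; simp
  exact_mod_cast h2

lemma vv_op_bound {d : ℕ} (M : Fin d → ℕ) (F : Finset (Fin d → ℤ))
    (hF : ∀ k : Fin d → ℤ, (∀ j, |k j| ≤ 2 * M j) → k ∈ F) {h : (Fin d → ℝ) → ℂ} (hm : Measurable h)
    {σ : ℝ} (hσ : ∀ x, ‖h x‖ ≤ σ) (x : Fin d → ℝ) :
    ‖ts F (fun k => ((∏ j, vv (M j) (k j) : ℝ) : ℂ) * fc h k) x‖ ≤ 3 ^ d * σ := by
  classical
  have hσ0 : 0 ≤ σ := (norm_nonneg _).trans (hσ 0)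
  by_cases hM : ∃ j, M j = 0
  · obtain ⟨j, hj⟩ := hM
    have h1 : ∀ k : Fin d → ℤ, ∏ j, vv (M j) (k j) = 0 := by
      intro k
      apply Finset.prod_eq_zero (Finset.mem_univ j)
      rw [hj, vv_zero]
    unfold ts
    simp only [h1]
    simp
    positivity
  push Not at hM
  set A : Finset (Fin d → ℤ) := Fintype.piFinset fun j => Finset.Ico (0 : ℤ) (3 * M j) with hA
  set B : Finset (Fin d → ℤ) := Fintype.piFinset fun j => Finset.Ico (M j : ℤ) (2 * M j) with hB
  set Pm : ℝ := ∏ j, (M j : ℝ) with hPm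
  have hPm0 : 0 < Pm := Finset.prod_pos fun j _ => by
    have := hM j; positivity
  have hAc : (A.card : ℝ) = 3 ^ d * Pm := by
    rw [hA, Fintype.card_piFinset]
    push_cast
    have : ∀ j, ((Finset.Ico (0 : ℤ) (3 * M j)).card : ℝ) = 3 * M j := by
      intro j
      rw [Int.card_Ico]
      have : ((3 * (M j : ℤ) - 0).toNat) = 3 * M j := by omega
      rw [this]; push_cast; rfl
    simp only [this]
    rw [Finset.prod_mul_distrib]; simp [hPm]
  have hBc : (B.card : ℝ) = Pm := by
    rw [hB, Fintype.card_piFinset]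
    push_cast
    have : ∀ j, ((Finset.Ico (M j : ℤ) (2 * M j)).card : ℝ) = M j := by
      intro j
      rw [Int.card_Ico]
      have : ((2 * (M j : ℤ) - M j).toNat) = M j := by omega
      rw [this]
    simp only [this]
    rfl
  have hcnt : ∀ k : Fin d → ℤ, Pm * ∏ j, vv (M j) (k j)
      = ((B.filter fun b => k + b ∈ A).card : ℝ) := by
    intro k
    have h1 : B.filter (fun b => k + b ∈ A) = Fintype.piFinset fun j =>
        (Finset.Ico (M j : ℤ) (2 * M j)).filter (fun b => k j + b ∈ Finset.Ico (0 : ℤ) (3 * M j)) := by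
      ext b
      simp only [hA, hB, Finset.mem_filter, Fintype.mem_piFinset, Pi.add_apply]
      constructor
      · rintro ⟨h1, h2⟩ j; exact ⟨h1 j, h2 j⟩
      · intro h; exact ⟨fun j => (h j).1, fun j => (h j).2⟩
    rw [h1, Fintype.card_piFinset, hPm, ← Finset.prod_mul_distrib]
    push_cast
    apply Finset.prod_congr rfl
    intro j _
    rw [vv_card]
    unfold vv
    have : (M j : ℝ) ≠ 0 := by exact_mod_cast hM j
    field_simp
  -- rewrite the operator
  have hre : ∀ φ : (Fin d → ℤ) → ℂ, ∑ k ∈ F, ((Pm * ∏ j, vv (M j) (k j) : ℝ) : ℂ) * φ k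
      = ∑ b ∈ B, ∑ a ∈ A, φ (a - b) := by
    intro φ
    have h1 : ∀ k : Fin d → ℤ, ((Pm * ∏ j, vv (M j) (k j) : ℝ) : ℂ) * φ k
        = ∑ b ∈ B, if k + b ∈ A then φ k else 0 := by
      intro k
      rw [hcnt, ← Finset.sum_filter, Finset.sum_const, nsmul_eq_mul]
      push_cast; rfl
    simp only [h1]
    rw [Finset.sum_comm]
    apply Finset.sum_congr rfl
    intro b hb
    rw [← Finset.sum_filter]
    apply Finset.sum_bij' (fun k _ => k + b) (fun a _ => a - b)
    · intro k hk; exact (Finset.mem_filter.1 hk).2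
    · intro a ha
      rw [Finset.mem_filter]
      refine ⟨hF _ fun j => ?_, by simpa using ha⟩
      have h2 := (Fintype.mem_piFinset.1 ha) j
      have h3 := (Fintype.mem_piFinset.1 hb) j
      rw [Finset.mem_Ico] at h2 h3
      rw [Pi.sub_apply, abs_le]
      omega
    · intro k _; simp
    · intro a _; simp
    · intro k _; simp
  set pA : (Fin d → ℝ) → ℂ := fun y => ∑ a ∈ A, ee a x * ee (-a) y with hpA
  set pB : (Fin d → ℝ) → ℂ := fun y => ∑ b ∈ B, ee b x * ee (-b) y with hpB
  have hpAc : Continuous pA := continuous_finsetSum _ fun a _ => continuous_const.mul (ee_continuous _)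
  have hpBc : Continuous pB := continuous_finsetSum _ fun a _ => continuous_const.mul (ee_continuous _)
  have hbd : ∀ (S : Finset (Fin d → ℤ)) y, ‖∑ a ∈ S, ee a x * ee (-a) y‖ ≤ S.card := by
    intro S y
    refine (norm_sum_le _ _).trans ?_
    simp [ee_norm]
  have hint2 : ∀ p : (Fin d → ℝ) → ℂ, Continuous p → ∀ c : ℝ, (∀ y, ‖p y‖ ≤ c) →
      Integrable (fun y => ‖p y‖ ^ 2) (torusMeasure d) := by
    intro p hp c hc
    apply bdd_integrable (by fun_prop) (B := c ^ 2)
    intro y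
    rw [Real.norm_of_nonneg (by positivity)]
    gcongr
    exact hc y
  have hkey : (Pm : ℂ) * ts F (fun k => ((∏ j, vv (M j) (k j) : ℝ) : ℂ) * fc h k) x
      = ∫ y, h y * (pA y * (starRingEnd ℂ) (pB y)) ∂(torusMeasure d) := by
    unfold ts
    rw [Finset.mul_sum]
    have e1 : ∑ k ∈ F, (Pm : ℂ) * (((∏ j, vv (M j) (k j) : ℝ) : ℂ) * fc h k * ee k x)
        = ∑ k ∈ F, ((Pm * ∏ j, vv (M j) (k j) : ℝ) : ℂ) * (fc h k * ee k x) := by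
      apply Finset.sum_congr rfl
      intro k _
      rw [Complex.ofReal_mul]; ring
    rw [e1, hre]
    have e2 : ∀ y, h y * (pA y * (starRingEnd ℂ) (pB y))
        = ∑ b ∈ B, ∑ a ∈ A, (h y * ee (-(a - b)) y) * ee (a - b) x := by
      intro y
      simp only [hpA, hpB]
      rw [mul_comm (∑ a ∈ A, _), map_sum, Finset.sum_mul_sum, Finset.mul_sum]
      apply Finset.sum_congr rfl
      intro b _
      rw [Finset.mul_sum]
      apply Finset.sum_congr rfl
      intro a _
      rw [map_mul, ← ee_neg, ← ee_neg, neg_neg, neg_sub, ee_sub b, ee_sub a, ← ee_neg, ← ee_neg]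
      ring
    simp only [e2]
    have hi : ∀ k : Fin d → ℤ, Integrable (fun y => (h y * ee (-k) y) * ee k x) (torusMeasure d) :=
      fun k => (integrable_mul_ee hm hσ (-k)).mul_const _
    rw [integral_finsetSum _ fun b _ => integrable_finsetSum _ fun a _ => hi (a - b)]
    apply Finset.sum_congr rfl
    intro b _
    rw [integral_finsetSum _ fun a _ => hi (a - b)]
    apply Finset.sum_congr rfl
    intro a _
    rw [integral_mul_const]; rfl
  have hbound : ‖∫ y, h y * (pA y * (starRingEnd ℂ) (pB y)) ∂(torusMeasure d)‖ ≤ σ * (3 ^ d * Pm) := by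
    have hiA := hint2 pA hpAc _ (hbd A)
    have hiB := hint2 pB hpBc _ (hbd B)
    calc _ ≤ ∫ y, σ * ((‖pA y‖ ^ 2 + 3 ^ d * ‖pB y‖ ^ 2) / 2) ∂(torusMeasure d) := by
          apply norm_integral_le_of_norm_le
          · exact ((hiA.add (hiB.const_mul _)).div_const 2).const_mul σ
          · refine Filter.Eventually.of_forall fun y => ?_
            rw [norm_mul, norm_mul, RCLike.norm_conj]
            apply mul_le_mul (hσ y) _ (by positivity) hσ0
            have h3 : (1 : ℝ) ≤ 3 ^ d := one_le_pow₀ (by norm_num)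
            nlinarith [sq_nonneg (‖pA y‖ - ‖pB y‖), sq_nonneg (‖pB y‖)]
      _ = σ * ((A.card + 3 ^ d * B.card) / 2) := by
          rw [integral_const_mul, integral_div, integral_add hiA (hiB.const_mul _), integral_const_mul,
            integral_pa, integral_pa]
      _ = σ * (3 ^ d * Pm) := by rw [hAc, hBc]; ring
  rw [← hkey, norm_mul, Complex.norm_real, Real.norm_of_nonneg hPm0.le] at hbound
  have : Pm * ‖ts F (fun k => ((∏ j, vv (M j) (k j) : ℝ) : ℂ) * fc h k) x‖ ≤ Pm * (3 ^ d * σ) := by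
    linarith
  exact le_of_mul_le_mul_left this hPm0

def bb {d : ℕ} (s : Fin d → ℕ) (k : Fin d → ℤ) : ℝ := ∏ j, al (s j) (k j)

lemma bb_nonneg {d : ℕ} (s : Fin d → ℕ) (k : Fin d → ℤ) : 0 ≤ bb s k :=
  Finset.prod_nonneg fun _ _ => al_nonneg _ _

lemma bb_le_one {d : ℕ} (s : Fin d → ℕ) (k : Fin d → ℤ) : bb s k ≤ 1 :=
  Finset.prod_le_one (fun _ _ => al_nonneg _ _) fun _ _ => al_le_one _ _

def fbox (d n : ℕ) : Finset (Fin d → ℤ) :=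
  Fintype.piFinset fun _ : Fin d => Finset.Icc (-(2 : ℤ) ^ (n + 1)) (2 ^ (n + 1))

lemma mem_fbox {d n : ℕ} {k : Fin d → ℤ} : k ∈ fbox d n ↔ ∀ j, |k j| ≤ 2 ^ (n + 1) := by
  unfold fbox
  rw [Fintype.mem_piFinset]
  simp only [Finset.mem_Icc, abs_le]

lemma bb_op_bound {d n : ℕ} (s : Fin d → ℕ) (hs : ∀ j, s j ≤ n) {h : (Fin d → ℝ) → ℂ} (hm : Measurable h)
    {σ : ℝ} (hσ : ∀ x, ‖h x‖ ≤ σ) (x : Fin d → ℝ) :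
    ‖ts (fbox d n) (fun k => (bb s k : ℂ) * fc h k) x‖ ≤ 6 ^ d * σ := by
  classical
  let sg : Bool → ℝ := fun e => if e then 1 else -1
  let MM : Bool → ℕ → ℕ := fun e r => if e then 2 ^ r else 2 ^ r / 2
  have hMM : ∀ e r, MM e r ≤ 2 ^ r := by
    intro e r
    cases e
    · exact Nat.div_le_self _ _
    · exact le_rfl
  have h1 : ∀ k, bb s k = ∑ e : Fin d → Bool, (∏ j, sg (e j)) * ∏ j, vv (MM (e j) (s j)) (k j) := by
    intro k
    unfold bb
    have h2 : ∀ j, al (s j) (k j) = ∑ e : Bool, sg e * vv (MM e (s j)) (k j) := by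
      intro j
      simp [sg, MM, al]; ring
    simp only [h2]
    rw [Finset.prod_univ_sum, Fintype.piFinset_univ]
    exact Finset.sum_congr rfl fun e _ => Finset.prod_mul_distrib
  have h2 : ts (fbox d n) (fun k => (bb s k : ℂ) * fc h k) x
      = ∑ e : Fin d → Bool, ((∏ j, sg (e j) : ℝ) : ℂ) *
        ts (fbox d n) (fun k => ((∏ j, vv (MM (e j) (s j)) (k j) : ℝ) : ℂ) * fc h k) x := by
    unfold ts
    simp only [Finset.mul_sum]
    rw [Finset.sum_comm]
    apply Finset.sum_congr rfl
    intro k _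
    rw [h1, Complex.ofReal_sum, Finset.sum_mul, Finset.sum_mul]
    apply Finset.sum_congr rfl
    intro e _
    rw [Complex.ofReal_mul]; ring
  rw [h2]
  refine (norm_sum_le _ _).trans ?_
  have h3 : ∀ e ∈ (Finset.univ : Finset (Fin d → Bool)), ‖((∏ j, sg (e j) : ℝ) : ℂ) *
        ts (fbox d n) (fun k => ((∏ j, vv (MM (e j) (s j)) (k j) : ℝ) : ℂ) * fc h k) x‖ ≤ 3 ^ d * σ := by
    intro e _
    rw [norm_mul, Complex.norm_real, norm_prod]
    have h4 : ∀ b, ‖sg b‖ = 1 := by intro b; cases b <;> simp [sg]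
    simp only [h4, Finset.prod_const_one, one_mul]
    apply vv_op_bound _ _ _ hm hσ
    intro k hk
    rw [mem_fbox]
    intro j
    refine (hk j).trans ?_
    have h5 : MM (e j) (s j) ≤ 2 ^ n := (hMM _ _).trans (Nat.pow_le_pow_right (by norm_num) (hs j))
    have h6 : ((MM (e j) (s j) : ℕ) : ℤ) ≤ 2 ^ n := by exact_mod_cast h5
    rw [pow_succ]; linarith
  refine (Finset.sum_le_card_nsmul _ _ _ h3).trans (le_of_eq ?_)
  rw [nsmul_eq_mul, Finset.card_univ]
  simp
  rw [← mul_assoc, ← mul_pow]; norm_num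

/-- Sum of the multipliers over one layer. -/
def BL {d : ℕ} (γ : Fin d → ℝ) (n l : ℕ) (k : Fin d → ℤ) : ℝ := ∑ s ∈ levl γ n l, bb s k

lemma BL_nonneg {d : ℕ} (γ : Fin d → ℝ) (n l : ℕ) (k : Fin d → ℤ) : 0 ≤ BL γ n l k :=
  Finset.sum_nonneg fun _ _ => bb_nonneg _ _

lemma lev_le {d : ℕ} {γ : Fin d → ℝ} {n : ℕ} {s : Fin d → ℕ} (hs : s ∈ lev γ n) (j : Fin d) : s j ≤ n := by
  classical
  unfold lev at hs
  rw [Finset.mem_filter, Fintype.mem_piFinset] at hs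
  have := hs.1 j
  rw [Finset.mem_range] at this; omega

lemma levl_sub {d : ℕ} {γ : Fin d → ℝ} {n l : ℕ} {s : Fin d → ℕ} (hs : s ∈ levl γ n l) :
    s ∈ lev γ n ∧ ∑ j, s j + l = n := by
  classical
  unfold levl at hs
  rwa [Finset.mem_filter] at hs

lemma bb_box_sum {d : ℕ} (n : ℕ) (k : Fin d → ℤ) :
    ∑ s ∈ Fintype.piFinset (fun _ : Fin d => Finset.range (n + 1)), bb s k = ∏ j, vv (2 ^ n) (k j) := by
  classical
  unfold bb
  rw [← Finset.prod_univ_sum (fun _ : Fin d => Finset.range (n + 1)) (fun j r => al r (k j))]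
  exact Finset.prod_congr rfl fun j _ => al_sum n (k j)

lemma BL_le_one {d : ℕ} (γ : Fin d → ℝ) (n l : ℕ) (k : Fin d → ℤ) : BL γ n l k ≤ 1 := by
  classical
  have h1 : BL γ n l k ≤ ∑ s ∈ Fintype.piFinset (fun _ : Fin d => Finset.range (n + 1)), bb s k := by
    apply Finset.sum_le_sum_of_subset_of_nonneg
    · intro s hs
      rw [Fintype.mem_piFinset]
      intro j
      rw [Finset.mem_range]
      have := lev_le (levl_sub hs).1 j
      omega
    · intro s _ _; exact bb_nonneg _ _
  rw [bb_box_sum] at h1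
  exact h1.trans (Finset.prod_le_one (fun _ _ => vv_nonneg _ _) fun _ _ => vv_le_one _ _)

lemma BL_sum_one {d : ℕ} {γ : Fin d → ℝ} (hγ : ∀ j, 1 ≤ γ j) (n : ℕ) {k : Fin d → ℤ}
    (hk : k ∈ hyperbolicCross d γ n) : ∑ l ∈ Finset.range (n + 1), BL γ n l k = 1 := by
  classical
  have hkn := hc_abs_lt hγ hk
  obtain ⟨s0, hs0, hk0⟩ := hk
  have h1 : ∑ l ∈ Finset.range (n + 1), BL γ n l k = ∑ s ∈ lev γ n, bb s k := by
    unfold BL levl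
    rw [← Finset.sum_fiberwise_of_maps_to (s := lev γ n) (t := Finset.range (n + 1))
      (g := fun s => n - ∑ j, s j) (by intro s _; rw [Finset.mem_range]; omega)]
    apply Finset.sum_congr rfl
    intro l hl
    apply Finset.sum_congr _ fun _ _ => rfl
    ext s
    simp only [Finset.mem_filter]
    refine and_congr_right fun hs => ?_
    have hsum : ∑ j, s j ≤ n := by
      have h2 := (mem_lev hγ).1 hs
      have h3 : ((∑ j, s j : ℕ) : ℝ) ≤ n := by
        push_cast
        refine le_trans (Finset.sum_le_sum fun j _ => ?_) h2
        have := hγ j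
        have h0 : (0 : ℝ) ≤ s j := Nat.cast_nonneg _
        nlinarith
      exact_mod_cast h3
    rw [Finset.mem_range] at hl
    omega
  have h2 : ∑ s ∈ lev γ n, bb s k
      = ∑ s ∈ Fintype.piFinset (fun _ : Fin d => Finset.range (n + 1)), bb s k := by
    apply Finset.sum_subset
    · intro s hs
      rw [Fintype.mem_piFinset]
      intro j
      rw [Finset.mem_range]
      have := lev_le hs j
      omega
    · intro s _ hs
      by_contra hne
      apply hs
      rw [mem_lev hγ]
      refine le_trans (Finset.sum_le_sum fun j _ => ?_) hs0
      have h3 : al (s j) (k j) ≠ 0 := fun h => hne (Finset.prod_eq_zero (Finset.mem_univ j) h)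
      have h4 : s j ≤ s0 j := al_ne_zero h3 (hk0 j).2
      have h5 : (s j : ℝ) ≤ s0 j := by exact_mod_cast h4
      have := hγ j
      nlinarith
  rw [h1, h2, bb_box_sum]
  apply Finset.prod_eq_one
  intro j _
  exact vv_eq_one Nat.one_le_two_pow (by push_cast; exact hkn j)

lemma BL_sum_le {d : ℕ} (γ : Fin d → ℝ) (n l : ℕ) :
    ∑ k ∈ fbox d n, BL γ n l k ≤ 4 ^ d * (2 ^ n / 2 ^ l) * (levl γ n l).card := by
  classical
  unfold BL
  rw [Finset.sum_comm]
  have h1 : ∀ s ∈ levl γ n l, ∑ k ∈ fbox d n, bb s k ≤ 4 ^ d * (2 ^ n / 2 ^ l) := by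
    intro s hs
    set S : Finset (Fin d → ℤ) := Fintype.piFinset fun j =>
      Finset.Ico (-(2 : ℤ) ^ (s j + 1)) (2 ^ (s j + 1)) with hS
    have h2 : ∑ k ∈ fbox d n, bb s k ≤ ∑ k ∈ S, (1 : ℝ) := by
      have h3 : ∑ k ∈ fbox d n, bb s k = ∑ k ∈ (fbox d n).filter (· ∈ S), bb s k := by
        rw [Finset.sum_filter_of_ne]
        intro k _ hne
        rw [hS, Fintype.mem_piFinset]
        intro j
        have h3 : al (s j) (k j) ≠ 0 := fun h => hne (Finset.prod_eq_zero (Finset.mem_univ j) h)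
        have := al_supp h3
        rw [abs_lt] at this
        rw [Finset.mem_Ico]
        exact ⟨this.1.le, this.2⟩
      rw [h3]
      refine (Finset.sum_le_sum fun k _ => bb_le_one s k).trans ?_
      apply Finset.sum_le_sum_of_subset_of_nonneg
      · intro k hk; exact (Finset.mem_filter.1 hk).2
      · intros; norm_num
    refine h2.trans (le_of_eq ?_)
    rw [Finset.sum_const, nsmul_eq_mul, mul_one, hS, Fintype.card_piFinset]
    have h4 : ∀ j, (Finset.Ico (-(2 : ℤ) ^ (s j + 1)) (2 ^ (s j + 1))).card = 4 * 2 ^ (s j) := by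
      intro j
      rw [Int.card_Ico]
      have : (2 : ℤ) ^ (s j + 1) - -(2 : ℤ) ^ (s j + 1) = ((4 * 2 ^ (s j) : ℕ) : ℤ) := by
        push_cast; ring
      rw [this, Int.toNat_natCast]
    simp only [h4]
    rw [Finset.prod_mul_distrib, Finset.prod_pow_eq_pow_sum]
    have h5 := (levl_sub hs).2
    push_cast
    have h6 : (2 : ℝ) ^ n / 2 ^ l = 2 ^ (∑ j, s j) := by
      rw [← h5, pow_add]; field_simp
    rw [h6]; simp
  refine (Finset.sum_le_card_nsmul _ _ _ h1).trans (le_of_eq ?_)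
  rw [nsmul_eq_mul]; ring

lemma BL_op_bound {d : ℕ} (γ : Fin d → ℝ) (n l : ℕ) {h : (Fin d → ℝ) → ℂ} (hm : Measurable h)
    {σ : ℝ} (hσ : ∀ x, ‖h x‖ ≤ σ) (x : Fin d → ℝ) :
    ‖ts (fbox d n) (fun k => (BL γ n l k : ℂ) * fc h k) x‖ ≤ 6 ^ d * (levl γ n l).card * σ := by
  have h1 : ts (fbox d n) (fun k => (BL γ n l k : ℂ) * fc h k) x
      = ∑ s ∈ levl γ n l, ts (fbox d n) (fun k => (bb s k : ℂ) * fc h k) x := by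
    unfold ts BL
    rw [Finset.sum_comm]
    apply Finset.sum_congr rfl
    intro k _
    simp only [Complex.ofReal_sum, Finset.sum_mul]
  rw [h1]
  refine (norm_sum_le _ _).trans ?_
  refine (Finset.sum_le_card_nsmul _ _ _ fun s hs =>
    bb_op_bound s (lev_le (levl_sub hs).1) hm hσ x).trans (le_of_eq ?_)
  rw [nsmul_eq_mul]; ring


/-! ### Covering numbers for large exponents -/

lemma tail_sq {d : ℕ} {q : ℝ} (hq : 2 < q) {f : (Fin d → ℝ) → ℂ} (hf : Measurable f) {B : ℝ}
    (hB : ∀ x, ‖f x‖ ≤ B) (hint : ∫ x, ‖f x‖ ^ q ∂(torusMeasure d) ≤ 1) {σ : ℝ} (hσ : 0 < σ)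
    {g : (Fin d → ℝ) → ℂ} (hg : ∀ x, (‖f x‖ ≤ σ ∧ g x = 0) ∨ (σ < ‖f x‖ ∧ g x = f x)) :
    ∫ x, ‖g x‖ ^ 2 ∂(torusMeasure d) ≤ σ ^ (2 - q) := by
  have hi := integrable_rpow (d := d) (q := q) (by linarith) hf hB
  calc ∫ x, ‖g x‖ ^ 2 ∂(torusMeasure d) ≤ ∫ x, σ ^ (2 - q) * ‖f x‖ ^ q ∂(torusMeasure d) := by
        apply integral_mono_of_nonneg
        · exact Filter.Eventually.of_forall fun x => by positivity
        · exact hi.const_mul _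
        · refine Filter.Eventually.of_forall fun x => ?_
          simp only
          rcases hg x with ⟨_, h0⟩ | ⟨h1, h2⟩
          · rw [h0]; simp; positivity
          · rw [h2]
            have hp : 0 < ‖f x‖ := hσ.trans h1
            have e : ‖f x‖ ^ 2 = ‖f x‖ ^ (2 - q) * ‖f x‖ ^ q := by
              rw [← Real.rpow_add hp]; norm_num
            rw [e]
            apply mul_le_mul_of_nonneg_right _ (by positivity)
            exact Real.rpow_le_rpow_of_nonpos hσ h1.le (by linarith)
    _ = σ ^ (2 - q) * ∫ x, ‖f x‖ ^ q ∂(torusMeasure d) := integral_const_mul _ _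
    _ ≤ σ ^ (2 - q) * 1 := by gcongr
    _ = _ := mul_one _

lemma layer_decomp {d : ℕ} {q : ℝ} (hq : 2 < q) {γ : Fin d → ℝ} (hγ : ∀ j, 1 ≤ γ j) (n : ℕ)
    (Q : Finset (Fin d → ℤ)) (hQ : (Q : Set (Fin d → ℤ)) = hyperbolicCross d γ n)
    (σ a : ℕ → ℝ) (hσ : ∀ l, 0 < σ l) (ha : ∀ l, 0 < a l)
    (f : (Fin d → ℝ) → ℂ) (hf : f ∈ ballq q Q) :
    ∃ x : Fin (n + 1) × {k // k ∈ fbox d n} → ℂ,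
      ∑ i, ‖x i‖ ^ 2 ≤ ∑ l ∈ Finset.range (n + 1), σ l ^ (2 - q) / a l ^ 2 ∧
      ∀ ω, ‖f ω - ∑ i, x i * ((a i.1 * BL γ n i.1 i.2 : ℝ) : ℂ) * ee (i.2 : Fin d → ℤ) ω‖
        ≤ ∑ l ∈ Finset.range (n + 1), 6 ^ d * (levl γ n l).card * σ l := by
  classical
  obtain ⟨⟨c, hc⟩, hint⟩ := hf
  have hfc : Continuous f := by rw [hc]; exact ts_continuous _ _
  have hfm : Measurable f := hfc.measurable
  set Bd := ∑ k ∈ Q, ‖c k‖ with hBd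
  have hfB : ∀ x, ‖f x‖ ≤ Bd := by intro x; rw [hc]; exact ts_bound _ _ _
  let h : ℕ → (Fin d → ℝ) → ℂ := fun l => {x | ‖f x‖ ≤ σ l}.indicator f
  let g : ℕ → (Fin d → ℝ) → ℂ := fun l => {x | ‖f x‖ ≤ σ l}ᶜ.indicator f
  have hms : ∀ l, MeasurableSet {x | ‖f x‖ ≤ σ l} := fun l => measurableSet_le hfm.norm measurable_const
  have hhm : ∀ l, Measurable (h l) := fun l => hfm.indicator (hms l)
  have hgm : ∀ l, Measurable (g l) := fun l => hfm.indicator (hms l).compl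
  have hhσ : ∀ l x, ‖h l x‖ ≤ σ l := by
    intro l x
    simp only [h, Set.indicator_apply, Set.mem_ofPred_eq]
    split_ifs with h1
    · exact h1
    · simp [(hσ l).le]
  have hgB : ∀ l x, ‖g l x‖ ≤ Bd := by
    intro l x
    exact (norm_indicator_le_norm_self _ _).trans (hfB x)
  have hg2 : ∀ l, ∫ x, ‖g l x‖ ^ 2 ∂(torusMeasure d) ≤ σ l ^ (2 - q) := by
    intro l
    apply tail_sq hq hfm hfB hint (hσ l)
    intro x
    by_cases h1 : ‖f x‖ ≤ σ l
    · left; exact ⟨h1, by simp [g, h1]⟩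
    · right
      push Not at h1
      exact ⟨h1, by simp [g, h1]⟩
  have hadd : ∀ l k, fc f k = fc (h l) k + fc (g l) k := by
    intro l k
    unfold fc
    rw [← integral_add (integrable_mul_ee (hhm l) (hhσ l) _) (integrable_mul_ee (hgm l) (hgB l) _)]
    congr 1
    funext y
    rw [← add_mul]
    congr 1
    exact (congrFun (Set.indicator_self_add_compl {x | ‖f x‖ ≤ σ l} f) y).symm
  have hfcf : ∀ k, fc f k = if k ∈ Q then c k else 0 := by intro k; rw [hc]; exact fc_ts _ _ _
  have hsub : Q ⊆ fbox d n := by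
    intro k hk
    rw [mem_fbox]
    intro j
    have : k ∈ hyperbolicCross d γ n := by rw [← hQ]; exact hk
    exact (hc_abs_lt hγ this j).trans (pow_le_pow_right₀ (by norm_num) (by omega))
  have hf1 : ∀ ω, f ω = ∑ k ∈ fbox d n, fc f k * ee k ω := by
    intro ω
    have e1 : f ω = ∑ k ∈ Q, c k * ee k ω := by rw [hc]; rfl
    rw [e1, ← Finset.sum_subset hsub (f := fun k => fc f k * ee k ω)]
    · apply Finset.sum_congr rfl
      intro k hk
      rw [hfcf, if_pos hk]
    · intro k _ hk
      rw [hfcf, if_neg hk, zero_mul]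
  have hf2 : ∀ ω, f ω = ∑ l ∈ Finset.range (n + 1),
      (ts (fbox d n) (fun k => (BL γ n l k : ℂ) * fc (h l) k) ω
        + ts (fbox d n) (fun k => (BL γ n l k : ℂ) * fc (g l) k) ω) := by
    intro ω
    rw [hf1 ω]
    unfold ts
    simp only [← Finset.sum_add_distrib]
    rw [Finset.sum_comm]
    apply Finset.sum_congr rfl
    intro k _
    have e1 : ∀ l, (BL γ n l k : ℂ) * fc (h l) k * ee k ω + (BL γ n l k : ℂ) * fc (g l) k * ee k ω
        = (BL γ n l k : ℂ) * (fc f k * ee k ω) := by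
      intro l; rw [hadd l k]; ring
    simp only [e1]
    rw [← Finset.sum_mul]
    by_cases hk : k ∈ Q
    · have h1 : k ∈ hyperbolicCross d γ n := by rw [← hQ]; exact hk
      have h2 := BL_sum_one hγ n h1
      have h3 : ∑ l ∈ Finset.range (n + 1), (BL γ n l k : ℂ) = 1 := by
        exact_mod_cast h2
      rw [h3, one_mul]
    · rw [hfcf, if_neg hk]; simp
  refine ⟨fun i => fc (g i.1) i.2 / a i.1, ?_, ?_⟩
  · rw [Fintype.sum_prod_type]
    rw [Fin.sum_univ_eq_sum_range (fun l => ∑ k : {k // k ∈ fbox d n}, ‖fc (g l) k / (a l : ℂ)‖ ^ 2)]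
    apply Finset.sum_le_sum
    intro l _
    rw [Finset.sum_coe_sort (fbox d n) (fun k => ‖fc (g l) k / (a l : ℂ)‖ ^ 2)]
    simp only [norm_div, div_pow, Complex.norm_real]
    rw [← Finset.sum_div, Real.norm_of_nonneg (ha l).le]
    have := (bessel (hgm l) (hgB l) (fbox d n)).trans (hg2 l)
    gcongr
  · intro ω
    have e1 : ∑ i : Fin (n + 1) × {k // k ∈ fbox d n}, fc (g i.1) i.2 / a i.1 *
        ((a i.1 * BL γ n i.1 i.2 : ℝ) : ℂ) * ee (i.2 : Fin d → ℤ) ω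
        = ∑ l ∈ Finset.range (n + 1), ts (fbox d n) (fun k => (BL γ n l k : ℂ) * fc (g l) k) ω := by
      rw [Fintype.sum_prod_type]
      rw [Fin.sum_univ_eq_sum_range (fun l => ∑ k : {k // k ∈ fbox d n}, fc (g l) k / a l *
        ((a l * BL γ n l k : ℝ) : ℂ) * ee (k : Fin d → ℤ) ω)]
      apply Finset.sum_congr rfl
      intro l _
      rw [Finset.sum_coe_sort (fbox d n) (fun k => fc (g l) k / a l *
        ((a l * BL γ n l k : ℝ) : ℂ) * ee (k : Fin d → ℤ) ω)]
      unfold ts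
      apply Finset.sum_congr rfl
      intro k _
      have : (a l : ℂ) ≠ 0 := by exact_mod_cast (ha l).ne'
      push_cast
      field_simp
    rw [e1, hf2 ω, Finset.sum_add_distrib, add_sub_cancel_right]
    refine (norm_sum_le _ _).trans (Finset.sum_le_sum fun l _ => ?_)
    exact BL_op_bound γ n l (hhm l) (hhσ l) ω

lemma geom_exp_le {κ : ℝ} (hκ : 0 < κ) (N : ℕ) :
    ∑ l ∈ Finset.range N, Real.exp (-(κ * l)) ≤ 1 / (1 - Real.exp (-κ)) := by
  have h1 : Real.exp (-κ) < 1 := by rw [Real.exp_lt_one_iff]; linarith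
  have h2 : ∀ l : ℕ, Real.exp (-(κ * l)) = Real.exp (-κ) ^ l := by
    intro l; rw [← Real.exp_nat_mul]; congr 1; ring
  simp only [h2]
  have h3 := (summable_geometric_of_lt_one (Real.exp_pos _).le h1).sum_le_tsum (Finset.range N)
    (fun _ _ => by positivity)
  rw [tsum_geometric_of_lt_one (Real.exp_pos _).le h1] at h3
  rwa [one_div]

lemma layer_params {d ν : ℕ} {γ : Fin d → ℝ} {q : ℝ} (hq : 2 < q) (hν : 1 ≤ ν) (hνd : ν ≤ d)
    (hγ1 : ∀ j : Fin d, (j : ℕ) < ν → γ j = 1) (hγ2 : ∀ j : Fin d, ν ≤ (j : ℕ) → 1 < γ j)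
    (Q : ℕ → Finset (Fin d → ℤ))
    (hQ : ∀ n, (Q n : Set (Fin d → ℤ)) = hyperbolicCross d γ n) :
    ∃ CV : ℝ, 0 < CV ∧ ∀ n : ℕ, 1 ≤ n → ∀ t : ℝ, 0 < t → ∃ σ a : ℕ → ℝ,
      (∀ l, 0 < σ l) ∧ (∀ l, 0 < a l) ∧
      ∑ l ∈ Finset.range (n + 1), 6 ^ d * (levl γ n l).card * σ l ≤ t / 4 ∧
      ∑ l ∈ Finset.range (n + 1), σ l ^ (2 - q) / a l ^ 2 ≤ 1 ∧
      ∑ l ∈ Finset.range (n + 1), ∑ k ∈ fbox d n, (a l * BL γ n l k) ^ 2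
        ≤ CV * t ^ (2 - q) * ((Q n).card * (n : ℝ) ^ (((ν : ℝ) - 1) * (q - 2))) := by
  set κ : ℝ := 1 / (8 * (q - 1)) with hκd
  have hκ : 0 < κ := by rw [hκd]; apply one_div_pos.2; linarith
  have hκq : 2 * κ * (q - 1) = 1 / 4 := by
    rw [hκd]; have : q - 1 ≠ 0 := by linarith
    field_simp; norm_num
  obtain ⟨C, hC, hCl⟩ := levl_card hν hνd hγ1 hγ2 κ hκ
  obtain ⟨Ch, hCh, hChl⟩ := hc_card_lower hν hνd hγ1 Q hQ
  set Z : ℝ := 1 / (1 - Real.exp (-κ)) with hZ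
  have hZ0 : 0 < Z := by
    rw [hZ]; apply one_div_pos.2
    have h1 : Real.exp (-κ) < 1 := by rw [Real.exp_lt_one_iff]; linarith
    linarith
  set Z2 : ℝ := 1 / (1 - Real.exp (-(1 / 4 : ℝ))) with hZ2
  have hZ20 : 0 < Z2 := by
    rw [hZ2]; apply one_div_pos.2
    have h1 : Real.exp (-(1 / 4 : ℝ)) < 1 := by rw [Real.exp_lt_one_iff]; norm_num
    linarith
  set E : ℝ := 4 * 6 ^ d * C * Z with hE
  have hE0 : 0 < E := by positivity
  refine ⟨Z * E ^ (q - 2) * 4 ^ d * C * Z2 * Ch, by positivity, ?_⟩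
  intro n hn t ht
  have hn0 : (0 : ℝ) < n := by exact_mod_cast hn
  set p : ℝ := (n : ℝ) ^ (ν - 1) with hp
  have hp0 : 0 < p := by positivity
  set σ : ℕ → ℝ := fun l => t / (E * p) * Real.exp (-(2 * κ * l)) with hσd
  have hσ : ∀ l, 0 < σ l := fun l => by positivity
  set a : ℕ → ℝ := fun l => Real.sqrt (Z * σ l ^ (2 - q) * Real.exp (κ * l)) with had
  have ha : ∀ l, 0 < a l := fun l => Real.sqrt_pos.2 (by have := hσ l; positivity)
  have ha2 : ∀ l, a l ^ 2 = Z * σ l ^ (2 - q) * Real.exp (κ * l) := fun l =>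
    Real.sq_sqrt (by have := hσ l; positivity)
  refine ⟨σ, a, hσ, ha, ?_, ?_, ?_⟩
  · calc ∑ l ∈ Finset.range (n + 1), 6 ^ d * (levl γ n l).card * σ l
        ≤ ∑ l ∈ Finset.range (n + 1), t / (4 * Z) * Real.exp (-(κ * l)) := by
          apply Finset.sum_le_sum
          intro l _
          have h1 := hCl n l hn
          have h2 := hσ l
          calc 6 ^ d * ((levl γ n l).card : ℝ) * σ l
              ≤ 6 ^ d * (C * p * Real.exp (κ * l)) * σ l := by gcongr
            _ = (6 ^ d * C * p * (t / (E * p))) * (Real.exp (κ * l) * Real.exp (-(2 * κ * l))) := by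
                rw [hσd]; ring
            _ = t / (4 * Z) * Real.exp (-(κ * l)) := by
                rw [← Real.exp_add]
                congr 1
                · rw [hE]; field_simp
                · congr 1; ring
      _ = t / (4 * Z) * ∑ l ∈ Finset.range (n + 1), Real.exp (-(κ * l)) := by rw [Finset.mul_sum]
      _ ≤ t / (4 * Z) * Z := by
          have := geom_exp_le hκ (n + 1)
          gcongr
      _ = t / 4 := by field_simp
  · calc ∑ l ∈ Finset.range (n + 1), σ l ^ (2 - q) / a l ^ 2
        = ∑ l ∈ Finset.range (n + 1), 1 / Z * Real.exp (-(κ * l)) := by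
          apply Finset.sum_congr rfl
          intro l _
          have h2 : 0 < σ l ^ (2 - q) := Real.rpow_pos_of_pos (hσ l) _
          rw [ha2, Real.exp_neg]
          field_simp
      _ = 1 / Z * ∑ l ∈ Finset.range (n + 1), Real.exp (-(κ * l)) := by rw [Finset.mul_sum]
      _ ≤ 1 / Z * Z := by
          have := geom_exp_le hκ (n + 1)
          gcongr
      _ = 1 := by field_simp
  · have hpq : p ^ (q - 2) = (n : ℝ) ^ (((ν : ℝ) - 1) * (q - 2)) := by
      rw [hp, ← Real.rpow_natCast, ← Real.rpow_mul hn0.le, Nat.cast_sub hν, Nat.cast_one]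
    have hσq : ∀ l : ℕ, σ l ^ (2 - q) = t ^ (2 - q) * E ^ (q - 2) * p ^ (q - 2)
        * Real.exp (2 * κ * (q - 2) * l) := by
      intro l
      simp only [hσd]
      rw [Real.mul_rpow (by positivity) (by positivity), Real.div_rpow ht.le (by positivity),
        Real.mul_rpow hE0.le hp0.le, ← Real.exp_mul]
      have e1 : E ^ (2 - q) = (E ^ (q - 2))⁻¹ := by rw [← Real.rpow_neg hE0.le]; congr 1; ring
      have e2 : p ^ (2 - q) = (p ^ (q - 2))⁻¹ := by rw [← Real.rpow_neg hp0.le]; congr 1; ring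
      have e3 : -(2 * κ * (l : ℝ)) * (2 - q) = 2 * κ * (q - 2) * l := by ring
      rw [e1, e2, e3]
      have : 0 < E ^ (q - 2) := by positivity
      have : 0 < p ^ (q - 2) := by positivity
      field_simp
    set W : ℝ := Z * E ^ (q - 2) * 4 ^ d * C * t ^ (2 - q) * (2 ^ n * p) * p ^ (q - 2) with hW
    have hW0 : 0 < W := by positivity
    calc ∑ l ∈ Finset.range (n + 1), ∑ k ∈ fbox d n, (a l * BL γ n l k) ^ 2
        ≤ ∑ l ∈ Finset.range (n + 1), W * Real.exp (-((1 / 4 : ℝ) * l)) := by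
          apply Finset.sum_le_sum
          intro l _
          have h1 := hCl n l hn
          have h2 : ∑ k ∈ fbox d n, (a l * BL γ n l k) ^ 2 ≤ a l ^ 2 * ∑ k ∈ fbox d n, BL γ n l k := by
            rw [Finset.mul_sum]
            apply Finset.sum_le_sum
            intro k _
            rw [mul_pow]
            have h3 := BL_nonneg γ n l k
            have h4 := BL_le_one γ n l k
            have : BL γ n l k ^ 2 ≤ BL γ n l k := by nlinarith
            gcongr
          have h2l : (1 : ℝ) / 2 ^ l ≤ Real.exp (-((1 / 2 : ℝ) * l)) := by
            rw [Real.exp_neg, one_div]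
            apply inv_anti₀ (Real.exp_pos _)
            rw [mul_comm, Real.exp_nat_mul]
            apply pow_le_pow_left₀ (Real.exp_pos _).le
            have h5 : (1 / 2 : ℝ) ≤ Real.log 2 := by linarith [Real.log_two_gt_d9]
            calc Real.exp (1 / 2) ≤ Real.exp (Real.log 2) := Real.exp_le_exp.2 h5
              _ = 2 := Real.exp_log (by norm_num)
          calc _ ≤ a l ^ 2 * ∑ k ∈ fbox d n, BL γ n l k := h2
            _ ≤ a l ^ 2 * (4 ^ d * (2 ^ n / 2 ^ l) * (C * p * Real.exp (κ * l))) := by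
                gcongr
                refine (BL_sum_le γ n l).trans ?_
                gcongr
            _ = W * (1 / 2 ^ l) * (Real.exp (2 * κ * (q - 2) * l) * Real.exp (κ * l) * Real.exp (κ * l)) := by
                rw [ha2, hσq, hW]; ring
            _ ≤ W * Real.exp (-((1 / 2 : ℝ) * l)) *
                (Real.exp (2 * κ * (q - 2) * l) * Real.exp (κ * l) * Real.exp (κ * l)) := by gcongr
            _ = W * Real.exp (-((1 / 4 : ℝ) * l)) := by
                rw [mul_assoc, ← Real.exp_add, ← Real.exp_add, ← Real.exp_add]
                congr 2
                have : 2 * κ * (q - 2) * l + κ * l + κ * l = (2 * κ * (q - 1)) * l := by ring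
                rw [this, hκq]; ring
      _ = W * ∑ l ∈ Finset.range (n + 1), Real.exp (-((1 / 4 : ℝ) * l)) := by rw [Finset.mul_sum]
      _ ≤ W * Z2 := by
          have := geom_exp_le (κ := 1 / 4) (by norm_num) (n + 1)
          gcongr
      _ = Z * E ^ (q - 2) * 4 ^ d * C * Z2 * t ^ (2 - q) * p ^ (q - 2) * (2 ^ n * p) := by
          rw [hW]; ring
      _ ≤ Z * E ^ (q - 2) * 4 ^ d * C * Z2 * t ^ (2 - q) * p ^ (q - 2) * (Ch * (Q n).card) := by
          have := hChl n hn
          gcongr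
      _ = _ := by rw [hpq]; ring

lemma rpow_nat_le_exp {n : ℕ} {p : ℝ} (hp : 0 ≤ p) : (n : ℝ) ^ p ≤ Real.exp (p * n) := by
  have h1 : (n : ℝ) ≤ Real.exp n := by linarith [Real.add_one_le_exp (n : ℝ)]
  refine (Real.rpow_le_rpow (Nat.cast_nonneg _) h1 hp).trans (le_of_eq ?_)
  rw [← Real.exp_mul, mul_comm]

lemma const_le_exp {n : ℕ} (hn : 1 ≤ n) {c : ℝ} (hc : 0 ≤ c) : c ≤ Real.exp (c * n) := by
  have h1 : (1 : ℝ) ≤ n := by exact_mod_cast hn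
  have h2 := Real.add_one_le_exp (c * n)
  nlinarith

lemma cover_large {d ν : ℕ} {γ : Fin d → ℝ} {q : ℝ} (hq : 2 < q) (hν : 1 ≤ ν) (hνd : ν ≤ d)
    (hγ1 : ∀ j : Fin d, (j : ℕ) < ν → γ j = 1) (hγ2 : ∀ j : Fin d, ν ≤ (j : ℕ) → 1 < γ j)
    (Q : ℕ → Finset (Fin d → ℤ))
    (hQ : ∀ n, (Q n : Set (Fin d → ℤ)) = hyperbolicCross d γ n) :
    ∃ A K : ℝ, 0 ≤ A ∧ 1 ≤ K ∧ ∀ n : ℕ, 1 ≤ n → ∀ G : ℝ,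
    G = (Q n).card * (n : ℝ) ^ (((ν : ℝ) - 1) * (q - 2)) →
    ∀ T : ℝ, 0 < T → T ^ q = K * G → (∀ f ∈ ballq q (Q n), ∀ x, ‖f x‖ ≤ T) ∧
    ∀ i : ℕ, 1 / 32 ≤ T / 2 ^ i → ∃ N : Finset ((Fin d → ℝ) → ℂ), (∀ g ∈ N, Continuous g) ∧
        (N.card : ℝ) ≤ Real.exp (A * n * (G / (T / 2 ^ i) ^ q)) ∧
        ∀ f ∈ ballq q (Q n), ∃ g ∈ N, ∀ x, ‖f x - g x‖ ≤ (T / 2 ^ i) / 2 := by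
  have hγ : ∀ j, 1 ≤ γ j := by
    intro j
    rcases lt_or_ge (j : ℕ) ν with h | h
    · exact (hγ1 j h).ge
    · exact (hγ2 j h).le
  obtain ⟨CV, hCV, hpar⟩ := layer_params hq hν hνd hγ1 hγ2 Q hQ
  have hν0 : (0 : ℝ) ≤ (ν : ℝ) - 1 := by
    have : (1 : ℝ) ≤ ν := by exact_mod_cast hν
    linarith
  have hex : 0 ≤ ((ν : ℝ) - 1) * (q - 2) := mul_nonneg hν0 (by linarith)
  set D : ℝ := 3 * d + ((ν : ℝ) - 1) * (q - 2) + 16 * CV * 32 ^ q with hD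
  have hD0 : 0 ≤ D := by positivity
  obtain ⟨C, hC1, hC⟩ := trig_cover d D hD0
  set K : ℝ := max 1 (16 * CV) with hK
  have hK1 : 1 ≤ K := le_max_left _ _
  have hK2 : 16 * CV ≤ K := le_max_right _ _
  refine ⟨C * (K + 16 * CV), K, by positivity, hK1, ?_⟩
  intro n hn G hG T hT hTq
  have hn0 : (0 : ℝ) < n := by exact_mod_cast hn
  have hcard : 1 ≤ (Q n).card := by
    apply Finset.card_pos.2
    refine ⟨0, ?_⟩
    rw [← Finset.mem_coe, hQ n]
    exact hc_zero_mem n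
  have hcard' : (0 : ℝ) < (Q n).card := by exact_mod_cast hcard
  have hG0 : 0 < G := by rw [hG]; positivity
  have hdec : ∀ t : ℝ, 0 < t → ∃ w : Fin (n + 1) × {k // k ∈ fbox d n} → ℝ,
      ∑ i, w i ^ 2 ≤ CV * t ^ (2 - q) * G ∧ ∀ f ∈ ballq q (Q n),
      ∃ x : Fin (n + 1) × {k // k ∈ fbox d n} → ℂ, ∑ i, ‖x i‖ ^ 2 ≤ 1 ∧
      ∀ ω, ‖f ω - ∑ i, x i * (w i : ℂ) * ee (i.2 : Fin d → ℤ) ω‖ ≤ t / 4 := by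
    intro t ht
    obtain ⟨σ, a, hσ, ha, h1, h2, h3⟩ := hpar n hn t ht
    refine ⟨fun i => a i.1 * BL γ n i.1 i.2, ?_, ?_⟩
    · rw [hG]
      refine le_trans (le_of_eq ?_) h3
      rw [Fintype.sum_prod_type]
      rw [Fin.sum_univ_eq_sum_range (fun l => ∑ k : {k // k ∈ fbox d n}, (a l * BL γ n l k) ^ 2)]
      apply Finset.sum_congr rfl
      intro l _
      rw [Finset.sum_coe_sort (fbox d n) (fun k => (a l * BL γ n l k) ^ 2)]
    · intro f hf
      obtain ⟨x, hx1, hx2⟩ := layer_decomp hq hγ n (Q n) (hQ n) σ a hσ ha f hf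
      exact ⟨x, hx1.trans h2, fun ω => (hx2 ω).trans h1⟩
  have hVeq : ∀ t : ℝ, 0 < t → CV * t ^ (2 - q) * G = CV * t ^ 2 * (G / t ^ q) := by
    intro t ht
    rw [Real.rpow_sub ht, Real.rpow_two]; ring
  have hKG : ∀ t : ℝ, 0 < t → t ≤ T → 1 ≤ K * (G / t ^ q) := by
    intro t ht htT
    have h1 : t ^ q ≤ K * G := by
      rw [← hTq]; exact Real.rpow_le_rpow ht.le htT (by linarith)
    have h2 : 0 < t ^ q := by positivity
    rw [← mul_div_assoc, le_div_iff₀ h2]; linarith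
  constructor
  · intro f hf ω
    obtain ⟨w, hw, hfd⟩ := hdec T hT
    obtain ⟨x, hx, hxω⟩ := hfd f hf
    have h1 := hxω ω
    rw [hVeq T hT] at hw
    have h2 : CV * T ^ 2 * (G / T ^ q) ≤ (T / 4) ^ 2 := by
      rw [hTq]
      have hKp : 0 < K := by linarith
      have : G / (K * G) = 1 / K := by field_simp
      rw [this, mul_one_div, div_le_iff₀ hKp]
      nlinarith [sq_nonneg T]
    have h3 : ‖∑ i, x i * (w i : ℂ) * ee (i.2 : Fin d → ℤ) ω‖ ≤ T / 4 := by
      have h4 : ‖∑ i, x i * (w i : ℂ) * ee (i.2 : Fin d → ℤ) ω‖ ≤ ∑ i, ‖x i‖ * |w i| := by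
        refine (norm_sum_le _ _).trans (Finset.sum_le_sum fun i _ => ?_)
        rw [norm_mul, norm_mul, ee_norm, mul_one, Complex.norm_real, Real.norm_eq_abs]
      refine h4.trans ?_
      have h5 := Finset.sum_mul_sq_le_sq_mul_sq Finset.univ (fun i => ‖x i‖) (fun i => |w i|)
      simp only [sq_abs] at h5
      have h6 : (∑ i, ‖x i‖ * |w i|) ^ 2 ≤ (T / 4) ^ 2 := by
        have h7 : 0 ≤ ∑ i, w i ^ 2 := Finset.sum_nonneg fun i _ => sq_nonneg _
        calc _ ≤ _ := h5
          _ ≤ 1 * ∑ i, w i ^ 2 := by gcongr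
          _ ≤ _ := by linarith
      exact (abs_le_of_sq_le_sq' h6 (by positivity)).2
    calc ‖f ω‖ = ‖(f ω - ∑ i, x i * (w i : ℂ) * ee (i.2 : Fin d → ℤ) ω)
          + ∑ i, x i * (w i : ℂ) * ee (i.2 : Fin d → ℤ) ω‖ := by rw [sub_add_cancel]
      _ ≤ T / 4 + T / 4 := (norm_add_le _ _).trans (add_le_add h1 h3)
      _ ≤ T := by linarith
  · intro i hi
    set t : ℝ := T / 2 ^ i with ht
    have ht0 : 0 < t := by positivity
    have htT : t ≤ T := div_le_self hT.le (one_le_pow₀ (by norm_num))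
    obtain ⟨w, hw, hfd⟩ := hdec t ht0
    rw [hVeq t ht0] at hw
    set R : ℝ := G / t ^ q with hR
    have hR0 : 0 < R := by positivity
    have hRexp : 16 * CV * R ≤ Real.exp (D * n) := by
      have h1 : (1 / 32 : ℝ) ^ q ≤ t ^ q := Real.rpow_le_rpow (by norm_num) hi (by linarith)
      have h2 : R ≤ 32 ^ q * G := by
        rw [hR, div_le_iff₀ (by positivity)]
        rw [one_div, Real.inv_rpow (by norm_num)] at h1
        have h3 : (0 : ℝ) < 32 ^ q := by positivity
        have h4 : 1 ≤ 32 ^ q * t ^ q := by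
          rw [inv_le_iff_one_le_mul₀ h3] at h1; linarith
        nlinarith
      have h5 : G ≤ Real.exp (3 * d * n) * Real.exp (((ν : ℝ) - 1) * (q - 2) * n) := by
        rw [hG]
        apply mul_le_mul _ (rpow_nat_le_exp hex) (by positivity) (by positivity)
        apply card_box hn
        intro k hk
        rw [← Finset.mem_coe, hQ n] at hk
        exact hc_abs_lt hγ hk
      have h6 : 16 * CV * 32 ^ q ≤ Real.exp (16 * CV * 32 ^ q * n) := const_le_exp hn (by positivity)
      calc 16 * CV * R ≤ 16 * CV * (32 ^ q * G) := by gcongr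
        _ = 16 * CV * 32 ^ q * G := by ring
        _ ≤ Real.exp (16 * CV * 32 ^ q * n) *
            (Real.exp (3 * d * n) * Real.exp (((ν : ℝ) - 1) * (q - 2) * n)) := by gcongr
        _ = Real.exp (D * n) := by
            rw [← Real.exp_add, ← Real.exp_add, hD]; congr 1; ring
    obtain ⟨N, hN1, hN2, hN3⟩ := hC n hn (Fin (n + 1) × {k // k ∈ fbox d n}) (fun i => i.2) w
      (CV * t ^ 2 * R) (t / 4) (by positivity) (by positivity) hw
      (by
        intro i j
        have h1 := mem_fbox.1 i.2.2 j
        have h2 : ((|(i.2 : Fin d → ℤ) j| : ℤ) : ℝ) ≤ ((2 ^ (n + 1) : ℤ) : ℝ) := by exact_mod_cast h1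
        push_cast at h2
        exact h2)
      (by
        have h1 : 0 ≤ (t / 4) ^ 2 := by positivity
        calc CV * t ^ 2 * R = (t / 4) ^ 2 * (16 * CV * R) := by ring
          _ ≤ _ := by gcongr)
    refine ⟨N, hN1, hN2.trans ?_, ?_⟩
    · apply Real.exp_le_exp.2
      have e1 : CV * t ^ 2 * R / (t / 4) ^ 2 = 16 * CV * R := by field_simp; norm_num
      rw [e1]
      have h1 := hKG t ht0 htT
      calc C * n * (1 + 16 * CV * R) ≤ C * n * (K * R + 16 * CV * R) := by gcongr
        _ = _ := by ring
    · intro f hf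
      obtain ⟨x, hx, hxω⟩ := hfd f hf
      obtain ⟨g, hg, hgω⟩ := hN3 x hx
      refine ⟨g, hg, fun ω => ?_⟩
      have := norm_sub_le_norm_sub_add_norm_sub (f ω)
        (∑ i, x i * (w i : ℂ) * ee (i.2 : Fin d → ℤ) ω) (g ω)
      have h1 := hxω ω
      have h2 := hgω ω
      linarith


lemma smul_ts_mem {d : ℕ} {q : ℝ} (hq : 1 ≤ q) (Q : Finset (Fin d → ℤ)) (c : (Fin d → ℤ) → ℂ) {lam : ℝ}
    (hl : 0 ≤ lam) :
    (∃ c', (fun x => (lam : ℂ) * ts Q c x) = ts Q c') ∧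
    (∀ x, ‖(lam : ℂ) * ts Q c x‖ ^ q = lam ^ q * ‖ts Q c x‖ ^ q) := by
  constructor
  · refine ⟨fun k => lam * c k, ?_⟩
    funext x
    unfold ts
    rw [Finset.mul_sum]
    exact Finset.sum_congr rfl fun k _ => by ring
  · intro x
    rw [norm_mul, Complex.norm_real, Real.norm_of_nonneg hl, Real.mul_rpow hl (norm_nonneg _)]

lemma trigPoly_ts {d : ℕ} {Q : Finset (Fin d → ℤ)} {S : Set (Fin d → ℤ)} (hQ : (Q : Set (Fin d → ℤ)) = S)
    {f : (Fin d → ℝ) → ℂ} (hf : IsTrigPoly d S f) : ∃ c, f = ts Q c := by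
  classical
  obtain ⟨F, hF, c, hc⟩ := hf
  refine ⟨fun k => if k ∈ F then c k else 0, ?_⟩
  funext x
  rw [hc]
  unfold ts
  have hsub : F ⊆ Q := by
    intro k hk
    rw [← Finset.mem_coe, hQ]; exact hF hk
  rw [← Finset.sum_subset hsub]
  · refine Finset.sum_congr rfl fun k hk => ?_
    simp only [if_pos hk]; rfl
  · intro k _ hk
    simp only [if_neg hk, zero_mul]

lemma cover_all {d ν : ℕ} {γ : Fin d → ℝ} {q : ℝ} (hq : 1 ≤ q) (hν : 1 ≤ ν) (hνd : ν ≤ d)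
    (hγ1 : ∀ j : Fin d, (j : ℕ) < ν → γ j = 1) (hγ2 : ∀ j : Fin d, ν ≤ (j : ℕ) → 1 < γ j)
    (hγ : ∀ j, 1 ≤ γ j) (Q : ℕ → Finset (Fin d → ℤ))
    (hQ : ∀ n, (Q n : Set (Fin d → ℤ)) = hyperbolicCross d γ n) :
    ∃ A K p : ℝ, 0 ≤ A ∧ 1 ≤ K ∧ 0 ≤ p ∧
    p + 2 ≤ (if q = 1 then (3 : ℝ) else if q ≤ 2 then 2 else ((ν : ℝ) - 1) * (q - 2) + min q 3) ∧
    ∀ n : ℕ, 1 ≤ n → ∀ G : ℝ, G = (Q n).card * (n : ℝ) ^ p →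
    ∀ T : ℝ, 0 < T → T ^ q = K * G → (∀ f ∈ ballq q (Q n), ∀ x, ‖f x‖ ≤ T) ∧
    ∀ i : ℕ, 1 / 32 ≤ T / 2 ^ i → ∃ N : Finset ((Fin d → ℝ) → ℂ), (∀ g ∈ N, Continuous g) ∧
        (N.card : ℝ) ≤ Real.exp (A * n * (G / (T / 2 ^ i) ^ q)) ∧
        ∀ f ∈ ballq q (Q n), ∃ g ∈ N, ∀ x, ‖f x - g x‖ ≤ (T / 2 ^ i) / 2 := by
  by_cases hq2 : q ≤ 2
  · obtain ⟨A, hA, h⟩ := cover_small d q hq hq2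
    refine ⟨A, 1, 0, hA, le_rfl, le_rfl, ?_, ?_⟩
    · rw [if_pos hq2]; split_ifs <;> norm_num
    · intro n hn G hG T hT hTq
      rw [Real.rpow_zero, mul_one] at hG
      rw [one_mul] at hTq
      subst hG
      refine h n hn (Q n) ⟨0, ?_⟩ ?_ T hT hTq
      · rw [← Finset.mem_coe, hQ n]
        exact hc_zero_mem n
      · intro k hk
        rw [← Finset.mem_coe, hQ n] at hk
        exact hc_abs_lt hγ hk
  · push Not at hq2
    obtain ⟨A, K, hA, hK, h⟩ := cover_large hq2 hν hνd hγ1 hγ2 Q hQ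
    have hν0 : (0 : ℝ) ≤ (ν : ℝ) - 1 := by
      have : (1 : ℝ) ≤ ν := by exact_mod_cast hν
      linarith
    refine ⟨A, K, ((ν : ℝ) - 1) * (q - 2), hA, hK, mul_nonneg hν0 (by linarith), ?_, h⟩
    rw [if_neg (by linarith), if_neg (by linarith)]
    have : 2 ≤ min q 3 := le_min hq2.le (by norm_num)
    linarith

/-- **Theorem 1.2 of the paper.** Sampling discretization of the `L_q` norm of
hyperbolic cross polynomials with `m ≥ C1·|Q_n^γ|·n^{w(ν,q)}` points. -/
theorem stmt_1 (d ν : ℕ) (γ : Fin d → ℝ) (q : ℝ) (hq : 1 ≤ q)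
    (hν : 1 ≤ ν) (hνd : ν ≤ d)
    (hγ1 : ∀ j : Fin d, (j : ℕ) < ν → γ j = 1)
    (hγ2 : ∀ j : Fin d, ν ≤ (j : ℕ) → 1 < γ j)
    (hγmono : Monotone γ) :
    ∃ C1 C2 C3 : ℝ, 0 < C1 ∧ 0 < C2 ∧ 0 < C3 ∧
      ∀ n m : ℕ, 1 ≤ n →
        (m : ℝ) ≥ C1 * ((hyperbolicCross d γ n).ncard : ℝ) *
          (n : ℝ) ^ (if q = 1 then (3 : ℝ) else if q ≤ 2 then 2
            else ((ν : ℝ) - 1) * (q - 2) + min q 3) →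
        ∃ ξ : Fin m → (Fin d → ℝ), (∀ j, ξ j ∈ torusCell d) ∧
          ∀ f : (Fin d → ℝ) → ℂ, IsTrigPoly d (hyperbolicCross d γ n) f →
            C2 * torusLq d q f ^ q ≤ (1 / m : ℝ) * ∑ j, ‖f (ξ j)‖ ^ q ∧
            (1 / m : ℝ) * ∑ j, ‖f (ξ j)‖ ^ q ≤ C3 * torusLq d q f ^ q := by
  have hγ : ∀ j, 1 ≤ γ j := by
    intro j
    rcases lt_or_ge (j : ℕ) ν with h | h
    · exact (hγ1 j h).ge
    · exact (hγ2 j h).le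
  have hq0 : 0 < q := by linarith
  let Q : ℕ → Finset (Fin d → ℤ) := fun n => (hc_finite hγ n).toFinset
  have hQ : ∀ n, (Q n : Set (Fin d → ℤ)) = hyperbolicCross d γ n := fun n =>
    Set.Finite.coe_toFinset _
  obtain ⟨A, K, p, hA, hK, hp, hpw, hcov⟩ := cover_all hq hν hνd hγ1 hγ2 hγ Q hQ
  set W : ℝ := (if q = 1 then (3 : ℝ) else if q ≤ 2 then 2
            else ((ν : ℝ) - 1) * (q - 2) + min q 3) with hW
  obtain ⟨C1, C3, hC1, hC3, hdisc⟩ := disc_of_cover d q A K (3 * d + p + K) hq hA hK (by positivity)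
  refine ⟨C1, 1 / (8 * 8 ^ q), C3, hC1, by positivity, hC3, ?_⟩
  intro n m hn hm
  have hn1 : (1 : ℝ) ≤ n := by exact_mod_cast hn
  have hn0 : (0 : ℝ) < n := by linarith
  have hnc : ((hyperbolicCross d γ n).ncard : ℝ) = (Q n).card := by
    rw [Set.ncard_eq_toFinset_card _ (hc_finite hγ n)]
  rw [hnc] at hm
  have hcard : 1 ≤ (Q n).card := by
    apply Finset.card_pos.2
    refine ⟨0, ?_⟩
    rw [← Finset.mem_coe, hQ n]
    exact hc_zero_mem n
  have hcard' : (1 : ℝ) ≤ (Q n).card := by exact_mod_cast hcard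
  obtain ⟨G, hG⟩ : ∃ G : ℝ, G = (Q n).card * (n : ℝ) ^ p := ⟨_, rfl⟩
  have hG1 : 1 ≤ G := by
    rw [hG]
    exact one_le_mul_of_one_le_of_one_le hcard' (Real.one_le_rpow hn1 hp)
  have hKG : 0 < K * G := by positivity
  set T : ℝ := (K * G) ^ (1 / q) with hT
  have hT0 : 0 < T := by positivity
  have hTq : T ^ q = K * G := by
    rw [hT, ← Real.rpow_mul hKG.le, one_div, inv_mul_cancel₀ hq0.ne', Real.rpow_one]
  have hexp : K * G ≤ Real.exp ((3 * d + p + K) * n) := by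
    have h5 : G ≤ Real.exp (3 * d * n) * Real.exp (p * n) := by
      rw [hG]
      apply mul_le_mul _ (rpow_nat_le_exp hp) (by positivity) (by positivity)
      apply card_box hn
      intro k hk
      rw [← Finset.mem_coe, hQ n] at hk
      exact hc_abs_lt hγ hk
    calc K * G ≤ Real.exp (K * n) * (Real.exp (3 * d * n) * Real.exp (p * n)) :=
          mul_le_mul (const_le_exp hn (by linarith)) h5 (by linarith) (by positivity)
      _ = _ := by rw [← Real.exp_add, ← Real.exp_add]; congr 1; ring
  obtain ⟨hsup, hnet⟩ := hcov n hn G hG T hT0 hTq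
  have hm2 : C1 * G * (n : ℝ) ^ 2 ≤ m := by
    refine le_trans ?_ hm
    rw [hG]
    have h1 : (n : ℝ) ^ p * (n : ℝ) ^ 2 ≤ (n : ℝ) ^ W := by
      rw [← Real.rpow_two, ← Real.rpow_add hn0]
      exact Real.rpow_le_rpow_of_exponent_le hn1 hpw
    calc C1 * ((Q n).card * (n : ℝ) ^ p) * (n : ℝ) ^ 2
        = C1 * (Q n).card * ((n : ℝ) ^ p * (n : ℝ) ^ 2) := by ring
      _ ≤ _ := by gcongr
  have hm0 : (0 : ℝ) < m := lt_of_lt_of_le (by positivity) hm2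
  obtain ⟨ξ, hξ, hξf⟩ := hdisc n hn G T hG1 hT0 hTq hexp (ballq q (Q n))
    (by
      intro f hf
      refine ⟨?_, hsup f hf, hf.2⟩
      obtain ⟨⟨c, rfl⟩, _⟩ := hf
      exact ts_continuous _ _) hnet m hm2
  refine ⟨ξ, hξ, ?_⟩
  intro f hf
  obtain ⟨c, rfl⟩ := trigPoly_ts (hQ n) hf
  set I : ℝ := ∫ x, ‖ts (Q n) c x‖ ^ q ∂(torusMeasure d) with hI
  have hI0 : 0 ≤ I := integral_nonneg fun x => by positivity
  have hLq : torusLq d q (ts (Q n) c) ^ q = I := by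
    unfold torusLq
    rw [← hI, ← Real.rpow_mul hI0, one_div, inv_mul_cancel₀ hq0.ne', Real.rpow_one]
  rw [hLq]
  have hint : ∀ lam : ℝ, 0 ≤ lam → ∫ x, ‖(lam : ℂ) * ts (Q n) c x‖ ^ q ∂(torusMeasure d) = lam ^ q * I := by
    intro lam hl
    simp only [(smul_ts_mem hq (Q n) c hl).2]
    rw [integral_const_mul]
  rcases hI0.eq_or_lt with h0 | hpos
  · have hz : ∀ x, ts (Q n) c x = 0 := by
      intro x
      by_contra hne
      have hnp : 0 < ‖ts (Q n) c x‖ := norm_pos_iff.2 hne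
      set lam : ℝ := 2 * T / ‖ts (Q n) c x‖ with hlam
      have hl : 0 ≤ lam := by positivity
      have hmem : (fun x => (lam : ℂ) * ts (Q n) c x) ∈ ballq q (Q n) := by
        refine ⟨(smul_ts_mem hq (Q n) c hl).1, ?_⟩
        rw [hint lam hl, ← h0]; simp
      have h1 := hsup _ hmem x
      simp only [norm_mul, Complex.norm_real, Real.norm_of_nonneg hl] at h1
      rw [hlam, div_mul_cancel₀ _ hnp.ne'] at h1
      linarith
    rw [← h0]
    simp [hz, Real.zero_rpow hq0.ne']
  · set lam : ℝ := I ^ (-(1 / q)) with hlam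
    have hl : 0 ≤ lam := by positivity
    have hlq : lam ^ q = 1 / I := by
      rw [hlam, ← Real.rpow_mul hI0, neg_mul, one_div, inv_mul_cancel₀ hq0.ne', Real.rpow_neg_one, one_div]
    have hone : ∫ x, ‖(lam : ℂ) * ts (Q n) c x‖ ^ q ∂(torusMeasure d) = 1 := by
      rw [hint lam hl, hlq]; field_simp
    have hmem : (fun x => (lam : ℂ) * ts (Q n) c x) ∈ ballq q (Q n) :=
      ⟨(smul_ts_mem hq (Q n) c hl).1, hone.le⟩
    obtain ⟨h1, h2⟩ := hξf _ hmem
    have h3 := h2 hone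
    simp only [(smul_ts_mem hq (Q n) c hl).2] at h1 h3
    rw [← Finset.mul_sum, hlq] at h1 h3
    set S := ∑ j, ‖ts (Q n) c (ξ j)‖ ^ q with hS
    rw [one_div_mul_eq_div, div_le_iff₀ hpos] at h1
    rw [one_div_mul_eq_div I, le_div_iff₀ hpos] at h3
    constructor
    · rw [one_div_mul_eq_div (m : ℝ), le_div_iff₀ hm0]
      linarith
    · rw [one_div_mul_eq_div (m : ℝ), div_le_iff₀ hm0]
      linarith
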